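/- arXiv:2408.11724 — 7 statements merged into one kernel-verified Lean document; each statement's English description precedes it below -/
import Mathlib

section
/- Let G be a group with subgroups H and K, and let I be an index set. Then the amalgamated free product of copies (H_i)_{i∈I} of H amalgamated over H ∩ K (each copy of H ∩ K identified via the same inclusion H ∩ K ↪ H) embeds (admits an injective group homomorphism) into the amalgamated free product of copies (G_i)_{i∈I} of G amalgamated over K (each copy of K identified via the same inclusion K ↪ G). -/
universe u

/-- The amalgamated free product of copies of `H` over `H ⊓ K` embeds into the
amalgamated free product of copies of `G` over `K`. -/
theorem pushoutI_inf_embeds_pushoutI {G : Type*} [Group G] (H K : Subgroup G)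
    (I : Type*) :
    ∃ f : Monoid.PushoutI
            (fun _ : I => Subgroup.inclusion (inf_le_left : H ⊓ K ≤ H)) →*
          Monoid.PushoutI (fun _ : I => K.subtype),
      Function.Injective f := by
  classical
  have hφ : ∀ i : I, Function.Injective
      ((fun _ : I => Subgroup.inclusion (inf_le_left : H ⊓ K ≤ H)) i) :=
    fun _ => Subgroup.inclusion_injective _
  have hψ : ∀ i : I, Function.Injective ((fun _ : I => K.subtype) i) :=
    fun _ => K.subtype_injective
  let f : Monoid.PushoutI
            (fun _ : I => Subgroup.inclusion (inf_le_left : H ⊓ K ≤ H)) →*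
          Monoid.PushoutI (fun _ : I => K.subtype) :=
    Monoid.PushoutI.lift
      (fun i => (Monoid.PushoutI.of (φ := fun _ : I => K.subtype) i).comp H.subtype)
      ((Monoid.PushoutI.base (fun _ : I => K.subtype)).comp
        (Subgroup.inclusion (inf_le_right : H ⊓ K ≤ K)))
      (by
        intro i
        ext x
        exact Monoid.PushoutI.of_apply_eq_base (fun _ : I => K.subtype) i
          (Subgroup.inclusion (inf_le_right : H ⊓ K ≤ K) x))
  refine ⟨f, (injective_iff_map_eq_one f).2 ?_⟩
  intro x hx
  obtain ⟨d⟩ := Monoid.PushoutI.NormalWord.transversal_nonempty _ hφ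
  obtain ⟨w, rfl⟩ := (Monoid.PushoutI.NormalWord.equiv (d := d)).symm.surjective x
  change f w.prod = 1 at hx
  change w.prod = 1
  let w' : Monoid.CoprodI.Word (fun _ : I => G) :=
    { toList := w.toList.map (fun p => ⟨p.1, (p.2 : G)⟩)
      ne_one := by
        intro l hl
        obtain ⟨p, hp, rfl⟩ := List.mem_map.1 hl
        intro h
        exact w.ne_one p hp (Subtype.ext h)
      chain_ne := by
        rw [List.isChain_map]
        exact w.chain_ne }
  have hfl : ∀ l : List (Σ _ : I, H),
      f (Monoid.PushoutI.ofCoprodI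
        (l.map fun p => (Monoid.CoprodI.of (M := fun _ : I => H) (i := p.1) p.2)).prod) =
      Monoid.PushoutI.ofCoprodI ((l.map (fun p => (⟨p.1, (p.2 : G)⟩ : Σ _ : I, G))).map
        fun p => (Monoid.CoprodI.of (M := fun _ : I => G) (i := p.1) p.2)).prod := by
    intro l
    induction l with
    | nil => simp
    | cons a l ih =>
      simp only [List.map_cons, List.prod_cons, map_mul, ih, Monoid.PushoutI.ofCoprodI_of]
      congr 1
  have hw : f (Monoid.PushoutI.ofCoprodI w.toWord.prod) =
      Monoid.PushoutI.ofCoprodI w'.prod := hfl w.toList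
  have hred : Monoid.PushoutI.Reduced (fun _ : I => K.subtype) w' := by
    intro l hl
    obtain ⟨p, hp, rfl⟩ := List.mem_map.1 hl
    rintro ⟨k, hk⟩
    have hk' : (k : G) = (p.2 : G) := hk
    have hr : p.2 ∈ (Subgroup.inclusion (inf_le_left : H ⊓ K ≤ H)).range :=
      ⟨⟨p.2, p.2.2, hk' ▸ k.2⟩, rfl⟩
    have h1 := (Subgroup.IsComplement.coe_equiv_snd_eq_one_iff_mem (d.compl p.1)
      (d.one_mem p.1)).2 hr
    have h2 := (Subgroup.IsComplement.equiv_snd_eq_self_iff_mem (d.compl p.1)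
      (one_mem _)).2 (w.normalized p.1 p.2 hp)
    exact w.ne_one p hp (h2.symm.trans h1)
  have hprod : w.prod = Monoid.PushoutI.base _ w.head *
      Monoid.PushoutI.ofCoprodI w.toWord.prod := rfl
  have hb : ∀ h, f (Monoid.PushoutI.base _ h) = Monoid.PushoutI.base (fun _ : I => K.subtype)
      (Subgroup.inclusion (inf_le_right : H ⊓ K ≤ K) h) := by
    intro h
    simp [f]
  rw [hprod, map_mul, hw, hb] at hx
  have hemp : w' = .empty := hred.eq_empty_of_mem_range hψ
    ⟨(Subgroup.inclusion (inf_le_right : H ⊓ K ≤ K) w.head)⁻¹, by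
      rw [map_inv]; exact inv_eq_of_mul_eq_one_right hx⟩
  have hwe : w.toWord = .empty := by
    have := congrArg Monoid.CoprodI.Word.toList hemp
    ext1
    exact List.map_eq_nil_iff.1 this
  rw [hemp, Monoid.CoprodI.Word.prod_empty, map_one, mul_one] at hx
  have h1 : Subgroup.inclusion (inf_le_right : H ⊓ K ≤ K) w.head = 1 :=
    Monoid.PushoutI.base_injective hψ (hx.trans (map_one _).symm)
  have h2 : w.head = 1 := Subgroup.inclusion_injective inf_le_right (h1.trans (map_one _).symm)
  rw [hprod, h2, hwe]
  simp
end

section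
/- Let H < G be a pair of groups, K be a group, and I be an index set. Then the amalgamated free product of copies of G × K indexed by I amalgamated over H × K (each copy of H × K identified via the same inclusion H × K ↪ G × K) embeds (admits an injective group homomorphism) into the direct product (∗_H^I G) × K, where ∗_H^I G is the amalgamated free product of copies of G indexed by I amalgamated over H. -/
universe u

/-- The amalgamated free product of copies of `G × K` over `H × K` embeds into
`(∗_H^I G) × K`. -/
theorem pushoutI_prod_embeds {G K : Type*} [Group G] [Group K] (H : Subgroup G)
    (I : Type*) :
    ∃ f : Monoid.PushoutI
            (fun _ : I => MonoidHom.prodMap H.subtype (MonoidHom.id K)) →*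
          (Monoid.PushoutI (fun _ : I => H.subtype)) × K,
      Function.Injective f := by
  let φ : I → (H × K →* G × K) := fun _ => MonoidHom.prodMap H.subtype (MonoidHom.id K)
  let ψ : I → (H →* G) := fun _ => H.subtype
  let f : Monoid.PushoutI φ →* Monoid.PushoutI ψ × K :=
    Monoid.PushoutI.lift
      (fun i => MonoidHom.prodMap (Monoid.PushoutI.of (φ := ψ) i) (MonoidHom.id K))
      (MonoidHom.prodMap (Monoid.PushoutI.base ψ) (MonoidHom.id K))
      (fun i => by
        refine MonoidHom.ext fun x => Prod.ext ?_ rfl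
        exact Monoid.PushoutI.of_apply_eq_base ψ i x.1)
  let g : Monoid.PushoutI ψ →* Monoid.PushoutI φ :=
    Monoid.PushoutI.lift
      (fun i => (Monoid.PushoutI.of (φ := φ) i).comp (MonoidHom.inl G K))
      ((Monoid.PushoutI.base φ).comp (MonoidHom.inl H K))
      (fun i => by
        refine MonoidHom.ext fun x => ?_
        exact Monoid.PushoutI.of_apply_eq_base φ i (x, 1))
  let b : K →* Monoid.PushoutI φ := (Monoid.PushoutI.base φ).comp (MonoidHom.inr H K)
  have hb : ∀ i k, b k = Monoid.PushoutI.of (φ := φ) i ((1 : G), k) := fun i k =>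
    (Monoid.PushoutI.of_apply_eq_base φ i ((1 : H), k)).symm
  have hgo : ∀ i (a : G), g (Monoid.PushoutI.of (φ := ψ) i a)
      = Monoid.PushoutI.of (φ := φ) i (a, (1 : K)) := fun i a =>
    Monoid.PushoutI.lift_of (φ := ψ) _ _ _ a
  have hgb : ∀ h : H, g (Monoid.PushoutI.base ψ h)
      = Monoid.PushoutI.base φ (h, (1 : K)) := fun h =>
    Monoid.PushoutI.lift_base (φ := ψ) _ _ _ h
  have hfo : ∀ i (a : G × K), f (Monoid.PushoutI.of (φ := φ) i a)
      = (Monoid.PushoutI.of (φ := ψ) i a.1, a.2) := fun i a =>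
    Monoid.PushoutI.lift_of (φ := φ) _ _ _ a
  have hfb : ∀ h : H × K, f (Monoid.PushoutI.base φ h)
      = (Monoid.PushoutI.base ψ h.1, h.2) := fun h =>
    Monoid.PushoutI.lift_base (φ := φ) _ _ _ h
  have hc : ∀ k x, Commute (b k) (g x) := by
    intro k x
    induction x using Monoid.PushoutI.induction_on with
    | of i a =>
      rw [hb i, hgo, Commute, SemiconjBy, ← map_mul, ← map_mul]
      simp
    | base h =>
      rw [hgb, Commute, SemiconjBy]
      change Monoid.PushoutI.base φ (1, k) * _ = _ * Monoid.PushoutI.base φ (1, k)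
      rw [← map_mul, ← map_mul]
      simp
    | mul x y hx hy => rw [map_mul]; exact hx.mul_right hy
  have key : ∀ x, g (f x).1 * b (f x).2 = x := by
    intro x
    induction x using Monoid.PushoutI.induction_on with
    | of i a =>
      rw [hfo, hgo, hb i, ← map_mul]
      simp
    | base h =>
      rw [hfb, hgb]
      change _ * Monoid.PushoutI.base φ (1, h.2) = _
      rw [← map_mul]
      simp
    | mul x y hx hy =>
      rw [map_mul, Prod.fst_mul, Prod.snd_mul, map_mul, map_mul]
      rw [(hc _ _).symm.mul_mul_mul_comm, hx, hy]
  refine ⟨f, fun x y hxy => ?_⟩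
  rw [← key x, ← key y, hxy]
end

section
/- Let (H_i < G_i)_{i∈ℕ} be a sequence of inclusions of groups, ω a free ultrafilter on ℕ, and let 𝐆 = ∏_ω G_i and 𝐇 = ∏_ω H_i be the algebraic ultraproducts, with 𝐇 viewed as a subgroup of 𝐆. Then for any index set I, the amalgamated free product of copies of 𝐆 indexed by I amalgamated over 𝐇 embeds (admits an injective group homomorphism) into the algebraic ultraproduct ∏_ω (∗_{H_i}^I G_i), where ∗_{H_i}^I G_i is the amalgamated free product of copies of G_i indexed by I amalgamated over H_i. -/
universe u

/-- The subgroup of sequences equal to the identity ω-almost everywhere. -/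
def upKer {ι : Type*} (ω : Ultrafilter ι) (G : ι → Type*) [∀ i, Group (G i)] :
    Subgroup (∀ i, G i) where
  carrier := {f | ∀ᶠ i in (ω : Filter ι), f i = 1}
  one_mem' := Filter.Eventually.of_forall fun _ => rfl
  mul_mem' := by
    intro a b ha hb
    filter_upwards [ha, hb] with i h1 h2
    simp [h1, h2]
  inv_mem' := by
    intro a ha
    filter_upwards [ha] with i h1
    simp [h1]

instance upKer_normal {ι : Type*} (ω : Ultrafilter ι) (G : ι → Type*) [∀ i, Group (G i)] :
    (upKer ω G).Normal := by
  constructor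
  intro a ha g
  filter_upwards [ha] with i h1
  simp [h1]

/-- The algebraic ultraproduct of a family of groups along an ultrafilter. -/
def Ultraproduct {ι : Type*} (ω : Ultrafilter ι) (G : ι → Type*) [∀ i, Group (G i)] :=
  (∀ i, G i) ⧸ upKer ω G

instance {ι : Type*} (ω : Ultrafilter ι) (G : ι → Type*) [∀ i, Group (G i)] :
    Group (Ultraproduct ω G) :=
  QuotientGroup.Quotient.group _

/-- The subgroup `∏_ω H_i` of the algebraic ultraproduct `∏_ω G_i`. -/
def upSubgroup {ι : Type*} (ω : Ultrafilter ι) {G : ι → Type*} [∀ i, Group (G i)]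
    (H : ∀ i, Subgroup (G i)) : Subgroup (Ultraproduct ω G) :=
  Subgroup.map (QuotientGroup.mk' (upKer ω G)) (Subgroup.pi Set.univ H)


/-- The quotient map onto the ultraproduct. -/
def umk {ι : Type*} (ω : Ultrafilter ι) (G : ι → Type*) [∀ i, Group (G i)] :
    (∀ i, G i) →* Ultraproduct ω G := QuotientGroup.mk' (upKer ω G)

theorem umk_surj {ι : Type*} (ω : Ultrafilter ι) (G : ι → Type*) [∀ i, Group (G i)] :
    Function.Surjective (umk ω G) := QuotientGroup.mk'_surjective _

theorem umk_eq_one {ι : Type*} (ω : Ultrafilter ι) (G : ι → Type*) [∀ i, Group (G i)]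
    (a : ∀ i, G i) : umk ω G a = 1 ↔ ∀ᶠ i in (ω : Filter ι), a i = 1 :=
  QuotientGroup.eq_one_iff (N := upKer ω G) a

theorem umk_eq {ι : Type*} (ω : Ultrafilter ι) (G : ι → Type*) [∀ i, Group (G i)]
    (a b : ∀ i, G i) : umk ω G a = umk ω G b ↔ ∀ᶠ i in (ω : Filter ι), a i = b i := by
  rw [← mul_inv_eq_one, ← map_inv, ← map_mul, umk_eq_one]
  simp [mul_inv_eq_one]

theorem mem_upSubgroup {ι : Type*} (ω : Ultrafilter ι) {G : ι → Type*} [∀ i, Group (G i)]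
    (H : ∀ i, Subgroup (G i)) (x : Ultraproduct ω G) :
    x ∈ upSubgroup ω H ↔ ∃ h : ∀ i, H i, umk ω G (fun i => (h i : G i)) = x := by
  constructor
  · rintro ⟨a, ha, rfl⟩
    exact ⟨fun i => ⟨a i, ha i (Set.mem_univ i)⟩, rfl⟩
  · rintro ⟨h, rfl⟩
    exact ⟨fun i => (h i : G i), fun i _ => (h i).2, rfl⟩

theorem umk_mem_of_eventually {ι : Type*} (ω : Ultrafilter ι) {G : ι → Type*} [∀ i, Group (G i)]
    (H : ∀ i, Subgroup (G i)) (a : ∀ i, G i) (ha : ∀ᶠ i in (ω : Filter ι), a i ∈ H i) :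
    umk ω G a ∈ upSubgroup ω H := by
  classical
  rw [mem_upSubgroup]
  refine ⟨fun i => if h : a i ∈ H i then ⟨a i, h⟩ else 1, ?_⟩
  rw [umk_eq]
  filter_upwards [ha] with i hi
  simp [hi]

/-- Functoriality of ultraproducts. -/
theorem umap_exists {ι : Type*} (ω : Ultrafilter ι) {G K : ι → Type*} [∀ i, Group (G i)]
    [∀ i, Group (K i)] (φ : ∀ i, G i →* K i) :
    ∃ F : Ultraproduct ω G →* Ultraproduct ω K,
      ∀ a, F (umk ω G a) = umk ω K (fun i => φ i (a i)) := by
  refine ⟨MonoidHom.mk' (fun x => umk ω K (fun i => φ i (Function.surjInv (umk_surj ω G) x i)))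
    ?_, ?_⟩
  · intro x y
    rw [← map_mul, umk_eq]
    have : umk ω G (Function.surjInv (umk_surj ω G) (x * y)) =
      umk ω G (Function.surjInv (umk_surj ω G) x * Function.surjInv (umk_surj ω G) y) := by
      simp [Function.surjInv_eq]
    rw [umk_eq] at this
    filter_upwards [this] with i hi
    simp [hi]
  · intro a
    change umk ω K _ = _
    have : umk ω G (Function.surjInv (umk_surj ω G) (umk ω G a)) = umk ω G a := by
      simp [Function.surjInv_eq]
    rw [umk_eq] at this ⊢
    filter_upwards [this] with i hi
    simp [hi]

theorem ubase_exists {ι : Type*} (ω : Ultrafilter ι) {G K : ι → Type*} [∀ i, Group (G i)]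
    [∀ i, Group (K i)] (H : ∀ i, Subgroup (G i)) (φ : ∀ i, H i →* K i) :
    ∃ F : upSubgroup ω H →* Ultraproduct ω K,
      ∀ (x : upSubgroup ω H) (h : ∀ i, H i), umk ω G (fun i => (h i : G i)) = x →
        F x = umk ω K (fun i => φ i (h i)) := by
  choose r hr using fun x : upSubgroup ω H => (mem_upSubgroup ω H x).1 x.2
  have key : ∀ (x : upSubgroup ω H) (h : ∀ i, H i), umk ω G (fun i => (h i : G i)) = x →
        umk ω K (fun i => φ i (r x i)) = umk ω K (fun i => φ i (h i)) := by
    intro x h hx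
    rw [← hr x, umk_eq] at hx
    rw [umk_eq]
    filter_upwards [hx] with i hi
    rw [Subtype.ext hi]
  refine ⟨MonoidHom.mk' (fun x => umk ω K (fun i => φ i (r x i))) ?_, key⟩
  intro x y
  rw [key (x * y) (fun i => r x i * r y i), ← map_mul]
  · congr 1
    ext i
    simp
  · rw [Subgroup.coe_mul, ← hr x, ← hr y, ← map_mul]
    rfl

theorem ultra_aux (G : ℕ → Type) [∀ i, Group (G i)]
    (H : ∀ i, Subgroup (G i)) (ω : Ultrafilter ℕ) (I : Type) :
    ∃ f : Monoid.PushoutI (fun _ : I => (upSubgroup ω H).subtype) →*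
          Ultraproduct ω (fun i => Monoid.PushoutI (fun _ : I => (H i).subtype)),
      Function.Injective f := by
  classical
  obtain ⟨k, hk⟩ := ubase_exists ω H
    (fun i => Monoid.PushoutI.base (fun _ : I => (H i).subtype))
  choose F hF using fun j : I => umap_exists ω
    (fun i => Monoid.PushoutI.of (G := fun _ : I => G i) (φ := fun _ : I => (H i).subtype) j)
  have hcomp : ∀ j, (F j).comp (upSubgroup ω H).subtype = k := by
    intro j
    ext x
    obtain ⟨h, hx⟩ := (mem_upSubgroup ω H x).1 x.2
    rw [hk x h hx, MonoidHom.comp_apply, Subgroup.subtype_apply, ← hx, hF]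
    congr 1
    ext i
    exact Monoid.PushoutI.of_apply_eq_base (fun _ : I => (H i).subtype) j (h i)
  refine ⟨Monoid.PushoutI.lift F k hcomp, ?_⟩
  rw [injective_iff_map_eq_one]
  intro x hx
  obtain ⟨d⟩ := Monoid.PushoutI.NormalWord.transversal_nonempty
    (fun _ : I => (upSubgroup ω H).subtype) (fun _ => Subtype.val_injective)
  obtain ⟨w, rfl⟩ := (Monoid.PushoutI.NormalWord.equiv (d := d)).symm.surjective x
  change Monoid.PushoutI.lift F k hcomp w.prod = 1 at hx
  change w.prod = 1
  obtain ⟨h, hh⟩ := (mem_upSubgroup ω H w.head).1 w.head.2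
  choose r hr using umk_surj ω G
  have hlist : ∀ l : List (Σ _ : I, Ultraproduct ω G),
      Monoid.PushoutI.lift F k hcomp (Monoid.PushoutI.ofCoprodI
        (l.map fun p => Monoid.CoprodI.of (M := fun _ : I => Ultraproduct ω G) (i := p.1) p.2).prod)
      = umk ω _ (fun i => Monoid.PushoutI.ofCoprodI (φ := fun _ : I => (H i).subtype)
        (l.map fun p => Monoid.CoprodI.of (M := fun _ : I => G i) (i := p.1) (r p.2 i)).prod) := by
    intro l
    induction l with
    | nil =>
      simp only [List.map_nil, List.prod_nil, map_one]
      exact (map_one _).symm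
    | cons p l ih =>
      simp only [List.map_cons, List.prod_cons, map_mul, ih, Monoid.PushoutI.ofCoprodI_of,
        Monoid.PushoutI.lift_of]
      conv_lhs => rw [← hr p.2, hF, ← map_mul]
      rfl
  have hred : ∀ p ∈ w.toList, p.2 ∉ upSubgroup ω H := by
    rintro ⟨j, g⟩ hp hg
    have h1 := w.normalized j g hp
    have h2 : g ≠ 1 := w.ne_one _ hp
    have h3 := (Subgroup.IsComplement.equiv_snd_eq_self_iff_mem (d.compl j)
      (one_mem _)).2 h1
    have h4 := (Subgroup.IsComplement.coe_equiv_snd_eq_one_iff_mem (d.compl j)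
      (d.one_mem j) (g := g)).2 (by simpa using hg)
    exact h2 (h3.symm.trans h4)
  have hev : ∀ᶠ i in (ω : Filter ℕ), ∀ p ∈ w.toList, r p.2 i ∉ H i := by
    have : ∀ᶠ i in (ω : Filter ℕ), ∀ p ∈ {p | p ∈ w.toList}, r p.2 i ∉ H i := by
      rw [Filter.eventually_all_finite (List.finite_toSet _)]
      intro p hp
      rw [Ultrafilter.eventually_not]
      intro hc
      apply hred p hp
      rw [← hr p.2]
      exact umk_mem_of_eventually ω H _ hc
    exact this
  have hprod : Monoid.PushoutI.lift F k hcomp w.prod =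
      umk ω _ (fun i => Monoid.PushoutI.base (fun _ : I => (H i).subtype) (h i) *
       Monoid.PushoutI.ofCoprodI (φ := fun _ : I => (H i).subtype)
        (w.toList.map fun p =>
          Monoid.CoprodI.of (M := fun _ : I => G i) (i := p.1) (r p.2 i)).prod) := by
    rw [Monoid.PushoutI.NormalWord.prod, map_mul, Monoid.PushoutI.lift_base, hk _ h hh]
    erw [hlist w.toList]
    rw [← map_mul]
    rfl
  rw [hprod, umk_eq_one] at hx
  have hnil : w.toList = [] := by
    obtain ⟨i, hi, hxi⟩ := (hev.and hx).exists
    let w' : Monoid.CoprodI.Word (fun _ : I => G i) :=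
      { toList := w.toList.map fun p => ⟨p.1, r p.2 i⟩
        ne_one := by
          intro l hl
          obtain ⟨p, hp, rfl⟩ := List.mem_map.1 hl
          intro h1
          apply hi p hp
          simp only at h1
          rw [h1]
          exact one_mem _
        chain_ne := by
          rw [List.isChain_map]
          exact w.chain_ne }
    have hw' : Monoid.PushoutI.Reduced (fun _ : I => (H i).subtype) w' := by
      intro l hl
      obtain ⟨p, hp, rfl⟩ := List.mem_map.1 hl
      simpa using hi p hp
    have := hw'.eq_empty_of_mem_range (fun _ => Subtype.val_injective) (by
      refine ⟨(h i)⁻¹, ?_⟩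
      rw [map_inv, inv_eq_iff_mul_eq_one, ← hxi]
      simp only [w', Monoid.CoprodI.Word.prod, List.map_map]
      rfl)
    have := congrArg Monoid.CoprodI.Word.toList this
    simpa [w', Monoid.CoprodI.Word.empty] using this
  have hhead : w.head = 1 := by
    apply Subtype.ext
    rw [← hh]
    refine (umk_eq_one ω G _).2 ?_
    filter_upwards [hx] with i hi
    simp only [hnil, List.map_nil, List.prod_nil, map_one, mul_one] at hi
    have := Monoid.PushoutI.base_injective (φ := fun _ : I => (H i).subtype)
      (fun _ => Subtype.val_injective) (hi.trans (map_one _).symm)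
    rw [this]; rfl
  rw [Monoid.PushoutI.NormalWord.prod, hhead, Monoid.CoprodI.Word.prod, hnil]
  simp

/-- The amalgamated free product of copies of the ultraproduct `𝐆 = ∏_ω G_i` over the
ultraproduct `𝐇 = ∏_ω H_i` embeds into the ultraproduct `∏_ω (∗_{H_i}^I G_i)`. -/
theorem pushoutI_ultraproduct_embeds (G : ℕ → Type) [∀ i, Group (G i)]
    (H : ∀ i, Subgroup (G i)) (ω : Ultrafilter ℕ)
    (hω : ∀ s : Set ℕ, s.Finite → s ∉ ω) (I : Type) :
    ∃ f : Monoid.PushoutI (fun _ : I => (upSubgroup ω H).subtype) →*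
          Ultraproduct ω (fun i => Monoid.PushoutI (fun _ : I => (H i).subtype)),
      Function.Injective f := by
  exact ultra_aux G H ω I
end

section
/- Let G be a countable discrete group, (H_i)_{i∈ℕ} a sequence of sofic groups, and ω a free ultrafilter on ℕ. If G embeds (admits an injective group homomorphism) into the algebraic ultraproduct ∏_ω H_i, then G is sofic. -/
universe u

/-- Normalized Hamming distance between two permutations of a (finite) type. -/
noncomputable def permDist {A : Type*} (σ τ : Equiv.Perm A) : ℝ :=
  (Set.ncard {a | σ a ≠ τ a} : ℝ) / (Nat.card A : ℝ)

/-- A group is sofic if every finite subset admits `(F, ε)`-approximations by permutations. -/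
def IsSofic (G : Type*) [Group G] : Prop :=
  ∀ (F : Finset G) (ε : ℝ), 0 < ε →
    ∃ A : Type, Finite A ∧ Nonempty A ∧ ∃ φ : G → Equiv.Perm A,
      φ 1 = 1 ∧
      (∀ g ∈ F, ∀ h ∈ F, permDist (φ (g * h)) (φ g * φ h) < ε) ∧
      (∀ g ∈ F, g ≠ 1 → 1 - ε < permDist (φ g) 1)


/-- If a countable group embeds into an algebraic ultraproduct of sofic groups along a
free ultrafilter, then it is sofic. -/
theorem isSofic_of_embeds_ultraproduct (G : Type*) [Group G] [Countable G]
    (H : ℕ → Type) [∀ i, Group (H i)] (hH : ∀ i, IsSofic (H i))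
    (ω : Ultrafilter ℕ) (hω : ∀ s : Set ℕ, s.Finite → s ∉ ω)
    (f : G →* Ultraproduct ω H) (hf : Function.Injective f) :
    IsSofic G := by
  classical
  have hlift : ∀ g : G, ∃ x : ∀ i, H i, QuotientGroup.mk' (upKer ω H) x = f g ∧ (g = 1 → x = 1) := by
    intro g
    by_cases hg : g = 1
    · refine ⟨1, ?_, fun _ => rfl⟩
      subst hg
      rw [map_one, map_one]
      rfl
    · obtain ⟨x, hx⟩ := QuotientGroup.mk'_surjective (upKer ω H) (f g)
      exact ⟨x, hx, fun h => absurd h hg⟩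
  choose s hs hs1 using hlift
  have hmul : ∀ g h : G, ∀ᶠ i in (ω : Filter ℕ), s (g * h) i = s g i * s h i := by
    intro g h
    have h1 : QuotientGroup.mk' (upKer ω H) (s (g * h))
        = QuotientGroup.mk' (upKer ω H) (s g * s h) := by
      rw [map_mul, hs, hs, hs, map_mul]
      rfl
    have h2 : (s (g * h))⁻¹ * (s g * s h) ∈ upKer ω H := QuotientGroup.eq.mp h1
    have h3 : ∀ᶠ i in (ω : Filter ℕ), ((s (g * h))⁻¹ * (s g * s h)) i = 1 := h2
    filter_upwards [h3] with i hi
    exact inv_mul_eq_one.mp hi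
  have hne : ∀ g : G, g ≠ 1 → ∀ᶠ i in (ω : Filter ℕ), s g i ≠ 1 := by
    intro g hg
    refine Ultrafilter.eventually_not.mpr fun hc => hg (hf ?_)
    have h2 : s g ∈ upKer ω H := hc
    rw [← hs g, map_one]
    exact (QuotientGroup.eq_one_iff _).mpr h2
  intro F ε hε
  have e1 : ∀ᶠ i in (ω : Filter ℕ), ∀ g ∈ F, ∀ h ∈ F, s (g * h) i = s g i * s h i :=
    (Filter.eventually_all_finset F).mpr fun g _ =>
      (Filter.eventually_all_finset F).mpr fun h _ => hmul g h
  have e2 : ∀ᶠ i in (ω : Filter ℕ), ∀ g ∈ F, g ≠ 1 → s g i ≠ 1 := by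
    refine (Filter.eventually_all_finset F).mpr fun g _ => ?_
    by_cases hg : g = 1
    · exact Filter.Eventually.of_forall fun _ h => absurd hg h
    · filter_upwards [hne g hg] with i hi _ using hi
  obtain ⟨i, hi1, hi2⟩ := (e1.and e2).exists
  obtain ⟨A, hA, hA', ψ, p1, p2, p3⟩ := hH i (F.image fun g => s g i) ε hε
  refine ⟨A, hA, hA', fun g => ψ (s g i), ?_, ?_, ?_⟩
  · simp only [hs1 1 rfl, Pi.one_apply, p1]
  · intro g hg h hh
    simp only [hi1 g hg h hh]
    exact p2 _ (Finset.mem_image_of_mem _ hg) _ (Finset.mem_image_of_mem _ hh)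
  · intro g hg hg1
    exact p3 _ (Finset.mem_image_of_mem _ hg) (hi2 g hg hg1)
end

section
/- Let H < G be a pair of countable groups and K a sofic group. If H < G is relatively sofic over K, then the amalgamated free product ∗_H G of countably infinitely many copies of G amalgamated over H (each copy of H identified via the same inclusion H ↪ G) is sofic. -/
universe u

/-- A group is amenable if it carries a left-invariant finitely additive
probability measure defined on all subsets. -/
def IsAmenable (G : Type*) [Group G] : Prop :=
  ∃ m : Set G → ℝ,
    (∀ A : Set G, 0 ≤ m A) ∧
    m Set.univ = 1 ∧
    (∀ A B : Set G, Disjoint A B → m (A ∪ B) = m A + m B) ∧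
    (∀ (g : G) (A : Set G), m ((g * ·) '' A) = m A)


/-- A witness to relative soficity of `H < G` over `K`. -/
structure RelSoficWitness {G : Type*} [Group G] (H : Subgroup G) (K : Type*) [Group K] where
  Gi : ℕ → Type u
  [instGi : ∀ i, Group (Gi i)]
  Hi : ∀ i, Subgroup (Gi i)
  ω : Ultrafilter ℕ
  free : ∀ s : Set ℕ, s.Finite → s ∉ ω
  sofic : ∀ i, IsSofic (Gi i)
  amenable : ∀ i, IsAmenable (Hi i)
  π : G →* Ultraproduct ω (fun i => Gi i × K)
  inj : Function.Injective π
  inter : Subgroup.map π ⊤ ⊓ upSubgroup ω (fun i => (Hi i).prod ⊤) = Subgroup.map π H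

/-- `H < G` is relatively sofic over `K`. -/
def RelativelySofic {G : Type*} [Group G] (H : Subgroup G) (K : Type*) [Group K] : Prop :=
  Nonempty (RelSoficWitness.{u} H K)


/-- density of a set in a finite type -/
noncomputable def dens {X : Type*} (s : Set X) : ℝ := (s.ncard : ℝ) / (Nat.card X : ℝ)

lemma dens_nonneg {X : Type*} (s : Set X) : 0 ≤ dens s := by unfold dens; positivity

lemma dens_mono {X : Type*} [Finite X] {s t : Set X} (h : s ⊆ t) : dens s ≤ dens t := by
  unfold dens
  have := Set.ncard_le_ncard h
  gcongr

lemma dens_union_le {X : Type*} (s t : Set X) : dens (s ∪ t) ≤ dens s + dens t := by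
  unfold dens
  rw [← add_div]
  have := Set.ncard_union_le s t
  gcongr
  exact_mod_cast this

lemma dens_empty {X : Type*} : dens (∅ : Set X) = 0 := by simp [dens]

lemma dens_biUnion_le {X ι : Type*} [Finite X] (S : Finset ι) (f : ι → Set X) :
    dens (⋃ i ∈ S, f i) ≤ ∑ i ∈ S, dens (f i) := by
  classical
  induction S using Finset.induction_on with
  | empty => simp [dens_empty]
  | insert a S ha ih =>
    rw [Finset.sum_insert ha, Finset.set_biUnion_insert]
    exact (dens_union_le _ _).trans (by gcongr)

lemma dens_le_of_cover {X ι : Type*} [Finite X] (S : Finset ι) (f : ι → Set X) (s : Set X) (δ : ℝ)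
    (hs : ∀ x ∈ s, ∃ i ∈ S, x ∈ f i) (hf : ∀ i ∈ S, dens (f i) ≤ δ) : dens s ≤ S.card * δ := by
  have h1 : s ⊆ ⋃ i ∈ S, f i := by
    intro x hx
    obtain ⟨i, hi, h⟩ := hs x hx
    simp only [Set.mem_iUnion]
    exact ⟨i, hi, h⟩
  refine (dens_mono h1).trans ((dens_biUnion_le S f).trans ?_)
  have := Finset.sum_le_card_nsmul S (fun i => dens (f i)) δ hf
  simpa using this

lemma dens_preimage_perm {X : Type*} (σ : Equiv.Perm X) (s : Set X) :
    dens {x | σ x ∈ s} = dens s := by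
  unfold dens
  congr 2
  have : {x | σ x ∈ s} = σ.symm '' s := by
    ext x; simp
  rw [this, Set.ncard_image_of_injective _ σ.symm.injective]

lemma dens_compl {X : Type*} [Finite X] [Nonempty X] (s : Set X) : dens sᶜ = 1 - dens s := by
  unfold dens
  have h := Set.ncard_add_ncard_compl s
  have h0 : (0:ℝ) < Nat.card X := by exact_mod_cast Nat.card_pos
  have : ((s.ncard : ℝ) + sᶜ.ncard) = Nat.card X := by exact_mod_cast h
  field_simp
  linarith

lemma dens_fiber {A Z : Type*} [Finite A] [Finite Z] [Nonempty A] [Nonempty Z] (s : Set (A × Z))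
    (bad : Set A) (ε : ℝ) (hε : 0 ≤ ε) (h : ∀ a, a ∉ bad → dens {z | (a, z) ∈ s} ≤ ε) :
    dens s ≤ dens bad + ε := by
  classical
  have := Fintype.ofFinite A
  have := Fintype.ofFinite Z
  have hA : (0:ℝ) < Nat.card A := by exact_mod_cast Nat.card_pos
  have hZ : (0:ℝ) < Nat.card Z := by exact_mod_cast Nat.card_pos
  have h1 : s.ncard = ∑ a : A, {z | (a, z) ∈ s}.ncard := by
    rw [← Nat.card_coe_set_eq]
    have e : s ≃ Σ a : A, {z | (a, z) ∈ s} :=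
      { toFun := fun x => ⟨x.1.1, x.1.2, x.2⟩
        invFun := fun x => ⟨(x.1, x.2.1), x.2.2⟩
        left_inv := fun x => rfl
        right_inv := fun x => rfl }
    rw [Nat.card_congr e, Nat.card_sigma]
    rfl
  have h2 : (s.ncard : ℝ) ≤ ∑ a : A, ((if a ∈ bad then (Nat.card Z : ℝ) else 0) + ε * Nat.card Z) := by
    rw [h1]; push_cast
    apply Finset.sum_le_sum
    intro a _
    by_cases ha : a ∈ bad
    · rw [if_pos ha]
      have : {z | (a, z) ∈ s}.ncard ≤ Nat.card Z := Set.ncard_le_card _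
      have : ({z | (a, z) ∈ s}.ncard : ℝ) ≤ Nat.card Z := by exact_mod_cast this
      nlinarith [mul_nonneg hε hZ.le]
    · rw [if_neg ha]
      have := h a ha
      unfold dens at this
      rw [div_le_iff₀ hZ] at this
      linarith
  have h3 : ∑ a : A, ((if a ∈ bad then (Nat.card Z : ℝ) else 0) + ε * Nat.card Z)
      = bad.ncard * Nat.card Z + Nat.card A * (ε * Nat.card Z) := by
    rw [Finset.sum_add_distrib, ← Finset.sum_filter, Finset.sum_const, Finset.sum_const,
      Set.ncard_eq_toFinset_card' bad]
    simp [Set.toFinset]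
  rw [h3] at h2
  unfold dens
  rw [Nat.card_prod]
  push_cast
  rw [div_add' _ _ _ hA.ne', div_le_div_iff₀ (by positivity) hA]
  nlinarith

lemma dens_fst {A Z : Type*} [Finite A] [Finite Z] [Nonempty A] [Nonempty Z] (s : Set A) :
    dens {x : A × Z | x.1 ∈ s} ≤ dens s := by
  have := dens_fiber {x : A × Z | x.1 ∈ s} s 0 le_rfl (by
    intro a ha; simp [ha, dens_empty])
  simpa using this

lemma dens_snd {A Z : Type*} [Finite A] [Finite Z] [Nonempty A] [Nonempty Z] (s : Set Z) :
    dens {x : A × Z | x.2 ∈ s} ≤ dens s := by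
  have := dens_fiber {x : A × Z | x.2 ∈ s} ∅ (dens s) (dens_nonneg _) (by
    intro a ha; exact le_of_eq rfl)
  simpa [dens_empty] using this

lemma permDist_eq_dens {A : Type*} (σ τ : Equiv.Perm A) : permDist σ τ = dens {a | σ a ≠ τ a} := rfl

lemma permDist_one_gt {A : Type*} [Finite A] [Nonempty A] (σ : Equiv.Perm A) (ε : ℝ) :
    1 - ε < permDist σ 1 ↔ dens {a | σ a = a} < ε := by
  rw [permDist_eq_dens]
  have : {a | σ a ≠ (1 : Equiv.Perm A) a} = {a | σ a = a}ᶜ := by ext; simp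
  rw [this, dens_compl]
  constructor <;> intro h <;> linarith

section MinHash
variable {A : Type*} [Fintype A]

lemma minhash_uniform (W : Finset A) (x : A) (hx : x ∈ W) :
    dens {r : A ≃ Fin (Fintype.card A) | ∀ y ∈ W, r x ≤ r y} ≤ 1 / W.card := by
  classical
  set M : A → Set (A ≃ Fin (Fintype.card A)) := fun x => {r | ∀ y ∈ W, r x ≤ r y} with hM
  have h1 : ∀ y ∈ W, (M y).ncard = (M x).ncard := by
    intro y hy
    have : M y = (fun r => (Equiv.swap x y).trans r) '' M x := by
      ext r
      constructor
      · intro hr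
        refine ⟨(Equiv.swap x y).trans r, ?_, ?_⟩
        · intro z hz
          simp only [Equiv.trans_apply, Equiv.swap_apply_left]
          apply hr
          by_cases h : z = x
          · subst h; simpa using hy
          by_cases h' : z = y
          · subst h'; simpa using hx
          · rwa [Equiv.swap_apply_of_ne_of_ne h h']
        · ext z; simp
      · rintro ⟨r, hr, rfl⟩ z hz
        simp only [Equiv.trans_apply, Equiv.swap_apply_right]
        apply hr
        by_cases h : z = x
        · subst h; simpa using hy
        by_cases h' : z = y
        · subst h'; simpa using hx
        · rwa [Equiv.swap_apply_of_ne_of_ne h h']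
    rw [this, Set.ncard_image_of_injective]
    intro r s h
    ext z
    have := congrArg (fun e => e (Equiv.swap x y z)) h
    simp at this
    rw [this]
  have h2 : ∑ y ∈ W, (M y).ncard ≤ Nat.card (A ≃ Fin (Fintype.card A)) := by
    have hd : (W : Set A).PairwiseDisjoint M := by
      intro a ha b hb hab
      rw [Function.onFun, Set.disjoint_left]
      intro r hr hr'
      exact hab (r.injective (le_antisymm (hr b hb) (hr' a ha)))
    have : (⋃ y ∈ W, M y).ncard = ∑ y ∈ W, (M y).ncard := by
      have e : (⋃ y ∈ W, M y) = ((W.biUnion fun y => (M y).toFinset : Finset _) : Set (A ≃ Fin (Fintype.card A))) := by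
        ext; simp
      rw [e, Set.ncard_coe_finset, Finset.card_biUnion]
      · simp [Set.ncard_eq_toFinset_card']
      · intro a ha b hb hab
        rw [Function.onFun, Set.disjoint_toFinset]
        exact hd ha hb hab
    rw [← this]
    exact Set.ncard_le_card _
  rw [Finset.sum_congr rfl h1, Finset.sum_const, smul_eq_mul] at h2
  have hW : (0:ℝ) < W.card := by exact_mod_cast Finset.card_pos.2 ⟨x, hx⟩
  have hO : (0:ℝ) < Nat.card (A ≃ Fin (Fintype.card A)) := by
    have : Nonempty (A ≃ Fin (Fintype.card A)) := ⟨Fintype.equivFin A⟩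
    exact_mod_cast Nat.card_pos
  have h3 : (W.card : ℝ) * (M x).ncard ≤ Nat.card (A ≃ Fin (Fintype.card A)) := by exact_mod_cast h2
  change ((M x).ncard : ℝ) / _ ≤ _
  rw [div_le_div_iff₀ hO hW]
  linarith

/-- the point of `U` with smallest rank -/
noncomputable def amin (r : A ≃ Fin (Fintype.card A)) (U : Finset A) (hU : U.Nonempty) : A :=
  (U.exists_min_image r hU).choose

lemma amin_mem (r : A ≃ Fin (Fintype.card A)) (U : Finset A) (hU : U.Nonempty) : amin r U hU ∈ U :=
  (U.exists_min_image r hU).choose_spec.1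

lemma amin_le (r : A ≃ Fin (Fintype.card A)) (U : Finset A) (hU : U.Nonempty) (x : A) (hx : x ∈ U) :
    r (amin r U hU) ≤ r x :=
  (U.exists_min_image r hU).choose_spec.2 x hx

lemma minhash [DecidableEq A] (U V : Finset A) (hU : U.Nonempty) (hV : V.Nonempty) :
    dens {r : A ≃ Fin (Fintype.card A) | amin r V hV ≠ amin r U hU} ≤
      ((U \ V).card + (V \ U).card) / U.card := by
  set W := U ∪ V
  have hWne : W.Nonempty := hU.mono Finset.subset_union_left
  have hc := dens_le_of_cover ((U \ V) ∪ (V \ U))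
    (fun x => {r : A ≃ Fin (Fintype.card A) | ∀ y ∈ W, r x ≤ r y})
    {r : A ≃ Fin (Fintype.card A) | amin r V hV ≠ amin r U hU} (1 / W.card) (by
      intro r hr
      refine ⟨amin r W hWne, ?_, fun y hy => amin_le r W hWne y hy⟩
      by_contra hcon
      have hm := amin_mem r W hWne
      have hmU : amin r W hWne ∈ U := by grind
      have hmV : amin r W hWne ∈ V := by grind
      apply hr
      have e1 : amin r U hU = amin r W hWne := r.injective (le_antisymm (amin_le _ _ _ _ hmU)
        (amin_le _ _ _ _ (Finset.subset_union_left (amin_mem _ _ _))))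
      have e2 : amin r V hV = amin r W hWne := r.injective (le_antisymm (amin_le _ _ _ _ hmV)
        (amin_le _ _ _ _ (Finset.subset_union_right (amin_mem _ _ _))))
      rw [e1, e2]) (by
      intro x hx
      apply minhash_uniform
      grind)
  refine hc.trans ?_
  have h1 : (((U \ V) ∪ (V \ U)).card : ℝ) ≤ (U \ V).card + (V \ U).card := by
    exact_mod_cast Finset.card_union_le _ _
  have h2 : (U.card : ℝ) ≤ W.card := by exact_mod_cast Finset.card_le_card Finset.subset_union_left
  have h3 : (0:ℝ) < U.card := by exact_mod_cast Finset.card_pos.2 hU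
  rw [mul_one_div]
  gcongr
end MinHash

open scoped Pointwise in
lemma paradox_aux {Q : Type*} [Group Q] [DecidableEq Q] (h : IsAmenable Q) (S : Finset Q) :
    ∃ K : Finset Q, (S * K).card < 2 * K.card := by
  by_contra hcon
  push Not at hcon
  obtain ⟨m, hm0, hm1, hadd, hinv⟩ := h
  -- Hall
  have hall := (Finset.all_card_le_biUnion_card_iff_exists_injective
    (fun x : Q × Bool => S * {x.1})).1 (by
      intro J
      have h1 : J.card ≤ 2 * (J.image Prod.fst).card := by
        have : J ⊆ (J.image Prod.fst) ×ˢ (Finset.univ : Finset Bool) := by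
          intro x hx
          simp only [Finset.mem_product, Finset.mem_univ, and_true]
          exact Finset.mem_image_of_mem _ hx
        have := Finset.card_le_card this
        rw [Finset.card_product] at this
        simp at this
        omega
      refine (h1.trans (hcon _)).trans (Finset.card_le_card ?_)
      intro y hy
      obtain ⟨s, hs, k, hk, rfl⟩ := Finset.mem_mul.1 hy
      obtain ⟨x, hx, rfl⟩ := Finset.mem_image.1 hk
      exact Finset.mem_biUnion.2 ⟨x, hx, Finset.mul_mem_mul hs (Finset.mem_singleton_self _)⟩)
  obtain ⟨f, finj, hf⟩ := hall
  have hempty : m ∅ = 0 := by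
    have := hadd ∅ ∅ (by simp)
    simp at this
    exact this
  have hsum : ∀ {ι : Type _} (T : Finset ι) (B : ι → Set Q),
      (∀ i ∈ T, ∀ j ∈ T, i ≠ j → Disjoint (B i) (B j)) → m (⋃ i ∈ T, B i) = ∑ i ∈ T, m (B i) := by
    classical
    intro ι T B
    induction T using Finset.induction_on with
    | empty => intro _; simp [hempty]
    | insert a T ha ih =>
      intro hd
      rw [Finset.sum_insert ha, Finset.set_biUnion_insert, hadd, ih]
      · intro i hi j hj
        exact hd i (Finset.mem_insert_of_mem hi) j (Finset.mem_insert_of_mem hj)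
      · rw [Set.disjoint_iUnion₂_right]
        intro i hi
        exact hd a (Finset.mem_insert_self _ _) i (Finset.mem_insert_of_mem hi) (by grind)
  let B : Bool × Q → Set Q := fun p => {q | f (q, p.1) = p.2 * q}
  have hB : ∀ b : Bool, ∑ s ∈ S, m (B (b, s)) = 1 := by
    intro b
    rw [← hsum S (fun s => B (b, s)), ← hm1]
    · congr 1
      ext q
      simp only [Set.mem_iUnion, Set.mem_univ, iff_true]
      obtain ⟨s, hs, k, hk, e⟩ := Finset.mem_mul.1 (hf (q, b))
      rw [Finset.mem_singleton] at hk
      subst hk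
      exact ⟨s, hs, e.symm⟩
    · intro i _ j _ hij
      rw [Set.disjoint_left]
      intro q h1 h2
      apply hij
      have : i * q = j * q := h1.symm.trans h2
      exact mul_right_cancel this
  have hC : m (⋃ p ∈ (Finset.univ : Finset Bool) ×ˢ S, (p.2 * ·) '' B p) = 2 := by
    rw [hsum]
    · simp only [hinv]
      rw [Finset.sum_product]
      simp only [hB]
      simp
    · intro i _ j _ hij
      rw [Set.disjoint_left]
      rintro _ ⟨q, hq, rfl⟩ ⟨q', hq', e⟩
      apply hij
      change f _ = _ at hq
      change f _ = _ at hq'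
      simp only at e
      rw [← hq, ← hq'] at e
      have := finj e
      simp only [Prod.mk.injEq] at this
      obtain ⟨rfl, h2⟩ := this
      rw [← h2, hq'] at hq
      exact Prod.ext h2.symm (mul_right_cancel hq).symm
  have hle : ∀ s : Set Q, m s ≤ 1 := by
    intro s
    have := hadd s sᶜ disjoint_compl_right
    rw [Set.union_compl_self, hm1] at this
    linarith [hm0 sᶜ]
  linarith [hle (⋃ p ∈ (Finset.univ : Finset Bool) ×ˢ S, (p.2 * ·) '' B p)]

open scoped Pointwise in
lemma folner {Q : Type*} [Group Q] [DecidableEq Q] (h : IsAmenable Q) (E : Finset Q) (ε : ℝ)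
    (hε : 0 < ε) : ∃ K : Finset Q, K.Nonempty ∧ ∀ g ∈ E,
      (((K.image (g * ·)) \ K).card : ℝ) ≤ ε * K.card := by
  by_contra hcon
  push Not at hcon
  set E1 : Finset Q := insert 1 E
  have h1 : ∀ K : Finset Q, (1 + ε) * K.card ≤ ((E1 * K).card : ℝ) := by
    intro K
    rcases K.eq_empty_or_nonempty with rfl | hK
    · simp
    obtain ⟨g, hg, hlt⟩ := hcon K hK
    have : K ∪ (K.image (g * ·) \ K) ⊆ E1 * K := by
      apply Finset.union_subset
      · intro k hk
        rw [← one_mul k]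
        exact Finset.mul_mem_mul (Finset.mem_insert_self _ _) hk
      · intro x hx
        obtain ⟨k, hk, rfl⟩ := Finset.mem_image.1 (Finset.mem_sdiff.1 hx).1
        exact Finset.mul_mem_mul (Finset.mem_insert_of_mem hg) hk
    have := Finset.card_le_card this
    rw [Finset.card_union_of_disjoint Finset.disjoint_sdiff] at this
    have : (K.card : ℝ) + (K.image (g * ·) \ K).card ≤ (E1 * K).card := by exact_mod_cast this
    linarith
  have h2 : ∀ (n : ℕ) (K : Finset Q), (1 + ε) ^ n * K.card ≤ ((E1 ^ n * K).card : ℝ) := by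
    intro n
    induction n with
    | zero => intro K; simp
    | succ n ih =>
      intro K
      rw [pow_succ, pow_succ, mul_assoc, mul_assoc]
      refine le_trans ?_ (ih _)
      have := h1 K
      gcongr
  obtain ⟨n, hn⟩ := pow_unbounded_of_one_lt 2 (show 1 < 1 + ε by linarith)
  obtain ⟨K, hK⟩ := paradox_aux h (E1 ^ n)
  have h3 := h2 n K
  have h4 : ((E1 ^ n * K).card : ℝ) < 2 * K.card := by exact_mod_cast hK
  have : (2:ℝ) * K.card ≤ (1 + ε) ^ n * K.card := by gcongr
  linarith

lemma image_sdiff_image_sub {X Y : Type*} [DecidableEq X] [DecidableEq Y] (f : X → Y)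
    (s t : Finset X) : s.image f \ t.image f ⊆ (s \ t).image f := by
  intro y hy
  obtain ⟨h1, h2⟩ := Finset.mem_sdiff.1 hy
  obtain ⟨x, hx, rfl⟩ := Finset.mem_image.1 h1
  exact Finset.mem_image_of_mem _ (Finset.mem_sdiff.2 ⟨hx, fun h => h2 (Finset.mem_image_of_mem _ h)⟩)

open scoped Pointwise in
lemma sofic_good {P : Type*} [Group P] (hP : IsSofic P) (D : Finset P) (δ : ℝ) (hδ : 0 < δ) :
    ∃ A : Type, Finite A ∧ Nonempty A ∧ ∃ α : P → Equiv.Perm A, α 1 = 1 ∧ ∃ bad : Set A,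
      dens bad ≤ δ ∧ ∀ a, a ∉ bad → (∀ x ∈ D, ∀ y ∈ D, α (x * y) a = α x (α y a)) ∧
        (∀ x ∈ D, ∀ y ∈ D, α x a = α y a → x = y) := by
  classical
  set D1 : Finset P := D ∪ D⁻¹ ∪ (D⁻¹ * D) with hD1
  set ε : ℝ := δ / (2 * ((D1 ×ˢ D1).card + 1)) with hε
  have hε0 : 0 < ε := by positivity
  obtain ⟨A, hA, hA', α, h1, hmul, hfix⟩ := hP D1 ε hε0
  refine ⟨A, hA, hA', α, h1, ⋃ p ∈ D1 ×ˢ D1,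
    ({a | α (p.1 * p.2) a ≠ (α p.1 * α p.2) a} ∪ {a | p.1 ≠ 1 ∧ α p.1 a = a}), ?_, ?_⟩
  · refine (dens_le_of_cover (D1 ×ˢ D1) _ _ (2 * ε) (fun x hx => by
      simpa only [Set.mem_iUnion, exists_prop] using hx) ?_).trans ?_
    · rintro ⟨x, y⟩ hxy
      obtain ⟨hx, hy⟩ := Finset.mem_product.1 hxy
      refine (dens_union_le _ _).trans ?_
      have e1 := (hmul x hx y hy).le
      rw [permDist_eq_dens] at e1
      have e2 : dens {a | x ≠ 1 ∧ α x a = a} ≤ ε := by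
        by_cases h : x = 1
        · simp [h, dens_empty, hε0.le]
        · have := (permDist_one_gt _ _).1 (hfix x hx h)
          simpa [h] using this.le
      simp only at e1 e2 ⊢
      linarith
    · rw [hε]
      have : (0:ℝ) ≤ ((D1 ×ˢ D1).card : ℝ) := by positivity
      rw [mul_div_assoc', mul_div_assoc', div_le_iff₀ (by positivity)]
      nlinarith
  · intro a ha
    simp only [Set.mem_iUnion, exists_prop, not_exists, not_and, Set.mem_union, Set.mem_ofPred_eq,
      not_or, Prod.forall, Finset.mem_product, and_imp, not_not] at ha
    have hm : ∀ x ∈ D1, ∀ y ∈ D1, α (x * y) a = α x (α y a) := fun x hx y hy => (ha x y hx hy).1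
    have hD : D ⊆ D1 := fun x hx => by simp [hD1, hx]
    refine ⟨fun x hx y hy => hm x (hD hx) y (hD hy), ?_⟩
    intro x hx y hy hxy
    by_contra hne
    have hyi : y⁻¹ ∈ D1 := by simp [hD1, hy]
    have hyx : y⁻¹ * x ∈ D1 := by
      rw [hD1]
      exact Finset.mem_union_right _ (Finset.mul_mem_mul (Finset.inv_mem_inv hy) hx)
    refine (ha (y⁻¹ * x) x hyx (hD hx)).2 (fun h => hne ?_) ?_
    · exact (inv_mul_eq_one.1 h).symm
    · rw [hm _ hyi _ (hD hx), hxy, ← hm _ hyi _ (hD hy), inv_mul_cancel, h1]; rfl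

open scoped Pointwise in
lemma coloring {P : Type*} [Group P] (hP : IsSofic P) (Q : Subgroup P) (hQ : IsAmenable Q)
    (D : Finset P) (δ : ℝ) (hδ : 0 < δ) :
    ∃ A : Type, Finite A ∧ Nonempty A ∧ ∃ α : P → Equiv.Perm A, ∃ C : Type, ∃ c : A → C,
      ∃ bad : Set A, dens bad ≤ δ ∧ ∀ a, a ∉ bad →
        (∀ x ∈ D, ∀ y ∈ D, α (x * y) a = α x (α y a)) ∧
        (∀ x ∈ D, x ≠ 1 → α x a ≠ a) ∧
        (∀ x ∈ D, x ∈ Q → c (α x a) = c a) ∧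
        (∀ x ∈ D, x ∉ Q → c (α x a) ≠ c a) := by
  classical
  set ε : ℝ := δ / (4 * (D.card + 1)) with hε
  have hε0 : 0 < ε := by positivity
  obtain ⟨K, hK, hKE⟩ := folner hQ ((D.subtype (· ∈ Q)).image (·⁻¹)) ε hε0
  set L : Finset P := K.image (fun k : Q => (k : P)⁻¹) with hL
  have hLne : L.Nonempty := Finset.Nonempty.image hK (fun k : Q => (k : P)⁻¹)
  have hLQ : ∀ l ∈ L, l ∈ Q := by
    intro l hl
    obtain ⟨k, _, rfl⟩ := Finset.mem_image.1 hl
    exact Q.inv_mem k.2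
  have hLcard : L.card = K.card := Finset.card_image_of_injective _ (by
    intro k k' h; simpa using h)
  set D' : Finset P := insert 1 (L ∪ D ∪ (L * D)) with hD'
  have hLD' : L ⊆ D' := fun x hx => by simp [hD', hx]
  have hDD' : D ⊆ D' := fun x hx => by simp [hD', hx]
  have hLDD' : L * D ⊆ D' := fun x hx => by
    rw [hD']; exact Finset.mem_insert_of_mem (Finset.mem_union_right _ hx)
  have h1D' : 1 ∈ D' := by simp [hD']
  obtain ⟨A, hA, hA', α, h1, bad, hbad, hgood⟩ := sofic_good hP D' (δ / 2) (by positivity)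
  have := Fintype.ofFinite A
  let Ω := A ≃ Fin (Fintype.card A)
  have hΩ : Nonempty Ω := ⟨Fintype.equivFin A⟩
  have hΩf : Finite Ω := inferInstance
  let U : A → Finset A := fun a => L.image (fun l => α l a)
  have hU : ∀ a, (U a).Nonempty := fun a => hLne.image _
  let c : A × Ω → A := fun p => amin p.2 (U p.1) (hU p.1)
  let β : P → Equiv.Perm (A × Ω) := fun x => Equiv.prodCongr (α x) (Equiv.refl Ω)
  have hβ : ∀ x p, β x p = (α x p.1, p.2) := fun x p => rfl
  -- description of translated sets
  have hV : ∀ a, a ∉ bad → ∀ x ∈ D, U (α x a) = (L.image (· * x)).image (fun l => α l a) := by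
    intro a ha x hx
    rw [Finset.image_image]
    apply Finset.image_congr
    intro l hl
    exact ((hgood a ha).1 l (hLD' hl) x (hDD' hx)).symm
  have hLx : ∀ x ∈ D, L.image (· * x) ⊆ D' := by
    intro x hx y hy
    obtain ⟨l, hl, rfl⟩ := Finset.mem_image.1 hy
    exact hLDD' (Finset.mul_mem_mul hl hx)
  refine ⟨A × Ω, inferInstance, inferInstance, β, A, c,
    {p | p.1 ∈ bad ∨ ∃ x ∈ D, x ∈ Q ∧ c (β x p) ≠ c p}, ?_, ?_⟩
  · refine (dens_fiber _ bad (δ / 2) (by positivity) ?_).trans (by linarith)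
    intro a ha
    refine (dens_le_of_cover (D.filter (· ∈ Q))
      (fun x => {r : Ω | amin r (U (α x a)) (hU _) ≠ amin r (U a) (hU _)}) _ (2 * ε) ?_ ?_).trans ?_
    · rintro r (hr | ⟨x, hx, hxQ, hne⟩)
      · exact (ha hr).elim
      · exact ⟨x, Finset.mem_filter.2 ⟨hx, hxQ⟩, hne⟩
    · intro x hx
      obtain ⟨hxD, hxQ⟩ := Finset.mem_filter.1 hx
      refine (minhash _ _ _ _).trans ?_
      have inj : Set.InjOn (fun l => α l a) (D' : Set P) := fun y hy z hz h =>
        (hgood a ha).2 y hy z hz h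
      have hUc : (U a).card = K.card := by
        rw [← hLcard]
        exact Finset.card_image_of_injOn (inj.mono (by exact_mod_cast hLD'))
      have hLxc : (L.image (· * x)).card = L.card :=
        Finset.card_image_of_injective _ (mul_left_injective x)
      have k1 : ((L.image (· * x)) \ L).card ≤ ε * K.card := by
        have := hKE (⟨x, hxQ⟩⁻¹) (Finset.mem_image_of_mem _ (by simpa using hxD))
        refine le_trans ?_ this
        have hsub : (L.image (· * x)) \ L ⊆
            ((K.image ((⟨x, hxQ⟩⁻¹ : Q) * ·)) \ K).image (fun k : Q => (k : P)⁻¹) := by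
          intro y hy
          obtain ⟨hy1, hy2⟩ := Finset.mem_sdiff.1 hy
          obtain ⟨l, hl, rfl⟩ := Finset.mem_image.1 hy1
          obtain ⟨k, hk, rfl⟩ := Finset.mem_image.1 hl
          refine Finset.mem_image.2 ⟨(⟨x, hxQ⟩⁻¹ : Q) * k, Finset.mem_sdiff.2
            ⟨Finset.mem_image_of_mem _ hk, fun hmem => hy2 ?_⟩, by simp⟩
          exact Finset.mem_image.2 ⟨_, hmem, by simp⟩
        exact_mod_cast (Finset.card_le_card hsub).trans Finset.card_image_le
      have k2 : (L \ (L.image (· * x))).card = ((L.image (· * x)) \ L).card :=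
        Finset.card_sdiff_comm hLxc.symm
      have e1 : (U a \ U (α x a)).card ≤ (L \ (L.image (· * x))).card := by
        rw [hV a ha x hxD]
        refine (Finset.card_le_card ?_).trans
          (Finset.card_image_le (s := L \ (L.image (· * x))) (f := fun l => α l a))
        exact image_sdiff_image_sub _ _ _
      have e2 : (U (α x a) \ U a).card ≤ ((L.image (· * x)) \ L).card := by
        rw [hV a ha x hxD]
        refine (Finset.card_le_card ?_).trans
          (Finset.card_image_le (s := (L.image (· * x)) \ L) (f := fun l => α l a))
        exact image_sdiff_image_sub _ _ _
      rw [k2] at e1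
      have e1' : ((U a \ U (α x a)).card : ℝ) ≤ ((L.image (· * x)) \ L).card := by exact_mod_cast e1
      have e2' : ((U (α x a) \ U a).card : ℝ) ≤ ((L.image (· * x)) \ L).card := by exact_mod_cast e2
      have hK0 : (0:ℝ) < K.card := by exact_mod_cast Finset.card_pos.2 hK
      rw [hUc, div_le_iff₀ hK0]
      linarith
    · have : ((D.filter (· ∈ Q)).card : ℝ) ≤ D.card := by
        exact_mod_cast Finset.card_filter_le _ _
      have h2 : ((D.filter (· ∈ Q)).card : ℝ) * (2 * ε) ≤ D.card * (2 * ε) := by gcongr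
      refine h2.trans ?_
      rw [hε, mul_div_assoc', mul_div_assoc', div_le_div_iff₀ (by positivity) (by positivity)]
      have : (0:ℝ) ≤ (D.card : ℝ) := by positivity
      nlinarith
  · rintro ⟨a, r⟩ hp
    simp only [Set.mem_ofPred_eq, not_or, not_exists, not_and, not_not] at hp
    obtain ⟨ha, hc⟩ := hp
    refine ⟨?_, ?_, hc, ?_⟩
    · intro x hx y hy
      simp only [hβ, (hgood a ha).1 x (hDD' hx) y (hDD' hy)]
    · intro x hx hx1 h
      apply hx1
      refine (hgood a ha).2 x (hDD' hx) 1 h1D' ?_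
      rw [h1]
      exact congrArg Prod.fst h
    · intro x hx hxQ h
      have m1 : amin r (U (α x a)) (hU _) ∈ U (α x a) := amin_mem _ _ _
      have m2 : amin r (U a) (hU _) ∈ U a := amin_mem _ _ _
      have h' : amin r (U (α x a)) (hU _) = amin r (U a) (hU _) := h
      rw [h', hV a ha x hx] at m1
      obtain ⟨l, hl, e1⟩ := Finset.mem_image.1 m1
      obtain ⟨l', hl', e2⟩ := Finset.mem_image.1 m2
      have := (hgood a ha).2 l (hLx x hx hl) l' (hLD' hl') (e1.trans e2.symm)
      obtain ⟨l'', hl'', rfl⟩ := Finset.mem_image.1 hl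
      apply hxQ
      have h3 := hLQ _ hl'
      rw [← this] at h3
      exact (Q.mul_mem_cancel_left (hLQ _ hl'')).1 h3

lemma exists_perm_extend {X : Type*} [Finite X] (R : X → X → Prop)
    (h1 : ∀ s t t', R s t → R s t' → t = t') (h2 : ∀ s s' t, R s t → R s' t → s = s') :
    ∃ σ : Equiv.Perm X, ∀ s t, R s t → σ s = t := by
  classical
  have := Fintype.ofFinite X
  let f : {s // ∃ t, R s t} → X := fun s => s.2.choose
  have hf : ∀ s, R s.1 (f s) := fun s => s.2.choose_spec
  let g : {t // ∃ s, R s t} → X := fun s => s.2.choose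
  have hg : ∀ s, R (g s) s.1 := fun s => s.2.choose_spec
  let e : {s // ∃ t, R s t} ≃ {t // ∃ s, R s t} :=
    { toFun := fun s => ⟨f s, s.1, hf s⟩
      invFun := fun t => ⟨g t, t.1, hg t⟩
      left_inv := fun s => Subtype.ext (h2 _ _ (f s) (hg ⟨f s, s.1, hf s⟩) (hf s))
      right_inv := fun t => Subtype.ext (h1 (g t) _ _ (hf ⟨g t, t.1, hg t⟩) (hg t)) }
  refine ⟨e.extendSubtype, fun s t hst => ?_⟩
  rw [Equiv.extendSubtype_apply_of_mem e s ⟨t, hst⟩]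
  exact h1 s _ _ (hf ⟨s, t, hst⟩) hst

lemma free_rf {α : Type*} (w : FreeGroup α) (hw : w ≠ 1) :
    ∃ n : ℕ, ∃ f : FreeGroup α →* Equiv.Perm (Fin n), f w ≠ 1 := by
  classical
  set L := w.toWord with hL
  have hred : FreeGroup.IsReduced L := FreeGroup.isReduced_toWord
  have hLne : L ≠ [] := fun h => hw (FreeGroup.toWord_eq_nil_iff.1 h)
  have hlen : 0 < L.length := List.length_pos_iff.2 hLne
  have hch : ∀ (i : ℕ) (h : i + 1 < L.length), L[i].1 = L[i+1].1 → L[i].2 = L[i+1].2 := by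
    intro i h
    exact List.isChain_iff_getElem.1 hred i h
  let R : α → Fin (L.length + 1) → Fin (L.length + 1) → Prop := fun x s t =>
    (∃ h : t.1 < L.length, L[t.1] = (x, true) ∧ s.1 = t.1 + 1) ∨
    (∃ h : s.1 < L.length, L[s.1] = (x, false) ∧ t.1 = s.1 + 1)
  have hσ : ∀ x, ∃ σ : Equiv.Perm (Fin (L.length + 1)), ∀ s t, R x s t → σ s = t := by
    intro x
    apply exists_perm_extend
    · rintro ⟨s, hs⟩ ⟨t, ht⟩ ⟨t', ht'⟩ (⟨h, e, e'⟩ | ⟨h, e, e'⟩) (⟨k, f, f'⟩ | ⟨k, f, f'⟩) <;>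
        simp only at h e e' k f f' <;> subst e'
      · ext; simp only; omega
      · have := hch t (by omega)
        simp [e, f] at this
      · have := hch t' (by omega)
        subst f'
        simp [e, f] at this
      · ext; simp only; omega
    · rintro ⟨s, hs⟩ ⟨s', hs'⟩ ⟨t, ht⟩ (⟨h, e, e'⟩ | ⟨h, e, e'⟩) (⟨k, f, f'⟩ | ⟨k, f, f'⟩) <;>
        simp only at h e e' k f f' <;> subst e'
      · ext; simp only; omega
      · subst f'
        have := hch s' (by omega)
        simp [e, f] at this
      · have := hch s (by omega)
        simp [e, f] at this
      · ext; simp only; omega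
  choose σ hσ using hσ
  refine ⟨L.length + 1, FreeGroup.lift σ, fun hone => ?_⟩
  have key : ∀ (k j : ℕ) (hj : j + k = L.length),
      FreeGroup.lift σ (FreeGroup.mk (L.drop j)) ⟨L.length, by omega⟩ = ⟨j, by omega⟩ := by
    intro k
    induction k with
    | zero =>
      intro j hj
      have : L.drop j = [] := List.drop_eq_nil_of_le (by omega)
      rw [this, FreeGroup.lift_mk]
      simp
      omega
    | succ k ih =>
      intro j hj
      have ih' := ih (j + 1) (by omega)
      rw [FreeGroup.lift_mk] at ih' ⊢
      rw [List.drop_eq_getElem_cons (by omega), List.map_cons, List.prod_cons, Equiv.Perm.mul_apply,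
        ih']
      rcases hb : L[j] with ⟨x, b⟩
      cases b
      · simp only [cond_false]
        rw [Equiv.Perm.inv_eq_iff_eq]
        symm
        exact hσ x _ _ (Or.inr ⟨by simp only; omega, hb, rfl⟩)
      · simp only [cond_true]
        exact hσ x _ _ (Or.inl ⟨by simp only; omega, hb, rfl⟩)
  have := key L.length 0 (by omega)
  have e : FreeGroup.mk (L.drop 0) = w := by rw [List.drop_zero, hL, FreeGroup.mk_toWord]
  rw [e, hone] at this
  have := congrArg Fin.val this
  simp only [Equiv.Perm.one_apply] at this
  omega

lemma free_rf_finset {α : Type} (W : Finset (FreeGroup α)) :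
    ∃ (Y : Type) (_ : Group Y) (_ : Finite Y) (f : FreeGroup α →* Y), ∀ w ∈ W, w ≠ 1 → f w ≠ 1 := by
  classical
  induction W using Finset.induction_on with
  | empty => exact ⟨Unit, inferInstance, inferInstance, 1, by simp⟩
  | insert a W ha ih =>
    obtain ⟨Y, _, _, f, hf⟩ := ih
    by_cases h : a = 1
    · refine ⟨Y, inferInstance, inferInstance, f, ?_⟩
      intro w hw hw1
      rcases Finset.mem_insert.1 hw with rfl | hw
      · exact (hw1 h).elim
      · exact hf w hw hw1
    · obtain ⟨n, g, hg⟩ := free_rf a h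
      refine ⟨Y × Equiv.Perm (Fin n), inferInstance, inferInstance, f.prod g, ?_⟩
      intro w hw hw1 he
      rw [MonoidHom.prod_apply, Prod.mk_eq_one] at he
      rcases Finset.mem_insert.1 hw with rfl | hw
      · exact hg he.2
      · exact hf w hw hw1 he.1

lemma alt_word_ne_one {C : Type*} (l : List (ℕ × C × C)) (hne : l ≠ [])
    (hch : (l.map Prod.fst).IsChain (· ≠ ·)) (hl : ∀ x ∈ l, x.2.1 ≠ x.2.2) :
    (l.map fun x => FreeGroup.of (x.1, x.2.1) * (FreeGroup.of (x.1, x.2.2))⁻¹).prod ≠ 1 := by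
  classical
  let F : List (ℕ × C × C) → List ((ℕ × C) × Bool) := fun l =>
    l.flatMap fun x => [((x.1, x.2.1), true), ((x.1, x.2.2), false)]
  have h1 : ∀ l : List (ℕ × C × C),
      (l.map fun x => FreeGroup.of (x.1, x.2.1) * (FreeGroup.of (x.1, x.2.2))⁻¹).prod
        = FreeGroup.mk (F l) := by
    intro l
    induction l with
    | nil => rfl
    | cons x l ih =>
      rw [List.map_cons, List.prod_cons, ih]
      rfl
  have h2 : ∀ l : List (ℕ × C × C), (l.map Prod.fst).IsChain (· ≠ ·) →
      (∀ x ∈ l, x.2.1 ≠ x.2.2) → FreeGroup.IsReduced (F l) := by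
    intro l
    induction l with
    | nil => intro _ _; exact FreeGroup.IsReduced.nil
    | cons x l ih =>
      intro hc hl
      have hx := hl x (by simp)
      cases l with
      | nil =>
        simp only [F, FreeGroup.IsReduced, List.flatMap_cons, List.flatMap_nil, List.append_nil]
        simp
        tauto
      | cons y l =>
        have ih' := ih (by simpa using hc.tail) (fun z hz => hl z (by simp [hz]))
        have hxy : x.1 ≠ y.1 := by
          simp only [List.map_cons, List.isChain_cons_cons] at hc
          exact hc.1
        simp only [F, FreeGroup.IsReduced, List.flatMap_cons, List.cons_append, List.nil_append,
          List.isChain_cons_cons] at ih' ⊢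
        refine ⟨?_, ?_, ih'⟩
        · intro h; exact (hx (Prod.ext_iff.1 h).2).elim
        · intro h; exact (hxy (Prod.ext_iff.1 h).1).elim
  rw [h1]
  intro h
  have h3 := FreeGroup.toWord_eq_nil_iff.2 h
  rw [FreeGroup.toWord_mk, (h2 l hch hl).reduce_eq] at h3
  cases l with
  | nil => exact hne rfl
  | cons x l => simp [F] at h3

/-- approximate relations satisfied by a family of permutations -/
def ApproxRel {G : Type*} [Group G] (H : Subgroup G) (E : Finset G) (δ : ℝ) {X : Type}
    (Θ : ℕ × G → Equiv.Perm X) : Prop :=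
  (∀ n, ∀ g ∈ E, ∀ h ∈ E, permDist (Θ (n, g * h)) (Θ (n, g) * Θ (n, h)) < δ) ∧
  (∀ n m, ∀ h ∈ E, h ∈ H → permDist (Θ (n, h)) (Θ (m, h)) < δ)

lemma model {G P K : Type*} [Group G] [Group P] [Group K] (H : Subgroup G) (Q : Subgroup P)
    (hP : IsSofic P) (hQ : IsAmenable Q) (hK : IsSofic K) (E : Finset G) (p : G → P) (q : G → K)
    (hpm : ∀ g ∈ E, ∀ h ∈ E, p (g * h) = p g * p h)
    (hqm : ∀ g ∈ E, ∀ h ∈ E, q (g * h) = q g * q h)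
    (hne : ∀ g ∈ E, g ≠ 1 → p g ≠ 1 ∨ q g ≠ 1)
    (hin : ∀ g ∈ E, g ∈ H → p g ∈ Q) (hout : ∀ g ∈ E, g ∉ H → p g ∉ Q)
    (T : Finset (List (ℕ × G)))
    (hT : ∀ l ∈ T, l ≠ [] ∧ (l.map Prod.fst).IsChain (· ≠ ·) ∧ ∀ x ∈ l, x.2 ∈ E ∧ x.2 ∉ H)
    (δ : ℝ) (hδ : 0 < δ) :
    ∃ X : Type, Finite X ∧ Nonempty X ∧ ∃ Θ : ℕ × G → Equiv.Perm X, ApproxRel H E δ Θ ∧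
      (∀ n, ∀ h ∈ E, h ≠ 1 → 1 - δ < permDist (Θ (n, h)) 1) ∧
      (∀ l ∈ T, 1 - δ < permDist (l.map Θ).prod 1) := by
  classical
  set M : ℕ := ∑ l ∈ T, l.length with hM
  set δ1 : ℝ := δ / (4 * (M + 1)) with hδ1
  have hδ1pos : 0 < δ1 := by positivity
  have hδ1le : δ1 ≤ δ / 4 := by
    rw [hδ1, div_le_div_iff₀ (by positivity) (by positivity)]
    have : (0:ℝ) ≤ M := by positivity
    nlinarith
  obtain ⟨A, _, _, α, C, c, bad, hbad, hgood⟩ := coloring hP Q hQ (E.image p) δ1 hδ1pos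
  obtain ⟨B, _, _, β, hβ1, badB, hbadB, hgoodB⟩ := sofic_good hK (insert 1 (E.image q)) (δ / 4)
    (by positivity)
  have := Fintype.ofFinite A
  -- words
  let act : List (ℕ × G) → Equiv.Perm A := fun l => (l.map fun x => α (p x.2)).prod
  let trip : A → List (ℕ × G) → List (ℕ × C × C) := fun a l =>
    List.rec [] (fun x l ih => (x.1, c (α (p x.2) (act l a)), c (act l a)) :: ih) l
  have htrip : ∀ a x l, trip a (x :: l) = (x.1, c (α (p x.2) (act l a)), c (act l a)) :: trip a l :=
    fun a x l => rfl
  let W : A → List (ℕ × G) → FreeGroup (ℕ × C) := fun a l =>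
    ((trip a l).map fun x => FreeGroup.of (x.1, x.2.1) * (FreeGroup.of (x.1, x.2.2))⁻¹).prod
  have hWcons : ∀ a x l, W a (x :: l) = FreeGroup.of (x.1, c (α (p x.2) (act l a))) *
      (FreeGroup.of (x.1, c (act l a)))⁻¹ * W a l := fun a x l => by
    simp only [W, htrip, List.map_cons, List.prod_cons]
  obtain ⟨Y, _, _, ρ, hρ⟩ := free_rf_finset ((Finset.univ ×ˢ T).image fun x => W x.1 x.2)
  have : Nonempty Y := ⟨1⟩
  let hat : G → Equiv.Perm (A × B × Y) := fun g =>
    Equiv.prodCongr (α (p g)) (Equiv.prodCongr (β (q g)) (Equiv.refl Y))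
  let t : ℕ → Equiv.Perm (A × B × Y) := fun n =>
    { toFun := fun x => (x.1, x.2.1, ρ (FreeGroup.of (n, c x.1)) * x.2.2)
      invFun := fun x => (x.1, x.2.1, (ρ (FreeGroup.of (n, c x.1)))⁻¹ * x.2.2)
      left_inv := fun x => by simp
      right_inv := fun x => by simp }
  let Θ : ℕ × G → Equiv.Perm (A × B × Y) := fun x => t x.1 * hat x.2 * (t x.1).symm
  have hΘ : ∀ n g a b y, Θ (n, g) (a, b, y) = (α (p g) a, β (q g) b,
      ρ (FreeGroup.of (n, c (α (p g) a)) * (FreeGroup.of (n, c a))⁻¹) * y) := by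
    intro n g a b y
    rw [map_mul, map_inv, mul_assoc]
    rfl
  have hbadX : dens {x : A × B × Y | x.1 ∈ bad ∨ x.2.1 ∈ badB} < δ := by
    have e1 : dens {x : A × B × Y | x.1 ∈ bad} ≤ dens bad := dens_fst _
    have e2 : dens {x : A × B × Y | x.2 ∈ {z : B × Y | z.1 ∈ badB}} ≤ dens badB :=
      (dens_snd _).trans (dens_fst _)
    have e3 := dens_union_le {x : A × B × Y | x.1 ∈ bad}
      {x : A × B × Y | x.2 ∈ {z : B × Y | z.1 ∈ badB}}
    have e4 : {x : A × B × Y | x.1 ∈ bad ∨ x.2.1 ∈ badB} = {x : A × B × Y | x.1 ∈ bad} ∪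
      {x : A × B × Y | x.2 ∈ {z : B × Y | z.1 ∈ badB}} := rfl
    rw [e4]
    linarith
  refine ⟨A × B × Y, inferInstance, inferInstance, Θ, ⟨?_, ?_⟩, ?_, ?_⟩
  · intro n g hg h hh
    rw [permDist_eq_dens]
    refine lt_of_le_of_lt (dens_mono ?_) hbadX
    rintro ⟨a, b, y⟩ hx
    by_contra hcon
    simp only [Set.mem_ofPred_eq, not_or] at hcon
    apply hx
    change Θ (n, g * h) (a, b, y) = Θ (n, g) (Θ (n, h) (a, b, y))
    rw [hΘ, hΘ, hΘ, hpm g hg h hh, hqm g hg h hh,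
      (hgood a hcon.1).1 _ (Finset.mem_image_of_mem _ hg) _ (Finset.mem_image_of_mem _ hh),
      (hgoodB b hcon.2).1 _ (Finset.mem_insert_of_mem (Finset.mem_image_of_mem _ hg)) _
        (Finset.mem_insert_of_mem (Finset.mem_image_of_mem _ hh))]
    rw [← mul_assoc, ← map_mul]
    congr 4
    group
  · intro n m h hh hhH
    rw [permDist_eq_dens]
    refine lt_of_le_of_lt (dens_mono ?_) hbadX
    rintro ⟨a, b, y⟩ hx
    by_contra hcon
    simp only [Set.mem_ofPred_eq, not_or] at hcon
    apply hx
    rw [hΘ, hΘ, (hgood a hcon.1).2.2.1 _ (Finset.mem_image_of_mem _ hh) (hin h hh hhH)]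
    simp
  · intro n h hh h1
    rw [permDist_one_gt]
    refine lt_of_le_of_lt (dens_mono ?_) hbadX
    rintro ⟨a, b, y⟩ hx
    by_contra hcon
    simp only [Set.mem_ofPred_eq, not_or] at hcon
    simp only [Set.mem_ofPred_eq, hΘ, Prod.mk.injEq] at hx
    rcases hne h hh h1 with h2 | h2
    · exact (hgood a hcon.1).2.1 _ (Finset.mem_image_of_mem _ hh) h2 hx.1
    · apply h2
      refine (hgoodB b hcon.2).2 _ (Finset.mem_insert_of_mem (Finset.mem_image_of_mem _ hh)) 1
        (Finset.mem_insert_self _ _) ?_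
      rw [hβ1]
      exact hx.2.1
  · intro l hl
    rw [permDist_one_gt]
    obtain ⟨hl0, hlch, hlE⟩ := hT l hl
    -- bad set for words
    let Bad : List (ℕ × G) → Set A := fun l =>
      List.rec ∅ (fun x l ih => ih ∪ {a | act l a ∈ bad}) l
    have hBad : ∀ x l, Bad (x :: l) = Bad l ∪ {a | act l a ∈ bad} := fun x l => rfl
    have hBadd : ∀ l, dens (Bad l) ≤ l.length * δ1 := by
      intro l
      induction l with
      | nil => simp [Bad, dens_empty]
      | cons x l ih =>
        rw [hBad x l]
        refine (dens_union_le _ _).trans ?_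
        rw [dens_preimage_perm]
        push_cast [List.length_cons]
        linarith
    have hlen : (l.length : ℝ) ≤ M := by
      have : l.length ≤ M := Finset.single_le_sum (f := fun l : List (ℕ × G) => l.length)
        (fun _ _ => Nat.zero_le _) hl
      exact_mod_cast this
    have hBlt : dens (Bad l) < δ := by
      refine (hBadd l).trans_lt ?_
      have : l.length * δ1 ≤ M * δ1 := by gcongr
      refine this.trans_lt ?_
      rw [hδ1, mul_div_assoc', div_lt_iff₀ (by positivity)]
      have : (0:ℝ) ≤ M := by positivity
      nlinarith
    have hword : ∀ (l : List (ℕ × G)) a b y, ∃ b',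
        (l.map Θ).prod (a, b, y) = (act l a, b', ρ (W a l) * y) := by
      intro l a b y
      induction l with
      | nil => exact ⟨b, by simp [act, W, trip]⟩
      | cons x l ih =>
        obtain ⟨b', hb'⟩ := ih
        refine ⟨β (q x.2) b', ?_⟩
        rw [List.map_cons, List.prod_cons, Equiv.Perm.mul_apply, hb', hWcons, map_mul ρ _ (W a l),
          mul_assoc]
        obtain ⟨n, g⟩ := x
        rw [hΘ]
        rfl
    have htf : ∀ a l, (trip a l).map Prod.fst = l.map Prod.fst := by
      intro a l
      induction l with
      | nil => rfl
      | cons x l ih => rw [htrip, List.map_cons, List.map_cons, ih]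
    have hsep : ∀ a (l : List (ℕ × G)), a ∉ Bad l → (∀ x ∈ l, x.2 ∈ E ∧ x.2 ∉ H) →
        ∀ z ∈ trip a l, z.2.1 ≠ z.2.2 := by
      intro a l
      induction l with
      | nil => intro _ _ z hz; simp [trip] at hz
      | cons x l ih =>
        intro ha hE z hz
        rw [hBad x l, Set.mem_union, not_or] at ha
        rw [htrip, List.mem_cons] at hz
        rcases hz with rfl | hz
        · obtain ⟨h1, h2⟩ := hE x (by simp)
          exact (hgood _ ha.2).2.2.2 _ (Finset.mem_image_of_mem _ h1) (hout _ h1 h2)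
        · exact ih ha.1 (fun y hy => hE y (by simp [hy])) z hz
    refine lt_of_le_of_lt (dens_mono (t := {x : A × B × Y | x.1 ∈ Bad l}) ?_)
      (lt_of_le_of_lt (dens_fst (Bad l)) hBlt)
    rintro ⟨a, b, y⟩ hx
    change a ∈ Bad l
    refine Classical.byContradiction fun ha => ?_
    obtain ⟨b', hb'⟩ := hword l a b y
    simp only [Set.mem_ofPred_eq] at hx
    rw [hb'] at hx
    simp only [Prod.mk.injEq, mul_eq_right] at hx
    refine hρ (W a l) (Finset.mem_image.2 ⟨(a, l), by simp [hl], rfl⟩) ?_ hx.2.2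
    apply alt_word_ne_one
    · intro h0
      have := htf a l
      rw [h0] at this
      simp at this
      exact hl0 this
    · rw [htf]; exact hlch
    · exact hsep a l ha hlE

lemma permDist_eq_one {X : Type*} (σ τ : Equiv.Perm X) : permDist σ τ = permDist (τ⁻¹ * σ) 1 := by
  rw [permDist_eq_dens, permDist_eq_dens]
  congr 1
  ext a
  simp [Equiv.symm_apply_eq]

lemma permDist_one_one {X : Type*} : permDist (1 : Equiv.Perm X) 1 = 0 := by
  simp [permDist]

lemma permDist_mul_le {X : Type*} [Finite X] (σ τ : Equiv.Perm X) :
    permDist (σ * τ) 1 ≤ permDist σ 1 + permDist τ 1 := by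
  have h := dens_union_le {a | σ (τ a) ≠ τ a} {a | τ a ≠ a}
  have h2 : dens {a | σ (τ a) ≠ τ a} = dens {a | σ a ≠ a} :=
    dens_preimage_perm τ {a | σ a ≠ a}
  rw [h2] at h
  refine le_trans (dens_mono ?_) h
  intro a ha
  by_contra hc
  simp only [Set.mem_union, Set.mem_ofPred_eq, not_or, not_not] at hc
  apply ha
  change σ (τ a) = a
  rw [hc.1, hc.2]

lemma permDist_conj {X : Type*} (σ τ : Equiv.Perm X) :
    permDist (τ * σ * τ⁻¹) 1 = permDist σ 1 := by
  rw [permDist_eq_dens, permDist_eq_dens]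
  rw [← dens_preimage_perm τ⁻¹ {a | σ a ≠ (1 : Equiv.Perm X) a}]
  congr 1
  ext a
  simp [Equiv.eq_symm_apply]

lemma permDist_inv {X : Type*} (σ : Equiv.Perm X) : permDist σ⁻¹ 1 = permDist σ 1 := by
  rw [permDist_eq_dens, permDist_eq_dens]
  congr 1
  ext a
  simp only [Set.mem_ofPred_eq, ne_eq, Equiv.Perm.coe_one, id_eq]
  rw [Equiv.Perm.inv_eq_iff_eq, eq_comm]

lemma ApproxRel.mono {G : Type*} [Group G] {H : Subgroup G} {E E' : Finset G} {δ δ' : ℝ} {X : Type}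
    {Θ : ℕ × G → Equiv.Perm X} (h : ApproxRel H E δ Θ) (hE : E' ⊆ E) (hδ : δ ≤ δ') :
    ApproxRel H E' δ' Θ :=
  ⟨fun n g hg k hk => (h.1 n g (hE hg) k (hE hk)).trans_le hδ,
    fun n m k hk hkH => (h.2 n m k (hE hk) hkH).trans_le hδ⟩

/-- words which are asymptotically trivial in all approximate models -/
def asympNull {G : Type*} [Group G] (H : Subgroup G) : Subgroup (FreeGroup (ℕ × G)) where
  carrier := {w | ∀ ε : ℝ, 0 < ε → ∃ E : Finset G, ∃ δ : ℝ, 0 < δ ∧ ∀ (X : Type) (_ : Finite X)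
    (Θ : ℕ × G → Equiv.Perm X), ApproxRel H E δ Θ → permDist (FreeGroup.lift Θ w) 1 < ε}
  one_mem' := by
    intro ε hε
    refine ⟨∅, 1, one_pos, fun X _ Θ _ => ?_⟩
    rw [map_one, permDist_one_one]; exact hε
  mul_mem' := by
    classical
    intro a b ha hb ε hε
    obtain ⟨E1, δ1, h1, hh1⟩ := ha (ε / 2) (by positivity)
    obtain ⟨E2, δ2, h2, hh2⟩ := hb (ε / 2) (by positivity)
    refine ⟨E1 ∪ E2, min δ1 δ2, lt_min h1 h2, fun X _ Θ hΘ => ?_⟩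
    have e1 := hh1 X inferInstance Θ (hΘ.mono Finset.subset_union_left (min_le_left _ _))
    have e2 := hh2 X inferInstance Θ (hΘ.mono Finset.subset_union_right (min_le_right _ _))
    rw [map_mul]
    exact (permDist_mul_le _ _).trans_lt (by linarith)
  inv_mem' := by
    intro a ha ε hε
    obtain ⟨E1, δ1, h1, hh1⟩ := ha ε hε
    refine ⟨E1, δ1, h1, fun X _ Θ hΘ => ?_⟩
    rw [map_inv, permDist_inv]
    exact hh1 X inferInstance Θ hΘ

instance asympNull_normal {G : Type*} [Group G] (H : Subgroup G) : (asympNull H).Normal := by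
  constructor
  intro a ha g ε hε
  obtain ⟨E1, δ1, h1, hh1⟩ := ha ε hε
  refine ⟨E1, δ1, h1, fun X _ Θ hΘ => ?_⟩
  rw [map_mul, map_mul, map_inv, permDist_conj]
  exact hh1 X inferInstance Θ hΘ

/-- the canonical map from words to the amalgam -/
def toPush {G : Type*} [Group G] (H : Subgroup G) :
    FreeGroup (ℕ × G) →* Monoid.PushoutI (fun _ : ℕ => H.subtype) :=
  FreeGroup.lift fun x => Monoid.PushoutI.of (φ := fun _ : ℕ => H.subtype) x.1 x.2

lemma mem_null {G : Type*} [Group G] (H : Subgroup G) (w : FreeGroup (ℕ × G))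
    (hw : toPush H w = 1) : w ∈ asympNull H := by
  classical
  let F := FreeGroup (ℕ × G)
  let f : ℕ → G →* F ⧸ asympNull H := fun n => MonoidHom.mk'
    (fun g => ((FreeGroup.of (n, g) : F) : F ⧸ asympNull H)) (by
      intro g h
      rw [← QuotientGroup.mk_mul, eq_comm, QuotientGroup.eq]
      intro ε hε
      refine ⟨{g, h}, ε, hε, fun X _ Θ hΘ => ?_⟩
      have := hΘ.1 n g (by simp) h (by simp)
      rw [permDist_eq_one] at this
      simpa using this)
  have hf : ∀ n, (f n).comp H.subtype = (f 0).comp H.subtype := by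
    intro n
    ext h
    change ((FreeGroup.of (n, (h : G)) : F) : F ⧸ asympNull H) =
      ((FreeGroup.of (0, (h : G)) : F) : F ⧸ asympNull H)
    rw [eq_comm, QuotientGroup.eq]
    intro ε hε
    refine ⟨{(h : G)}, ε, hε, fun X _ Θ hΘ => ?_⟩
    have := hΘ.2 n 0 h (by simp) h.2
    rw [permDist_eq_one] at this
    simpa using this
  let Φ := Monoid.PushoutI.lift (φ := fun _ : ℕ => H.subtype) f ((f 0).comp H.subtype) hf
  have hΦ : Φ.comp (toPush H) = QuotientGroup.mk' (asympNull H) := by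
    apply FreeGroup.ext_hom
    rintro ⟨n, g⟩
    rw [MonoidHom.comp_apply, toPush, FreeGroup.lift_apply_of]
    exact Monoid.PushoutI.lift_of _ _ _ _
  rw [← QuotientGroup.eq_one_iff]
  have := DFunLike.congr_fun hΦ w
  rw [MonoidHom.comp_apply, hw, map_one] at this
  exact this.symm

/-- reduced words -/
def IsNice {G : Type*} [Group G] (H : Subgroup G) (l : List (ℕ × G)) : Prop :=
  l ≠ [] ∧ (l.map Prod.fst).IsChain (· ≠ ·) ∧ ∀ x ∈ l, x.2 ∉ H

/-- elements with a normal form -/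
def HasNF {G : Type*} [Group G] (H : Subgroup G)
    (γ : Monoid.PushoutI (fun _ : ℕ => H.subtype)) : Prop :=
  (∃ h ∈ H, γ = toPush H (FreeGroup.of (0, h))) ∨
    ∃ l, IsNice H l ∧ γ = toPush H (l.map FreeGroup.of).prod

lemma toPush_of {G : Type*} [Group G] (H : Subgroup G) (n : ℕ) (g : G) :
    toPush H (FreeGroup.of (n, g)) = Monoid.PushoutI.of (φ := fun _ : ℕ => H.subtype) n g := by
  rw [toPush, FreeGroup.lift_apply_of]

lemma toPush_mul {G : Type*} [Group G] (H : Subgroup G) (n : ℕ) (g h : G) :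
    toPush H (FreeGroup.of (n, g)) * toPush H (FreeGroup.of (n, h)) =
      toPush H (FreeGroup.of (n, g * h)) := by
  rw [toPush_of, toPush_of, toPush_of, map_mul]

lemma toPush_base {G : Type*} [Group G] (H : Subgroup G) (n m : ℕ) (h : G) (hh : h ∈ H) :
    toPush H (FreeGroup.of (n, h)) = toPush H (FreeGroup.of (m, h)) := by
  rw [toPush_of, toPush_of]
  have e : ∀ n, Monoid.PushoutI.of (φ := fun _ : ℕ => H.subtype) n h =
      Monoid.PushoutI.base (fun _ : ℕ => H.subtype) ⟨h, hh⟩ := fun n =>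
    Monoid.PushoutI.of_apply_eq_base (fun _ : ℕ => H.subtype) n ⟨h, hh⟩
  rw [e, e]

lemma hasNF_base_mul {G : Type*} [Group G] (H : Subgroup G) (n : ℕ) (h : G) (hh : h ∈ H) (γ)
    (hγ : HasNF H γ) : HasNF H (toPush H (FreeGroup.of (n, h)) * γ) := by
  rcases hγ with ⟨k, hk, rfl⟩ | ⟨l, ⟨hl0, hlc, hlH⟩, rfl⟩
  · refine Or.inl ⟨h * k, H.mul_mem hh hk, ?_⟩
    rw [toPush_base H n 0 h hh, toPush_mul]
  · cases l with
    | nil => exact (hl0 rfl).elim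
    | cons x l =>
      obtain ⟨m, g⟩ := x
      refine Or.inr ⟨(m, h * g) :: l, ⟨by simp, hlc, ?_⟩, ?_⟩
      · intro x hx
        rcases List.mem_cons.1 hx with rfl | hx
        · intro hc
          exact hlH (m, g) (by simp) ((H.mul_mem_cancel_left hh).1 hc)
        · exact hlH x (by simp [hx])
      · rw [List.map_cons, List.prod_cons, map_mul, ← mul_assoc, toPush_base H n m h hh, toPush_mul,
          List.map_cons, List.prod_cons, map_mul]

lemma hasNF_of_mul {G : Type*} [Group G] (H : Subgroup G) (n : ℕ) (g : G) (γ)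
    (hγ : HasNF H γ) : HasNF H (toPush H (FreeGroup.of (n, g)) * γ) := by
  by_cases hg : g ∈ H
  · exact hasNF_base_mul H n g hg γ hγ
  rcases hγ with ⟨k, hk, rfl⟩ | ⟨l, ⟨hl0, hlc, hlH⟩, rfl⟩
  · refine Or.inr ⟨[(n, g * k)], ⟨by simp, by simp, ?_⟩, ?_⟩
    · intro x hx hc
      rw [List.mem_singleton] at hx
      subst hx
      exact hg ((H.mul_mem_cancel_right hk).1 hc)
    · rw [toPush_base H 0 n k hk, toPush_mul]; simp
  · cases l with
    | nil => exact (hl0 rfl).elim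
    | cons x l =>
      obtain ⟨m, g'⟩ := x
      by_cases hnm : n = m
      · subst hnm
        rw [List.map_cons, List.prod_cons, map_mul, ← mul_assoc, toPush_mul]
        by_cases hgg : g * g' ∈ H
        · apply hasNF_base_mul H n _ hgg
          by_cases hl : l = []
          · subst hl
            refine Or.inl ⟨1, H.one_mem, ?_⟩
            rw [toPush_of]; simp
          · refine Or.inr ⟨l, ⟨hl, ?_, fun x hx => hlH x (by simp [hx])⟩, rfl⟩
            simpa using hlc.tail
        · refine Or.inr ⟨(n, g * g') :: l, ⟨by simp, hlc, ?_⟩, ?_⟩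
          · intro x hx
            rcases List.mem_cons.1 hx with rfl | hx
            · exact hgg
            · exact hlH x (by simp [hx])
          · rw [List.map_cons, List.prod_cons, map_mul]
      · refine Or.inr ⟨(n, g) :: (m, g') :: l, ⟨by simp, ?_, ?_⟩, ?_⟩
        · simp only [List.map_cons, List.isChain_cons_cons] at hlc ⊢
          exact ⟨hnm, hlc⟩
        · intro x hx
          rcases List.mem_cons.1 hx with rfl | hx
          · exact hg
          · exact hlH x hx
        · rw [List.map_cons (l := (m, g') :: l), List.prod_cons, map_mul]

lemma hasNF_all {G : Type*} [Group G] (H : Subgroup G)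
    (γ : Monoid.PushoutI (fun _ : ℕ => H.subtype)) : HasNF H γ := by
  have key : ∀ γ' : Monoid.PushoutI (fun _ : ℕ => H.subtype), ∀ y, HasNF H y → HasNF H (γ' * y) := by
    intro γ'
    induction γ' using Monoid.PushoutI.induction_on with
    | of i g => intro y hy; rw [← toPush_of]; exact hasNF_of_mul H i g y hy
    | base h =>
      intro y hy
      rw [← Monoid.PushoutI.of_apply_eq_base (fun _ : ℕ => H.subtype) 0 h, ← toPush_of]
      exact hasNF_of_mul H 0 _ y hy
    | mul x y hx hy => intro z hz; rw [mul_assoc]; exact hx _ (hy _ hz)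
  have := key γ 1 (Or.inl ⟨1, H.one_mem, by rw [toPush_of, map_one]⟩)
  rwa [mul_one] at this

lemma exists_section {G : Type*} [Group G] (H : Subgroup G)
    (γ : Monoid.PushoutI (fun _ : ℕ => H.subtype)) : ∃ w, toPush H w = γ ∧
      (γ = 1 → w = 1) ∧ (γ ≠ 1 → (∃ h, h ≠ 1 ∧ w = FreeGroup.of (0, h)) ∨
        ∃ l, IsNice H l ∧ w = (l.map FreeGroup.of).prod) := by
  by_cases h1 : γ = 1
  · exact ⟨1, by simp [h1], fun _ => rfl, fun h => (h h1).elim⟩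
  rcases hasNF_all H γ with ⟨h, hh, e⟩ | ⟨l, hl, e⟩
  · refine ⟨_, e.symm, fun h => (h1 h).elim, fun _ => Or.inl ⟨h, ?_, rfl⟩⟩
    rintro rfl
    apply h1
    rw [e, toPush_of, map_one]
  · exact ⟨_, e.symm, fun h => (h1 h).elim, fun _ => Or.inr ⟨l, hl, rfl⟩⟩

lemma null_finset {G : Type*} [Group G] (H : Subgroup G) (S : Finset (FreeGroup (ℕ × G)))
    (hS : ∀ w ∈ S, w ∈ asympNull H) (ε : ℝ) (hε : 0 < ε) :
    ∃ E : Finset G, ∃ δ : ℝ, 0 < δ ∧ ∀ (X : Type) (_ : Finite X)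
    (Θ : ℕ × G → Equiv.Perm X), ApproxRel H E δ Θ → ∀ w ∈ S,
      permDist (FreeGroup.lift Θ w) 1 < ε := by
  classical
  induction S using Finset.induction_on with
  | empty => exact ⟨∅, 1, one_pos, by simp⟩
  | insert a S ha ih =>
    obtain ⟨E1, δ1, h1, hh1⟩ := ih (fun w hw => hS w (Finset.mem_insert_of_mem hw))
    obtain ⟨E2, δ2, h2, hh2⟩ := hS a (Finset.mem_insert_self _ _) ε hε
    refine ⟨E1 ∪ E2, min δ1 δ2, lt_min h1 h2, fun X _ Θ hΘ w hw => ?_⟩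
    rcases Finset.mem_insert.1 hw with rfl | hw
    · exact hh2 X inferInstance Θ (hΘ.mono Finset.subset_union_right (min_le_right _ _))
    · exact hh1 X inferInstance Θ (hΘ.mono Finset.subset_union_left (min_le_left _ _)) w hw

lemma select_index {G K : Type*} [Group G] [Group K] (H : Subgroup G)
    (Wt : RelSoficWitness.{u} H K) (E : Finset G) :
    ∃ (P : Type u) (_ : Group P) (Q : Subgroup P), IsSofic P ∧ IsAmenable Q ∧
      ∃ (p : G → P) (q : G → K),
        (∀ g ∈ E, ∀ h ∈ E, p (g * h) = p g * p h) ∧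
        (∀ g ∈ E, ∀ h ∈ E, q (g * h) = q g * q h) ∧
        (∀ g ∈ E, g ≠ 1 → p g ≠ 1 ∨ q g ≠ 1) ∧
        (∀ g ∈ E, g ∈ H → p g ∈ Q) ∧ (∀ g ∈ E, g ∉ H → p g ∉ Q) := by
  classical
  letI := Wt.instGi
  let N := upKer Wt.ω (fun i => Wt.Gi i × K)
  have hex : ∀ g : G, ∃ f : ∀ i, Wt.Gi i × K, QuotientGroup.mk' N f = Wt.π g := fun g =>
    QuotientGroup.mk'_surjective N (Wt.π g)
  choose f hf using hex
  have key : ∀ u v : ∀ i, Wt.Gi i × K, QuotientGroup.mk' N u = QuotientGroup.mk' N v ↔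
      ∀ᶠ i in (Wt.ω : Filter ℕ), u i = v i := by
    intro u v
    have h1 : QuotientGroup.mk' N u = QuotientGroup.mk' N v ↔ u⁻¹ * v ∈ N := QuotientGroup.eq
    rw [h1]
    change (∀ᶠ i in (Wt.ω : Filter ℕ), (u⁻¹ * v) i = 1) ↔ _
    refine Filter.eventually_congr (Filter.Eventually.of_forall fun i => ?_)
    rw [Pi.mul_apply, Pi.inv_apply, inv_mul_eq_one]
  have e1 : ∀ g h, ∀ᶠ i in (Wt.ω : Filter ℕ), f (g * h) i = f g i * f h i := by
    intro g h
    refine (key (f (g * h)) (f g * f h)).1 ?_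
    rw [map_mul, hf, hf, hf]
    exact map_mul Wt.π g h
  have e2 : ∀ g, g ≠ 1 → ∀ᶠ i in (Wt.ω : Filter ℕ), f g i ≠ 1 := by
    intro g hg
    refine Ultrafilter.eventually_not.2 fun hc => hg ?_
    have := (key (f g) 1).2 hc
    rw [map_one, hf] at this
    exact Wt.inj (this.trans (map_one Wt.π).symm)
  have e3 : ∀ g, g ∈ H → ∀ᶠ i in (Wt.ω : Filter ℕ), (f g i).1 ∈ Wt.Hi i := by
    intro g hg
    have h1 : Wt.π g ∈ Subgroup.map Wt.π H := ⟨g, hg, rfl⟩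
    rw [← Wt.inter] at h1
    obtain ⟨u, hu, hu2⟩ := h1.2
    have h2 := (key u (f g)).1 (hu2.trans (hf g).symm)
    filter_upwards [h2] with i hi
    rw [← hi]
    exact (hu i (Set.mem_univ i)).1
  have e4 : ∀ g, g ∉ H → ∀ᶠ i in (Wt.ω : Filter ℕ), (f g i).1 ∉ Wt.Hi i := by
    intro g hg
    refine Ultrafilter.eventually_not.2 fun hc => hg ?_
    let u : ∀ i, Wt.Gi i × K := fun i => if (f g i).1 ∈ Wt.Hi i then f g i else 1
    have hu : ∀ᶠ i in (Wt.ω : Filter ℕ), u i = f g i := by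
      filter_upwards [hc] with i hi
      exact if_pos hi
    have h1 : Wt.π g ∈ Subgroup.map Wt.π H := by
      rw [← Wt.inter]
      refine ⟨⟨g, trivial, rfl⟩, u, ?_, ((key u (f g)).2 hu).trans (hf g)⟩
      intro i _
      change u i ∈ (Wt.Hi i).prod ⊤
      by_cases h : (f g i).1 ∈ Wt.Hi i
      · have : u i = f g i := if_pos h
        rw [this]
        exact ⟨h, trivial⟩
      · have : u i = 1 := if_neg h
        rw [this]
        exact one_mem _
    obtain ⟨k, hk, hk2⟩ := h1
    rw [← Wt.inj hk2]
    exact hk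
  have a1 : ∀ᶠ i in (Wt.ω : Filter ℕ), ∀ g ∈ E, ∀ h ∈ E, f (g * h) i = f g i * f h i :=
    (Filter.eventually_all_finset E).2 fun g _ =>
      (Filter.eventually_all_finset E).2 fun h _ => e1 g h
  have a2 : ∀ᶠ i in (Wt.ω : Filter ℕ), ∀ g ∈ E, g ≠ 1 → f g i ≠ 1 :=
    (Filter.eventually_all_finset E).2 fun g _ => by
      by_cases h : g = 1
      · exact Filter.Eventually.of_forall fun i hc => absurd h hc
      · exact (e2 g h).mono fun i hi _ => hi
  have a3 : ∀ᶠ i in (Wt.ω : Filter ℕ), ∀ g ∈ E, g ∈ H → (f g i).1 ∈ Wt.Hi i :=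
    (Filter.eventually_all_finset E).2 fun g _ => by
      by_cases h : g ∈ H
      · exact (e3 g h).mono fun i hi _ => hi
      · exact Filter.Eventually.of_forall fun i hc => absurd hc h
  have a4 : ∀ᶠ i in (Wt.ω : Filter ℕ), ∀ g ∈ E, g ∉ H → (f g i).1 ∉ Wt.Hi i :=
    (Filter.eventually_all_finset E).2 fun g _ => by
      by_cases h : g ∈ H
      · exact Filter.Eventually.of_forall fun i hc => absurd h hc
      · exact (e4 g h).mono fun i hi _ => hi
  obtain ⟨i, ⟨⟨b1, b2⟩, b3⟩, b4⟩ := (((a1.and a2).and a3).and a4).exists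
  refine ⟨Wt.Gi i, Wt.instGi i, Wt.Hi i, Wt.sofic i, Wt.amenable i, fun g => (f g i).1,
    fun g => (f g i).2, fun g hg h hh => by
      have := b1 g hg h hh
      simp only [this]
      rfl,
    fun g hg h hh => by
      have := b1 g hg h hh
      simp only [this]
      rfl, fun g hg hg1 => ?_, b3, b4⟩
  refine Classical.byContradiction fun hc => b2 g hg hg1 ?_
  rw [not_or, not_not, not_not] at hc
  exact Prod.ext hc.1 hc.2

theorem isSofic_pushoutI_of_relativelySofic {G : Type*} [Group G] [Countable G]
    (H : Subgroup G) (K : Type*) [Group K] (hK : IsSofic K)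
    (h : RelativelySofic.{u} H K) :
    IsSofic (Monoid.PushoutI (fun _ : ℕ => H.subtype)) := by
  classical
  obtain ⟨Wt⟩ := h
  intro F ε hε
  choose s hs hs1 hs2 using exists_section H
  let S : Finset (FreeGroup (ℕ × G)) :=
    (F ×ˢ F).image fun x => (s x.1 * s x.2)⁻¹ * s (x.1 * x.2)
  obtain ⟨E0, δ0, hδ0, hnull⟩ := null_finset H S (by
    intro w hw
    obtain ⟨x, _, rfl⟩ := Finset.mem_image.1 hw
    apply mem_null
    rw [map_mul, map_inv, map_mul, hs, hs, hs, inv_mul_cancel]) ε hε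
  have hcode : ∀ γ : Monoid.PushoutI (fun _ : ℕ => H.subtype), ∃ (k : G) (l : List (ℕ × G)),
      γ ≠ 1 → (k ≠ 1 ∧ s γ = FreeGroup.of (0, k)) ∨
        (IsNice H l ∧ s γ = (l.map FreeGroup.of).prod) := by
    intro γ
    by_cases hγ : γ = 1
    · exact ⟨1, [], fun hc => absurd hγ hc⟩
    · rcases hs2 γ hγ with ⟨k, hk⟩ | ⟨l, hl⟩
      · exact ⟨k, [], fun _ => Or.inl hk⟩
      · exact ⟨1, l, fun _ => Or.inr hl⟩
  choose kk ll hkl using hcode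
  let T : Finset (List (ℕ × G)) := (F.image ll).filter fun l => IsNice H l
  let E : Finset G := E0 ∪ F.image kk ∪ F.biUnion fun γ => ((ll γ).map Prod.snd).toFinset
  obtain ⟨P, _, Q, hP, hQ, p, q, c1, c2, c3, c4, c5⟩ := select_index H Wt E
  obtain ⟨X, hX, hX2, Θ, hΘ, d1, d2⟩ := model H Q hP hQ hK E p q c1 c2 c3 c4 c5 T (by
    intro l hl
    obtain ⟨hl1, hl2⟩ := Finset.mem_filter.1 hl
    obtain ⟨γ, hγ, rfl⟩ := Finset.mem_image.1 hl1
    refine ⟨hl2.1, hl2.2.1, fun x hx => ⟨?_, hl2.2.2 x hx⟩⟩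
    refine Finset.mem_union_right _ (Finset.mem_biUnion.2 ⟨γ, hγ, ?_⟩)
    exact List.mem_toFinset.2 (List.mem_map.2 ⟨x, hx, rfl⟩)) (min δ0 ε) (lt_min hδ0 hε)
  have hmin : min δ0 ε ≤ ε := min_le_right _ _
  refine ⟨X, hX, hX2, fun γ => FreeGroup.lift Θ (s γ), ?_, ?_, ?_⟩
  · change FreeGroup.lift Θ (s 1) = 1
    rw [hs1 1 rfl, map_one]
  · intro g hg k hk
    change permDist (FreeGroup.lift Θ (s (g * k)))
      (FreeGroup.lift Θ (s g) * FreeGroup.lift Θ (s k)) < ε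
    rw [permDist_eq_one, ← map_mul, ← map_inv, ← map_mul]
    refine hnull X hX Θ (hΘ.mono ?_ (min_le_left _ _)) _ ?_
    · exact Finset.subset_union_left.trans Finset.subset_union_left
    · exact Finset.mem_image.2 ⟨(g, k), Finset.mem_product.2 ⟨hg, hk⟩, rfl⟩
  · intro g hg hg1
    change 1 - ε < permDist (FreeGroup.lift Θ (s g)) 1
    rcases hkl g hg1 with ⟨h1, h2⟩ | ⟨h1, h2⟩
    · rw [h2, FreeGroup.lift_apply_of]
      have := d1 0 (kk g) (Finset.mem_union_left _ (Finset.mem_union_right _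
        (Finset.mem_image_of_mem _ hg))) h1
      linarith
    · rw [h2, map_list_prod, List.map_map]
      have e : (FreeGroup.lift Θ : FreeGroup (ℕ × G) → Equiv.Perm X) ∘ FreeGroup.of = Θ := by
        funext x; exact FreeGroup.lift_apply_of
      rw [e]
      have := d2 (ll g) (Finset.mem_filter.2 ⟨Finset.mem_image_of_mem _ hg, h1⟩)
      linarith
end

section
/- Suppose H₁ < G₁ is relatively sofic over a group K₁ and H₂ < G₂ is relatively sofic over a group K₂. Then H₁ × H₂ < G₁ × G₂ is relatively sofic over K₁ × K₂. -/
universe u v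

theorem permDist_prod_le {A B : Type} [Finite A] [Finite B] [Nonempty A] [Nonempty B]
    (σ τ : Equiv.Perm A) (σ' τ' : Equiv.Perm B) :
    permDist (Equiv.prodCongr σ σ' : Equiv.Perm (A × B)) (Equiv.prodCongr τ τ') ≤
      permDist σ τ + permDist σ' τ' := by
  unfold permDist
  have hsub : {a : A × B | (Equiv.prodCongr σ σ') a ≠ (Equiv.prodCongr τ τ') a} ⊆
      ({a | σ a ≠ τ a} ×ˢ Set.univ) ∪ (Set.univ ×ˢ {b | σ' b ≠ τ' b}) := by
    rintro ⟨a, b⟩ h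
    by_contra hc
    simp at hc
    apply h
    simp [hc.1, hc.2]
  have h1 := (Set.ncard_le_ncard hsub (Set.toFinite _)).trans (Set.ncard_union_le _ _)
  rw [Set.ncard_prod, Set.ncard_prod, Set.ncard_univ, Set.ncard_univ] at h1
  have hA : (0:ℝ) < Nat.card A := by exact_mod_cast Nat.card_pos
  have hB : (0:ℝ) < Nat.card B := by exact_mod_cast Nat.card_pos
  rw [Nat.card_prod, div_add_div _ _ hA.ne' hB.ne']
  push_cast
  gcongr
  exact_mod_cast h1

theorem permDist_prod_ge_left {A B : Type} [Finite A] [Finite B] [Nonempty A] [Nonempty B]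
    (σ τ : Equiv.Perm A) (σ' τ' : Equiv.Perm B) :
    permDist σ τ ≤
    permDist (Equiv.prodCongr σ σ' : Equiv.Perm (A × B)) (Equiv.prodCongr τ τ') := by
  unfold permDist
  have hsub : ({a | σ a ≠ τ a} ×ˢ (Set.univ : Set B)) ⊆
      {a : A × B | (Equiv.prodCongr σ σ') a ≠ (Equiv.prodCongr τ τ') a} := by
    rintro ⟨a, b⟩ h hc
    simp at h hc
    exact h hc.1
  have h1 := (Set.ncard_le_ncard hsub (Set.toFinite _))
  rw [Set.ncard_prod, Set.ncard_univ] at h1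
  have hA : (0:ℝ) < Nat.card A := by exact_mod_cast Nat.card_pos
  have hB : (0:ℝ) < Nat.card B := by exact_mod_cast Nat.card_pos
  rw [Nat.card_prod, ← mul_div_mul_right _ _ hB.ne']
  push_cast
  gcongr
  exact_mod_cast h1

theorem permDist_prod_ge_right {A B : Type} [Finite A] [Finite B] [Nonempty A] [Nonempty B]
    (σ τ : Equiv.Perm A) (σ' τ' : Equiv.Perm B) :
    permDist σ' τ' ≤
    permDist (Equiv.prodCongr σ σ' : Equiv.Perm (A × B)) (Equiv.prodCongr τ τ') := by
  unfold permDist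
  have hsub : ((Set.univ : Set A) ×ˢ {b | σ' b ≠ τ' b}) ⊆
      {a : A × B | (Equiv.prodCongr σ σ') a ≠ (Equiv.prodCongr τ τ') a} := by
    rintro ⟨a, b⟩ h hc
    simp at h hc
    exact h hc.2
  have h1 := (Set.ncard_le_ncard hsub (Set.toFinite _))
  rw [Set.ncard_prod, Set.ncard_univ] at h1
  have hA : (0:ℝ) < Nat.card A := by exact_mod_cast Nat.card_pos
  have hB : (0:ℝ) < Nat.card B := by exact_mod_cast Nat.card_pos
  rw [Nat.card_prod, ← mul_div_mul_left _ _ hA.ne']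
  push_cast
  gcongr
  exact_mod_cast h1

theorem IsSofic.prod {G G' : Type*} [Group G] [Group G'] (h : IsSofic G) (h' : IsSofic G') :
    IsSofic (G × G') := by
  classical
  intro F ε hε
  obtain ⟨A, _, _, φ, h1, h2, h3⟩ := h (F.image Prod.fst) (ε / 2) (by positivity)
  obtain ⟨B, _, _, ψ, k1, k2, k3⟩ := h' (F.image Prod.snd) (ε / 2) (by positivity)
  refine ⟨A × B, inferInstance, inferInstance,
    fun g => Equiv.prodCongr (φ g.1) (ψ g.2), ?_, ?_, ?_⟩
  · ext x <;> simp [h1, k1]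
  · intro g hg k hk
    have a1 := h2 g.1 (Finset.mem_image_of_mem _ hg) k.1 (Finset.mem_image_of_mem _ hk)
    have a2 := k2 g.2 (Finset.mem_image_of_mem _ hg) k.2 (Finset.mem_image_of_mem _ hk)
    have a3 := permDist_prod_le (φ (g.1 * k.1)) (φ g.1 * φ k.1) (ψ (g.2 * k.2)) (ψ g.2 * ψ k.2)
    have : (Equiv.prodCongr (φ g.1) (ψ g.2) * Equiv.prodCongr (φ k.1) (ψ k.2) :
        Equiv.Perm (A × B)) = Equiv.prodCongr (φ g.1 * φ k.1) (ψ g.2 * ψ k.2) := by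
      ext x <;> simp
    simp only [Prod.fst_mul, Prod.snd_mul]
    rw [this]
    linarith
  · intro g hg hne
    have h11 : (1 : Equiv.Perm (A × B)) = Equiv.prodCongr (1 : Equiv.Perm A) (1 : Equiv.Perm B) := by
      ext x <;> simp
    rw [h11]
    by_cases hg1 : g.1 = 1
    · have hg2 : g.2 ≠ 1 := fun hc => hne (Prod.ext hg1 hc)
      have a1 := k3 g.2 (Finset.mem_image_of_mem _ hg) hg2
      have a2 := permDist_prod_ge_right (φ g.1) 1 (ψ g.2) 1
      linarith
    · have a1 := h3 g.1 (Finset.mem_image_of_mem _ hg) hg1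
      have a2 := permDist_prod_ge_left (φ g.1) 1 (ψ g.2) 1
      linarith

theorem IsAmenable.ofEquiv {G G' : Type*} [Group G] [Group G'] (e : G ≃* G')
    (h : IsAmenable G) : IsAmenable G' := by
  obtain ⟨m, m0, m1, m2, m3⟩ := h
  refine ⟨fun A => m (e ⁻¹' A), fun A => m0 _, by simpa using m1, fun A B hAB => ?_,
    fun g A => ?_⟩
  · beta_reduce
    rw [Set.preimage_union]
    exact m2 _ _ (hAB.preimage _)
  · beta_reduce
    rw [← m3 (e.symm g) (e ⁻¹' A)]
    congr 1
    ext x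
    simp only [Set.mem_preimage, Set.mem_image]
    constructor
    · rintro ⟨a, ha, hx⟩
      exact ⟨e.symm a, by simpa using ha, by rw [← map_mul, hx]; simp⟩
    · rintro ⟨a, ha, hx⟩
      exact ⟨e a, ha, by rw [← hx]; simp⟩

section fam
variable {X : Type*} (m : Set X → ℝ)
  (m0 : ∀ A : Set X, 0 ≤ m A) (m1 : m Set.univ = 1)
  (m2 : ∀ A B : Set X, Disjoint A B → m (A ∪ B) = m A + m B)

include m2 in
theorem fam_empty : m ∅ = 0 := by
  have := m2 ∅ ∅ (by simp)
  simp at this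
  exact this

include m2 in
theorem fam_biUnion {ι : Type*} (s : Finset ι) (w : X → ι) :
    m {x | w x ∈ s} = ∑ i ∈ s, m {x | w x = i} := by
  classical
  induction s using Finset.induction_on with
  | empty => simpa using fam_empty m m2
  | insert a s ha ih =>
    rw [Finset.sum_insert ha, ← ih, ← m2]
    · congr 1
      ext x
      simp
    · rw [Set.disjoint_left]
      intro x hx hx'
      simp only [Set.mem_ofPred_eq] at hx hx'
      exact ha (hx ▸ hx')

/-- integral of a natural valued function bounded by `N`. -/
noncomputable def famE (N : ℕ) (u : X → ℕ) : ℝ := ∑ k ∈ Finset.range N, (k : ℝ) * m {x | u x = k}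

include m2 in
theorem famE_comp {ι : Type*} [Fintype ι] (w : X → ι) (c : ι → ℕ) (N : ℕ) (hc : ∀ i, c i < N) :
    famE m N (fun x => c (w x)) = ∑ i, (c i : ℝ) * m {x | w x = i} := by
  classical
  unfold famE
  have : ∀ k, m {x | c (w x) = k} = ∑ i with c i = k, m {x | w x = i} := by
    intro k
    rw [← fam_biUnion m m2]
    simp
  simp_rw [this, Finset.mul_sum]
  rw [← Finset.sum_fiberwise_of_maps_to (s := Finset.univ) (t := Finset.range N) (g := c)
    (by simpa using hc)]
  refine Finset.sum_congr rfl fun k _ => Finset.sum_congr rfl fun i hi => ?_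
  simp at hi
  rw [hi]

include m0 m1 m2 in
theorem famE_add (N : ℕ) (u v t : X → ℕ) (hu : ∀ x, u x < N) (hv : ∀ x, v x < N)
    (ht : ∀ x, t x < N) (h1 : ∀ x, u x + v x ≤ t x) (h2 : ∀ x, t x ≤ u x + v x + 1) :
    |famE m N t - (famE m N u + famE m N v)| ≤ 1 := by
  let w : X → Fin N × Fin N × Fin N := fun x => (⟨u x, hu x⟩, ⟨v x, hv x⟩, ⟨t x, ht x⟩)
  have e1 := famE_comp m m2 w (fun i => i.1) N (fun i => i.1.2)
  have e2 := famE_comp m m2 w (fun i => i.2.1) N (fun i => i.2.1.2)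
  have e3 := famE_comp m m2 w (fun i => i.2.2) N (fun i => i.2.2.2)
  have e4 := fam_biUnion m m2 Finset.univ w
  simp only [Finset.mem_univ, Set.ofPred_true, m1] at e4
  simp only [w] at e1 e2 e3
  rw [e1, e2, e3, ← Finset.sum_add_distrib, ← Finset.sum_sub_distrib]
  refine (Finset.abs_sum_le_sum_abs _ _).trans ?_
  rw [e4]
  refine Finset.sum_le_sum fun i _ => ?_
  by_cases hi : ∃ x, w x = i
  · obtain ⟨x, rfl⟩ := hi
    have hm := m0 {y | w y = w x}
    have a1 : (u x : ℝ) + v x ≤ t x := by exact_mod_cast h1 x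
    have a2 : (t x : ℝ) ≤ u x + v x + 1 := by exact_mod_cast h2 x
    change |(t x : ℝ) * m {y | w y = w x} - (u x * m {y | w y = w x} + v x * m {y | w y = w x})|
      ≤ m {y | w y = w x}
    rw [abs_le]
    constructor <;> nlinarith
  · have : {x | w x = i} = ∅ := by
      ext x; simpa using fun h => hi ⟨x, h⟩
    change |(i.2.2 : ℝ) * m {y | w y = i} - (i.1 * m {y | w y = i} + i.2.1 * m {y | w y = i})|
      ≤ m {y | w y = i}
    rw [this, fam_empty m m2]; simp

include m0 m1 m2 in
theorem famE_le (N : ℕ) (u : X → ℕ) (hu : ∀ x, u x < N + 1) :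
    famE m (N + 1) u ≤ N := by
  have e4 := fam_biUnion m m2 (Finset.range (N + 1)) u
  have : {x | u x ∈ Finset.range (N + 1)} = Set.univ := by
    ext x; simpa using hu x
  rw [this, m1] at e4
  calc famE m (N + 1) u ≤ ∑ k ∈ Finset.range (N + 1), (N : ℝ) * m {x | u x = k} := by
        refine Finset.sum_le_sum fun k hk => ?_
        have : (k : ℝ) ≤ N := by
          have := Finset.mem_range.1 hk
          exact_mod_cast Nat.lt_succ_iff.1 this
        exact mul_le_mul_of_nonneg_right this (m0 _)
    _ = N := by rw [← Finset.mul_sum, ← e4, mul_one]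

/-- approximations to the integral. -/
noncomputable def famA (f : X → ℝ) (n : ℕ) : ℝ := famE m (n + 1) (fun x => ⌊n * f x⌋₊) / n

theorem floor_lt_aux (n : ℕ) (r : ℝ) (h1 : r ≤ 1) : ⌊n * r⌋₊ < n + 1 := by
  rw [Nat.lt_succ_iff]
  apply Nat.floor_le_of_le
  have : (0:ℝ) ≤ n := by positivity
  nlinarith

include m0 m1 m2 in
theorem famA_mem (f : X → ℝ) (hf1 : ∀ x, f x ≤ 1) (n : ℕ) :
    famA m f n ∈ Set.Icc (0:ℝ) 1 := by
  constructor
  · exact div_nonneg (Finset.sum_nonneg fun k _ => mul_nonneg (by positivity) (m0 _)) (by positivity)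
  · exact div_le_one_of_le₀ (famE_le m m0 m1 m2 n _ fun x => floor_lt_aux n _ (hf1 x)) (by positivity)

include m0 m1 m2 in
theorem exists_integral : ∃ I : (X → ℝ) → ℝ,
    (∀ f : X → ℝ, (∀ x, f x ≤ 1) → 0 ≤ I f) ∧ I (fun _ => 1) = 1 ∧
    (∀ f g : X → ℝ, (∀ x, 0 ≤ f x) → (∀ x, 0 ≤ g x) → (∀ x, f x + g x ≤ 1) →
      I (fun x => f x + g x) = I f + I g) ∧
    (∀ f g : X → ℝ, (∀ x, f x ≤ 1) → (∀ r : Set ℝ, m {x | f x ∈ r} = m {x | g x ∈ r}) →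
      (∀ x, g x ≤ 1) → I f = I g) := by
  have key : ∀ f : X → ℝ, ∃ L : ℝ, (∀ x, f x ≤ 1) → L ∈ Set.Icc (0:ℝ) 1 ∧
      Filter.Tendsto (famA m f) (Filter.hyperfilter ℕ : Ultrafilter ℕ) (nhds L) := by
    intro f
    by_cases hf : ∀ x, f x ≤ 1
    · obtain ⟨L, hL, hL'⟩ := (isCompact_Icc (a := (0:ℝ)) (b := 1)).ultrafilter_le_nhds
        ((Filter.hyperfilter ℕ).map (famA m f)) (by
          rw [Filter.le_principal_iff]
          exact Ultrafilter.mem_map.2 (Filter.Eventually.of_forall (fun n => famA_mem m m0 m1 m2 f hf n)))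
      exact ⟨L, fun _ => ⟨hL, hL'⟩⟩
    · exact ⟨0, fun h => absurd h hf⟩
  choose I hI using key
  have hle : ((Filter.hyperfilter ℕ : Ultrafilter ℕ) : Filter ℕ) ≤ Filter.atTop := by
    rw [← Nat.cofinite_eq_atTop]; exact Filter.hyperfilter_le_cofinite
  refine ⟨I, fun f hf => (hI f hf).1.1, ?_, ?_, ?_⟩
  · refine tendsto_nhds_unique (hI _ fun _ => le_rfl).2 ?_
    refine Filter.Tendsto.congr' ?_ tendsto_const_nhds
    filter_upwards [hle (Filter.eventually_gt_atTop 0)] with n hn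
    unfold famA famE
    rw [Finset.sum_range_succ, Finset.sum_eq_zero]
    · have : (n:ℝ) ≠ 0 := by have : 0 < n := hn
                             positivity
      simp [m1, this]
    · intro k hk
      have hk := Finset.mem_range.1 hk
      have : {x : X | ⌊(n:ℝ) * 1⌋₊ = k} = ∅ := by
        ext x; simp; omega
      rw [this, fam_empty m m2, mul_zero]
  · intro f g hf hg hfg
    have hf1 : ∀ x, f x ≤ 1 := fun x => by linarith [hf x, hg x, hfg x]
    have hg1 : ∀ x, g x ≤ 1 := fun x => by linarith [hf x, hg x, hfg x]
    refine tendsto_nhds_unique (hI _ hfg).2 ?_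
    have h0 : Filter.Tendsto (fun n => famA m (fun x => f x + g x) n - (famA m f n + famA m g n))
        (Filter.hyperfilter ℕ : Ultrafilter ℕ) (nhds 0) := by
      refine squeeze_zero_norm ?_ ((tendsto_one_div_atTop_nhds_zero_nat (𝕜 := ℝ)).mono_left hle)
      intro n
      unfold famA
      rw [← add_div, ← sub_div, norm_div, Real.norm_eq_abs, Real.norm_natCast]
      gcongr
      apply famE_add m m0 m1 m2
      · exact fun x => floor_lt_aux n _ (hf1 x)
      · exact fun x => floor_lt_aux n _ (hg1 x)
      · exact fun x => floor_lt_aux n _ (hfg x)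
      · intro x
        have := hf x
        have := hg x
        rw [mul_add]
        apply Nat.le_floor
        push_cast
        exact add_le_add (Nat.floor_le (by positivity)) (Nat.floor_le (by positivity))
      · intro x
        have := hf x
        have := hg x
        rw [← Nat.lt_succ_iff]
        rw [Nat.floor_lt (by positivity)]
        have := Nat.lt_floor_add_one (n * f x)
        have := Nat.lt_floor_add_one (n * g x)
        push_cast
        linarith
    have := h0.add ((hI _ hf1).2.add (hI _ hg1).2)
    simpa using this
  · intro f g hf hfg hg
    refine tendsto_nhds_unique (hI _ hf).2 ?_
    refine (hI _ hg).2.congr fun n => ?_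
    unfold famA famE
    congr 1
    refine Finset.sum_congr rfl fun k _ => ?_
    rw [show m {x | ⌊n * f x⌋₊ = k} = m {x | ⌊n * g x⌋₊ = k} from hfg {r | ⌊n * r⌋₊ = k}]

end fam

theorem IsAmenable.prod {G G' : Type*} [Group G] [Group G'] (h : IsAmenable G)
    (h' : IsAmenable G') : IsAmenable (G × G') := by
  obtain ⟨m, m0, m1, m2, m3⟩ := h
  obtain ⟨p, p0, p1, p2, p3⟩ := h'
  obtain ⟨I, i0, i1, i2, i3⟩ := exists_integral m m0 m1 m2
  have ple : ∀ A, p A ≤ 1 := by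
    intro A
    have := p2 A Aᶜ disjoint_compl_right
    rw [Set.union_compl_self, p1] at this
    linarith [p0 Aᶜ]
  refine ⟨fun A => I (fun x => p {y | (x, y) ∈ A}), fun A => i0 _ fun x => ple _, ?_, ?_, ?_⟩
  · simpa [p1] using i1
  · intro A B hAB
    have e : ∀ x, p {y | (x, y) ∈ A ∪ B} = p {y | (x, y) ∈ A} + p {y | (x, y) ∈ B} := by
      intro x
      rw [← p2]
      · rfl
      · exact hAB.preimage (fun y => (x, y))
    simp only [e]
    exact i2 _ _ (fun _ => p0 _) (fun _ => p0 _) (fun x => by rw [← e]; exact ple _)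
  · rintro ⟨g, g'⟩ A
    have e : ∀ x, p {y | (x, y) ∈ ((g, g') * ·) '' A} = p {y | (g⁻¹ * x, y) ∈ A} := by
      intro x
      rw [← p3 g' {y | (g⁻¹ * x, y) ∈ A}]
      congr 1
      ext y
      simp only [Set.mem_ofPred_eq, Set.mem_image, Prod.exists, Prod.mk_mul_mk, Prod.mk.injEq]
      constructor
      · rintro ⟨a, b, hab, rfl, rfl⟩
        exact ⟨b, by simpa using hab, rfl⟩
      · rintro ⟨b, hb, rfl⟩
        exact ⟨_, b, hb, by simp, rfl⟩
    simp only [e]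
    refine i3 _ _ (fun _ => ple _) (fun r => ?_) (fun _ => ple _)
    rw [← m3 g {x | p {y | (x, y) ∈ A} ∈ r}]
    congr 1
    ext x
    simp only [Set.mem_ofPred_eq, Set.mem_image]
    constructor
    · intro hx
      exact ⟨g⁻¹ * x, hx, by simp⟩
    · rintro ⟨x, hx, rfl⟩
      simpa using hx

section up
variable {ι : Type*} {ω : Ultrafilter ι} {G : ι → Type*} [∀ i, Group (G i)]

/-- Class of a sequence in the ultraproduct. -/
def upMk (ω : Ultrafilter ι) (f : ∀ i, G i) : Ultraproduct ω G :=
  QuotientGroup.mk' (upKer ω G) f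

theorem upMk_eq {f g : ∀ i, G i} :
    upMk ω f = upMk ω g ↔ ∀ᶠ i in (ω : Filter ι), f i = g i := by
  have : upMk ω f = upMk ω g ↔ f⁻¹ * g ∈ upKer ω G := QuotientGroup.eq
  rw [this]
  change (∀ᶠ i in (ω : Filter ι), (f i)⁻¹ * g i = 1) ↔ _
  simp only [inv_mul_eq_one]

theorem upMk_mul (f g : ∀ i, G i) : upMk ω (f * g) = upMk ω f * upMk ω g := rfl

/-- A representative. -/
noncomputable def upOut (x : Ultraproduct ω G) : ∀ i, G i :=
  Classical.choose (QuotientGroup.mk'_surjective (upKer ω G) x)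

theorem upMk_out (x : Ultraproduct ω G) : upMk ω (upOut x) = x :=
  Classical.choose_spec (QuotientGroup.mk'_surjective (upKer ω G) x)

theorem upOut_mul (x y : Ultraproduct ω G) :
    ∀ᶠ i in (ω : Filter ι), upOut (x * y) i = upOut x i * upOut y i := by
  have : upMk ω (upOut (x * y)) = upMk ω (upOut x * upOut y) := by
    rw [upMk_mul, upMk_out, upMk_out, upMk_out]
  exact upMk_eq.1 this

theorem upMk_mem {H : ∀ i, Subgroup (G i)} {f : ∀ i, G i} :
    upMk ω f ∈ upSubgroup ω H ↔ ∀ᶠ i in (ω : Filter ι), f i ∈ H i := by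
  classical
  constructor
  · rintro ⟨g, hg, hgf⟩
    filter_upwards [upMk_eq.1 (show upMk ω g = upMk ω f from hgf)] with i hi
    rw [← hi]
    exact hg i trivial
  · intro h
    refine ⟨fun i => if f i ∈ H i then f i else 1, ?_, ?_⟩
    · intro i _
      dsimp only
      split_ifs with hi
      · exact hi
      · exact (H i).one_mem
    · refine (upMk_eq (ω := ω)).2 ?_
      filter_upwards [h] with i hi
      simp [hi]

end up

theorem exists_joint (ω₁ ω₂ : Ultrafilter ℕ) : ∃ (ω : Ultrafilter ℕ) (p q : ℕ → ℕ),
    ω.map p = ω₁ ∧ ω.map q = ω₂ := by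
  let θ : Ultrafilter (ℕ × ℕ) := Ultrafilter.of ((ω₁ : Filter ℕ) ×ˢ (ω₂ : Filter ℕ))
  have hθ : (θ : Filter (ℕ × ℕ)) ≤ (ω₁ : Filter ℕ) ×ˢ (ω₂ : Filter ℕ) := Ultrafilter.of_le _
  refine ⟨θ.map Nat.pairEquiv, fun n => (Nat.pairEquiv.symm n).1,
    fun n => (Nat.pairEquiv.symm n).2, ?_, ?_⟩
  · rw [Ultrafilter.map_map]
    have : (fun n => (Nat.pairEquiv.symm n).1) ∘ Nat.pairEquiv = Prod.fst := by
      ext x; simp only [Function.comp, Equiv.symm_apply_apply]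
    rw [this]
    exact Ultrafilter.coe_le_coe.1 ((Filter.map_mono hθ).trans Filter.tendsto_fst)
  · rw [Ultrafilter.map_map]
    have : (fun n => (Nat.pairEquiv.symm n).2) ∘ Nat.pairEquiv = Prod.snd := by
      ext x; simp only [Function.comp, Equiv.symm_apply_apply]
    rw [this]
    exact Ultrafilter.coe_le_coe.1 ((Filter.map_mono hθ).trans Filter.tendsto_snd)

theorem witness_mem_iff {G K : Type*} [Group G] [Group K] {ι : Type*} {ω : Ultrafilter ι}
    {L : ι → Type*} [∀ i, Group (L i)] (H : Subgroup G) (S : Subgroup (Ultraproduct ω L))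
    (π : G →* Ultraproduct ω L) (inj : Function.Injective π) :
    Subgroup.map π ⊤ ⊓ S = Subgroup.map π H ↔ ∀ g, π g ∈ S ↔ g ∈ H := by
  constructor
  · intro h g
    rw [← Subgroup.mem_map_iff_mem inj (K := H), ← h]
    simp
  · intro h
    ext x
    constructor
    · rintro ⟨⟨g, -, rfl⟩, hx⟩
      exact ⟨g, (h g).1 hx, rfl⟩
    · rintro ⟨g, hg, rfl⟩
      exact ⟨⟨g, trivial, rfl⟩, (h g).2 hg⟩

/-- Relative soficity is preserved under finite direct products. -/
theorem relativelySofic_prod {G₁ G₂ K₁ K₂ : Type*} [Group G₁] [Group G₂]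
    [Group K₁] [Group K₂] (H₁ : Subgroup G₁) (H₂ : Subgroup G₂)
    (h₁ : RelativelySofic.{u} H₁ K₁) (h₂ : RelativelySofic.{v} H₂ K₂) :
    RelativelySofic.{max u v} (H₁.prod H₂) (K₁ × K₂) := by
  obtain ⟨⟨A, S, ω₁, free₁, sof₁, am₁, π₁, inj₁, int₁⟩⟩ := h₁
  obtain ⟨⟨B, T, ω₂, free₂, sof₂, am₂, π₂, inj₂, int₂⟩⟩ := h₂
  obtain ⟨ω, p, q, rfl, rfl⟩ := exists_joint ω₁ ω₂
  rw [witness_mem_iff (K := K₁) _ _ _ inj₁] at int₁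
  rw [witness_mem_iff (K := K₂) _ _ _ inj₂] at int₂
  let F : G₁ × G₂ → ∀ j, (A (p j) × B (q j)) × (K₁ × K₂) := fun g j =>
    (((upOut (π₁ g.1) (p j)).1, (upOut (π₂ g.2) (q j)).1),
     ((upOut (π₁ g.1) (p j)).2, (upOut (π₂ g.2) (q j)).2))
  let π : G₁ × G₂ →* Ultraproduct ω (fun j => (A (p j) × B (q j)) × (K₁ × K₂)) :=
    MonoidHom.mk' (fun g => upMk ω (F g)) (by
      intro g h
      rw [← upMk_mul, upMk_eq]
      have a1 : ∀ᶠ j in (ω : Filter ℕ), _ := upOut_mul (π₁ g.1) (π₁ h.1)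
      have a2 : ∀ᶠ j in (ω : Filter ℕ), _ := upOut_mul (π₂ g.2) (π₂ h.2)
      filter_upwards [a1, a2] with j b1 b2
      simp only [F, Prod.fst_mul, Prod.snd_mul, map_mul, Pi.mul_apply]
      rw [b1, b2]
      rfl)
  have hπ : ∀ g, π g = upMk ω (F g) := fun g => rfl
  have inj : Function.Injective π := by
    intro g h hgh
    rw [hπ, hπ, upMk_eq] at hgh
    refine Prod.ext (inj₁ ?_) (inj₂ ?_)
    · rw [← upMk_out (π₁ g.1), ← upMk_out (π₁ h.1), upMk_eq]
      change ∀ᶠ j in (ω : Filter ℕ), upOut (π₁ g.1) (p j) = upOut (π₁ h.1) (p j)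
      filter_upwards [hgh] with j hj
      simp only [F, Prod.mk.injEq] at hj
      exact Prod.ext hj.1.1 hj.2.1
    · rw [← upMk_out (π₂ g.2), ← upMk_out (π₂ h.2), upMk_eq]
      change ∀ᶠ j in (ω : Filter ℕ), upOut (π₂ g.2) (q j) = upOut (π₂ h.2) (q j)
      filter_upwards [hgh] with j hj
      simp only [F, Prod.mk.injEq] at hj
      exact Prod.ext hj.1.2 hj.2.2
  refine ⟨⟨fun j => A (p j) × B (q j), fun j => (S (p j)).prod (T (q j)), ω, ?_,
    fun j => (sof₁ _).prod (sof₂ _),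
    fun j => ((am₁ _).prod (am₂ _)).ofEquiv (Subgroup.prodEquiv _ _).symm, π, inj, ?_⟩⟩
  · intro s hs hsω
    refine free₁ (p '' s) (hs.image p) ?_
    exact Ultrafilter.mem_map.2 <| Filter.mem_of_superset hsω (Set.subset_preimage_image p s)
  · rw [witness_mem_iff (K := K₁) _ _ _ inj]
    intro g
    rw [Subgroup.mem_prod, ← int₁, ← int₂, hπ, upMk_mem, ← upMk_out (π₁ g.1),
      ← upMk_out (π₂ g.2), upMk_mem, upMk_mem]
    change _ ↔ (∀ᶠ j in (ω : Filter ℕ), upOut (π₁ g.1) (p j) ∈ (S (p j)).prod ⊤) ∧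
      (∀ᶠ j in (ω : Filter ℕ), upOut (π₂ g.2) (q j) ∈ (T (q j)).prod ⊤)
    rw [← Filter.eventually_and]
    simp only [F, Subgroup.mem_prod, Subgroup.mem_top, and_true]
end

section
/- Let (G_k)_{k∈ℕ} be a sequence of countable groups all containing a common subgroup H, and suppose the sequence (H < G_k)_{k∈ℕ} is consistently relatively sofic over a sofic group K. Then the amalgamated free product ∗_H^{k∈ℕ} G_k of the groups G_k amalgamated over H (via the given inclusions H ↪ G_k) is sofic. -/
universe u

/-- A witness that the family of inclusions `ι k : H ↪ G k` is
consistently relatively sofic over `K`. -/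
structure ConsRelSoficWitness {H : Type*} [Group H] {G : ℕ → Type*} [∀ k, Group (G k)]
    (ι : ∀ k, H →* G k) (K : Type*) [Group K] where
  L : ℕ → Type u
  [instL : ∀ i, Group (L i)]
  Hi : ∀ i, Subgroup (L i)
  ω : Ultrafilter ℕ
  free : ∀ s : Set ℕ, s.Finite → s ∉ ω
  sofic : ∀ i, IsSofic (L i)
  amenable : ∀ i, IsAmenable (Hi i)
  π : ∀ k, G k →* Ultraproduct ω (fun i => L i × K)
  inj : ∀ k, Function.Injective (π k)
  inter : ∀ k, Subgroup.map (π k) ⊤ ⊓ upSubgroup ω (fun i => (Hi i).prod ⊤)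
      = Subgroup.map (π k) (Subgroup.map (ι k) ⊤)
  consistent : ∀ (h : H) (k k' : ℕ), π k (ι k h) = π k' (ι k' h)

/-- The family `(H < G_k)` is consistently relatively sofic over `K`. -/
def ConsistentlyRelativelySofic {H : Type*} [Group H] {G : ℕ → Type*} [∀ k, Group (G k)]
    (ι : ∀ k, H →* G k) (K : Type*) [Group K] : Prop :=
  Nonempty (ConsRelSoficWitness.{u} ι K)


namespace SoficAux
open scoped Pointwise
open Classical in
theorem fin_add {H : Type*} (m : Set H → ℝ)
    (hd : ∀ A B : Set H, Disjoint A B → m (A ∪ B) = m A + m B) {κ : Type*} (s : Finset κ)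
    (X : κ → Set H) (hX : ∀ i ∈ s, ∀ j ∈ s, i ≠ j → Disjoint (X i) (X j)) :
    m (⋃ i ∈ s, X i) = ∑ i ∈ s, m (X i) := by
  induction s using Finset.induction_on with
  | empty =>
    have := hd ∅ ∅ (by simp)
    simp at this ⊢
    exact this
  | insert a s ha ih =>
    rw [Finset.set_biUnion_insert, hd, ih, Finset.sum_insert ha]
    · intro i hi j hj
      exact hX i (Finset.mem_insert_of_mem hi) j (Finset.mem_insert_of_mem hj)
    · simp only [Set.disjoint_iUnion_right]
      intro i hi
      exact hX a (Finset.mem_insert_self _ _) i (Finset.mem_insert_of_mem hi)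
        (by rintro rfl; exact ha hi)

theorem folner {H : Type*} [Group H] [DecidableEq H] (hH : IsAmenable H) (S : Finset H) (ε : ℝ) (hε : 0 < ε) :
    ∃ T : Finset H, T.Nonempty ∧ (((S * T).card : ℕ) : ℝ) < (1 + ε) * T.card := by
  by_contra hcon
  push Not at hcon
  have hpow : ∀ n : ℕ, ∀ T : Finset H, T.Nonempty → 
      (1 + ε) ^ n * T.card ≤ (((S ^ n * T).card : ℕ) : ℝ) := by
    have hSne : S.Nonempty := by
      by_contra h
      rw [Finset.not_nonempty_iff_eq_empty] at h
      have := hcon {1} (by simp)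
      simp [h] at this
      linarith
    intro n
    induction n with
    | zero => intro T hT; simp
    | succ n ih =>
      intro T hT
      have h1 := ih (S * T) (hSne.mul hT)
      have h2 := hcon T hT
      rw [pow_succ S, mul_assoc, pow_succ, mul_assoc]
      refine le_trans ?_ h1
      gcongr
  obtain ⟨n, hn⟩ := pow_unbounded_of_one_lt (2 : ℝ) (show (1 : ℝ) < 1 + ε by linarith)
  set R := S ^ n with hR
  have h2 : ∀ T : Finset H, 2 * T.card ≤ (R * T).card := by
    intro T
    rcases T.eq_empty_or_nonempty with rfl | hT
    · simp
    have := hpow n T hT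
    have : (2 : ℝ) * T.card ≤ (R * T).card := le_trans (by gcongr) this
    exact_mod_cast this
  obtain ⟨f, hf, hfm⟩ := (Finset.all_card_le_biUnion_card_iff_exists_injective
    (fun x : H × Bool => R * {x.1})).1 (by
      intro s
      have h3 : s.card ≤ 2 * (s.image Prod.fst).card := by
        have : s ⊆ (s.image Prod.fst) ×ˢ (Finset.univ : Finset Bool) := by
          intro x hx
          simp only [Finset.mem_product, Finset.mem_univ, and_true]
          exact Finset.mem_image_of_mem _ hx
        have := Finset.card_le_card this
        simp [Finset.card_product] at this
        omega
      refine h3.trans ((h2 _).trans (Finset.card_le_card ?_))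
      intro x hx
      rw [Finset.mem_mul] at hx
      obtain ⟨r, hr, y, hy, rfl⟩ := hx
      obtain ⟨z, hz, rfl⟩ := Finset.mem_image.1 hy
      rw [Finset.mem_biUnion]
      exact ⟨z, hz, Finset.mul_mem_mul hr (by simp)⟩)
  obtain ⟨m, hm0, hm1, hmd, hmi⟩ := hH
  let X : Bool → H → Set H := fun b r => {g | f (g, b) = r * g}
  have hXsum : ∀ b, ∑ r ∈ R, m (X b r) = 1 := by
    intro b
    rw [← fin_add m hmd, ← hm1]
    · congr 1
      ext g
      simp only [Set.mem_iUnion, Set.mem_univ, iff_true]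
      have := hfm (g, b)
      rw [Finset.mem_mul] at this
      obtain ⟨r, hr, y, hy, h⟩ := this
      simp at hy
      subst hy
      exact ⟨r, hr, h.symm⟩
    · intro r _ r' _ hne
      rw [Set.disjoint_left]
      intro g (h : f (g,b) = r * g) (h' : f (g,b) = r' * g)
      exact hne (mul_right_cancel (h.symm.trans h'))
  have hYsum : ∑ x ∈ (Finset.univ : Finset Bool) ×ˢ R, m ((x.2 * ·) '' X x.1 x.2) ≤ 1 := by
    rw [← fin_add m hmd]
    · have := hmd (⋃ i ∈ (Finset.univ : Finset Bool) ×ˢ R, (i.2 * ·) '' X i.1 i.2) _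
        disjoint_compl_right
      rw [Set.union_compl_self, hm1] at this
      linarith [hm0 (⋃ i ∈ (Finset.univ : Finset Bool) ×ˢ R, (i.2 * ·) '' X i.1 i.2)ᶜ]
    · rintro ⟨b, r⟩ _ ⟨b', r'⟩ _ hne
      rw [Set.disjoint_left]
      rintro _ ⟨g, (hg : f (g,b) = r * g), rfl⟩ ⟨g', (hg' : f (g',b') = r' * g'), h⟩
      simp only at h
      rw [← hg, ← hg'] at h
      have := hf h
      simp only [Prod.mk.injEq] at this
      obtain ⟨rfl, rfl⟩ := this
      rw [hg] at hg'
      exact hne (by rw [mul_right_cancel hg'])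
  simp only [hmi, Finset.sum_product, hXsum] at hYsum
  norm_num at hYsum

noncomputable def am {A : Type*} {n : ℕ} (e : A ≃ Fin n) (σ : Equiv.Perm A) (X : Finset A) 
    (hX : X.Nonempty) : A := (Finset.exists_min_image X (fun a => e (σ a)) hX).choose

section
variable {A : Type*} {n : ℕ} (e : A ≃ Fin n) (σ : Equiv.Perm A) (X : Finset A) (hX : X.Nonempty)

theorem am_mem : am e σ X hX ∈ X :=
  (Finset.exists_min_image X (fun a => e (σ a)) hX).choose_spec.1

theorem am_le (y : A) (hy : y ∈ X) : e (σ (am e σ X hX)) ≤ e (σ y) :=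
  (Finset.exists_min_image X (fun a => e (σ a)) hX).choose_spec.2 y hy

theorem am_eq_iff (x : A) : am e σ X hX = x ↔ x ∈ X ∧ ∀ y ∈ X, e (σ x) ≤ e (σ y) := by
  constructor
  · rintro rfl
    exact ⟨am_mem e σ X hX, am_le e σ X hX⟩
  · rintro ⟨h1, h2⟩
    exact σ.injective (e.injective (le_antisymm (am_le e σ X hX x h1) (h2 _ (am_mem e σ X hX))))

open Classical in
theorem am_card [Fintype A] (x : A) (hx : x ∈ X) :
    (Finset.univ.filter fun σ => am e σ X hX = x).card * X.card = Fintype.card (Equiv.Perm A) := by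
  have key : ∀ y ∈ X, (Finset.univ.filter fun σ => am e σ X hX = y).card =
      (Finset.univ.filter fun σ => am e σ X hX = x).card := by
    intro y hy
    refine Finset.card_bij (fun σ _ => σ * Equiv.swap x y) ?_ ?_ ?_
    · intro σ hσ
      simp only [Finset.mem_filter, Finset.mem_univ, true_and, am_eq_iff] at hσ ⊢
      refine ⟨hx, fun z hz => ?_⟩
      simp only [Equiv.Perm.mul_apply, Equiv.swap_apply_left]
      apply hσ.2
      rw [Equiv.swap_apply_def]
      split_ifs <;> assumption
    · intro a _ b _ h
      exact mul_right_cancel h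
    · intro σ hσ
      refine ⟨σ * Equiv.swap x y, ?_, by simp [mul_assoc]⟩
      simp only [Finset.mem_filter, Finset.mem_univ, true_and, am_eq_iff] at hσ ⊢
      refine ⟨hy, fun z hz => ?_⟩
      simp only [Equiv.Perm.mul_apply, Equiv.swap_apply_right]
      apply hσ.2
      rw [Equiv.swap_apply_def]
      split_ifs <;> assumption
  have := Finset.card_eq_sum_card_fiberwise (f := fun σ => am e σ X hX)
    (s := (Finset.univ : Finset (Equiv.Perm A))) (t := X) (fun σ _ => am_mem e σ X hX)
  rw [Finset.sum_congr rfl key] at this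
  rw [← Finset.card_univ, this]
  simp [mul_comm]

open Classical in
theorem am_ne_card [Fintype A] (Y : Finset A) (hY : Y.Nonempty) :
    (Finset.univ.filter fun σ => am e σ X hX ≠ am e σ Y hY).card * (X ∪ Y).card ≤ 
      ((X ∪ Y) \ (X ∩ Y)).card * Fintype.card (Equiv.Perm A) := by
  have hU : (X ∪ Y).Nonempty := hX.mono Finset.subset_union_left
  have hsub : (Finset.univ.filter fun σ => am e σ X hX ≠ am e σ Y hY) ⊆
     ((X ∪ Y) \ (X ∩ Y)).biUnion fun z => Finset.univ.filter fun σ => am e σ (X ∪ Y) hU = z := by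
    intro σ hσ
    simp only [Finset.mem_filter, Finset.mem_univ, true_and, Finset.mem_biUnion] at hσ ⊢
    refine ⟨_, ?_, rfl⟩
    rw [Finset.mem_sdiff]
    refine ⟨am_mem _ _ _ _, fun h => hσ ?_⟩
    rw [Finset.mem_inter] at h
    have h1 : am e σ X hX = am e σ (X ∪ Y) hU := (am_eq_iff _ _ _ _ _).2
      ⟨h.1, fun y hy => am_le _ _ _ _ _ (Finset.mem_union_left _ hy)⟩
    have h2 : am e σ Y hY = am e σ (X ∪ Y) hU := (am_eq_iff _ _ _ _ _).2
      ⟨h.2, fun y hy => am_le _ _ _ _ _ (Finset.mem_union_right _ hy)⟩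
    rw [h1, h2]
  refine (Nat.mul_le_mul_right _ ((Finset.card_le_card hsub).trans Finset.card_biUnion_le)).trans ?_
  rw [Finset.sum_mul, Finset.sum_congr rfl (fun z hz => am_card e (X ∪ Y) hU z (Finset.mem_sdiff.1 hz).1)]
  simp
end
open Filter

/-- filter of asymptotically full subsets -/
def MF {J : Type*} (𝓕 : Filter J) (A : J → Type) [∀ j, Finite (A j)] : Filter (Σ j, A j) where
  sets := {S | ∀ δ : ℝ, 0 < δ → ∀ᶠ j in 𝓕,
    (Set.ncard {a : A j | (⟨j, a⟩ : Σ j, A j) ∉ S} : ℝ) ≤ δ * Nat.card (A j)}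
  univ_sets := by
    intro δ hδ
    refine Eventually.of_forall fun j => ?_
    have : {a : A j | (⟨j, a⟩ : Σ j, A j) ∉ (Set.univ : Set (Σ j, A j))} = ∅ := by
      ext a; simp
    rw [this, Set.ncard_empty]
    push_cast
    positivity
  sets_of_superset := by
    intro S T hS hST δ hδ
    filter_upwards [hS δ hδ] with j hj
    refine le_trans ?_ hj
    exact_mod_cast Set.ncard_le_ncard (fun a (ha : _ ∉ T) => fun h => ha (hST h)) (Set.toFinite _)
  inter_sets := by
    intro S T hS hT δ hδ
    filter_upwards [hS (δ/2) (by positivity), hT (δ/2) (by positivity)] with j h1 h2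
    have h3 : {a : A j | (⟨j, a⟩ : Σ j, A j) ∉ S ∩ T} ⊆ 
      {a : A j | (⟨j, a⟩ : Σ j, A j) ∉ S} ∪ {a : A j | (⟨j, a⟩ : Σ j, A j) ∉ T} := by
      intro a ha
      by_contra hb
      simp only [Set.mem_union, Set.mem_ofPred_eq, not_or, not_not] at hb
      exact ha hb
    have h4 := (Set.ncard_le_ncard h3 (Set.toFinite _)).trans (Set.ncard_union_le _ _)
    have h5 : (Set.ncard {a : A j | (⟨j, a⟩ : Σ j, A j) ∉ S ∩ T} : ℝ) ≤ 
      Set.ncard {a : A j | (⟨j, a⟩ : Σ j, A j) ∉ S} +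
       Set.ncard {a : A j | (⟨j, a⟩ : Σ j, A j) ∉ T} := by exact_mod_cast h4
    linarith

section
variable {J : Type*} {𝓕 : Filter J} {A : J → Type} [∀ j, Finite (A j)]

theorem eventually_MF {P : (Σ j, A j) → Prop} : (∀ᶠ x in MF 𝓕 A, P x) ↔ 
    ∀ δ : ℝ, 0 < δ → ∀ᶠ j in 𝓕,
    (Set.ncard {a : A j | ¬ P ⟨j, a⟩} : ℝ) ≤ δ * Nat.card (A j) := Iff.rfl

theorem eventually_MF_of {P : J → Prop} (h : ∀ᶠ j in 𝓕, P j) : ∀ᶠ x in MF 𝓕 A, P x.1 := by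
  rw [eventually_MF]
  intro δ hδ
  filter_upwards [h] with j hj
  simp [hj]
  positivity

def sg (σ : ∀ j, Equiv.Perm (A j)) (x : Σ j, A j) : Σ j, A j := ⟨x.1, σ x.1 x.2⟩

theorem tendsto_sg (σ : ∀ j, Equiv.Perm (A j)) : Tendsto (sg σ) (MF 𝓕 A) (MF 𝓕 A) := by
  intro S hS δ hδ
  filter_upwards [hS δ hδ] with j hj
  refine le_trans (le_of_eq ?_) hj
  congr 1
  have : {a : A j | (⟨j, a⟩ : Σ j, A j) ∉ S} = 
    σ j '' {a : A j | (⟨j, a⟩ : Σ j, A j) ∉ sg σ ⁻¹' S} := by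
    ext a
    constructor
    · intro h
      refine ⟨(σ j)⁻¹ a, ?_, by simp⟩
      simpa [sg] using h
    · rintro ⟨b, hb, rfl⟩
      simpa [sg] using hb
  rw [this, Set.ncard_image_of_injective _ (σ j).injective]

theorem tendsto_proj (Y : J → Type) [∀ j, Finite (Y j)] : 
    Tendsto (fun x : Σ j, A j × Y j => (⟨x.1, x.2.1⟩ : Σ j, A j)) (MF 𝓕 (fun j => A j × Y j))
      (MF 𝓕 A) := by
  intro S hS δ hδ
  filter_upwards [hS δ hδ] with j hj
  have : {a : A j × Y j | (⟨j, a⟩ : Σ j, A j × Y j) ∉ 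
      (fun x : Σ j, A j × Y j => (⟨x.1, x.2.1⟩ : Σ j, A j)) ⁻¹' S} = 
      {a : A j | (⟨j, a⟩ : Σ j, A j) ∉ S} ×ˢ Set.univ := by
    ext a; simp
  rw [this, Set.ncard_prod, Nat.card_prod, Set.ncard_univ]
  push_cast
  rw [← mul_assoc]
  gcongr

variable (𝓕 A) in
def Triv (σ : ∀ j, Equiv.Perm (A j)) : Prop := ∀ᶠ x in MF 𝓕 A, σ x.1 x.2 = x.2

theorem Triv.one : Triv 𝓕 A 1 := Eventually.of_forall fun x => by simp

theorem Triv.mul {a b : ∀ j, Equiv.Perm (A j)} (ha : Triv 𝓕 A a) (hb : Triv 𝓕 A b) :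
    Triv 𝓕 A (a * b) := by
  unfold Triv at *
  filter_upwards [ha, hb] with x h1 h2
  rw [Pi.mul_apply, Equiv.Perm.mul_apply, h2, h1]

theorem Triv.inv {a : ∀ j, Equiv.Perm (A j)} (ha : Triv 𝓕 A a) : Triv 𝓕 A a⁻¹ := by
  unfold Triv at *
  filter_upwards [ha] with x h1
  rw [Pi.inv_apply, Equiv.Perm.inv_eq_iff_eq, h1]

variable (𝓕 A) in
/-- sequences of permutations that are asymptotically trivial -/
def upN : Subgroup (∀ j, Equiv.Perm (A j)) where
  carrier := {σ | Triv 𝓕 A σ}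
  one_mem' := Triv.one
  mul_mem' := Triv.mul
  inv_mem' := Triv.inv

theorem mem_upN {σ : ∀ j, Equiv.Perm (A j)} : σ ∈ upN 𝓕 A ↔ ∀ᶠ x in MF 𝓕 A, σ x.1 x.2 = x.2 :=
  Iff.rfl

instance : (upN 𝓕 A).Normal := by
  constructor
  intro a ha g
  have := (tendsto_sg (𝓕 := 𝓕) (g⁻¹)).eventually ha
  rw [mem_upN]
  filter_upwards [this] with x hx
  simp only [sg] at hx
  have h2 : g x.1 (a x.1 (g⁻¹ x.1 x.2)) = g x.1 (g⁻¹ x.1 x.2) := congrArg _ hx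
  exact h2.trans ((g x.1).apply_symm_apply x.2)

theorem mk_eq {σ τ : ∀ j, Equiv.Perm (A j)} : 
    (QuotientGroup.mk σ : _ ⧸ upN 𝓕 A) = QuotientGroup.mk τ ↔ 
      ∀ᶠ x in MF 𝓕 A, σ x.1 x.2 = τ x.1 x.2 := by
  rw [QuotientGroup.eq, mem_upN]
  refine eventually_congr (Eventually.of_forall fun x => ?_)
  rw [Pi.mul_apply, Pi.inv_apply, Equiv.Perm.mul_apply, Equiv.Perm.inv_eq_iff_eq]
  exact eq_comm

open Classical in
theorem isSofic_of_hom {P : Type*} [Group P] [𝓕.NeBot] [∀ j, Nonempty (A j)]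
    (θ : P →* (∀ j, Equiv.Perm (A j)) ⧸ upN 𝓕 A)
    (hθ : ∀ p, p ≠ 1 → ∃ σ : ∀ j, Equiv.Perm (A j), θ p = QuotientGroup.mk σ ∧ 
      ∀ᶠ x in MF 𝓕 A, σ x.1 x.2 ≠ x.2) : IsSofic P := by
  intro F ε hε
  have : ∀ p, ∃ σ : ∀ j, Equiv.Perm (A j), θ p = QuotientGroup.mk σ ∧ (p = 1 → σ = 1) ∧
      (p ≠ 1 → ∀ᶠ x in MF 𝓕 A, σ x.1 x.2 ≠ x.2) := by
    intro p
    by_cases hp : p = 1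
    · exact ⟨1, by rw [hp, map_one]; rfl, fun _ => rfl, fun h => absurd hp h⟩
    · obtain ⟨σ, h1, h2⟩ := hθ p hp
      exact ⟨σ, h1, fun h => absurd h hp, fun _ => h2⟩
  choose φ h1 h2 h3 using this
  have hm : ∀ g ∈ F, ∀ h ∈ F, ∀ᶠ j in 𝓕, permDist (φ (g * h) j) (φ g j * φ h j) < ε := by
    intro g _ h _
    have e : (QuotientGroup.mk (φ (g * h)) : _ ⧸ upN 𝓕 A) = QuotientGroup.mk (φ g * φ h) := by
      rw [← h1, map_mul, h1, h1]; rfl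
    rw [mk_eq, eventually_MF] at e
    filter_upwards [e (ε/2) (by positivity)] with j hj
    have hc : (0 : ℝ) < Nat.card (A j) := by exact_mod_cast Nat.card_pos
    unfold permDist
    rw [div_lt_iff₀ hc]
    refine lt_of_le_of_lt hj ?_
    nlinarith
  have hn : ∀ g ∈ F, ∀ᶠ j in 𝓕, g ≠ 1 → 1 - ε < permDist (φ g j) 1 := by
    intro g _
    by_cases hg : g = 1
    · exact Eventually.of_forall fun j h => absurd hg h
    have e := h3 g hg
    rw [eventually_MF] at e
    filter_upwards [e (ε/2) (by positivity)] with j hj _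
    have hc : (0 : ℝ) < Nat.card (A j) := by exact_mod_cast Nat.card_pos
    unfold permDist
    rw [lt_div_iff₀ hc]
    have := Set.ncard_add_ncard_compl {a | φ g j a ≠ (1 : Equiv.Perm (A j)) a}
    have hs : ({a | φ g j a ≠ (1 : Equiv.Perm (A j)) a})ᶜ = {a | ¬ (φ g j a ≠ a)} := by
      ext a; simp
    rw [hs] at this
    have t : (Set.ncard {a | φ g j a ≠ (1 : Equiv.Perm (A j)) a} : ℝ) +
      Set.ncard {a | ¬ (φ g j a ≠ a)} = Nat.card (A j) := by exact_mod_cast this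
    nlinarith
  have hm' : ∀ᶠ j in 𝓕, ∀ g ∈ F, ∀ h ∈ F, permDist (φ (g * h) j) (φ g j * φ h j) < ε := by
    rw [Filter.eventually_all_finset]
    intro g hg
    rw [Filter.eventually_all_finset]
    exact hm g hg
  have hn' : ∀ᶠ j in 𝓕, ∀ g ∈ F, g ≠ 1 → 1 - ε < permDist (φ g j) 1 := by
    rw [Filter.eventually_all_finset]
    exact hn
  obtain ⟨j, hj1, hj2⟩ := (hm'.and hn').exists
  exact ⟨A j, inferInstance, inferInstance, fun p => φ p j, by simp [h2], hj1, hj2⟩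
end

/-- finitary relative soficity -/
def RelSof (U : Type*) [Group U] (V : Subgroup U) : Prop :=
  ∀ (F : Finset U) (ε : ℝ), 0 < ε → ∃ (A : Type) (B : Type) (_ : Finite A) (_ : Nonempty A)
    (_ : Finite B) (φ : U → Equiv.Perm A) (β : A → B),
    (∀ g ∈ F, ∀ h ∈ F, (Set.ncard {a | φ (g * h) a ≠ φ g (φ h a)} : ℝ) ≤ ε * Nat.card A) ∧
    (∀ g ∈ F, g ≠ 1 → (Set.ncard {a | φ g a = a} : ℝ) ≤ ε * Nat.card A) ∧
    (∀ g ∈ F, g ∈ V → (Set.ncard {a | β (φ g a) ≠ β a} : ℝ) ≤ ε * Nat.card A) ∧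
    (∀ g ∈ F, g ∉ V → (Set.ncard {a | β (φ g a) = β a} : ℝ) ≤ ε * Nat.card A)

theorem RelSof.top {L : Type*} [Group L] (hL : IsSofic L) : RelSof L ⊤ := by
  intro F ε hε
  obtain ⟨A, hA, hA', φ, -, h1, h2⟩ := hL F ε hε
  have hc : (0 : ℝ) < Nat.card A := by exact_mod_cast Nat.card_pos
  refine ⟨A, Unit, hA, hA', inferInstance, φ, fun _ => (), ?_, ?_, ?_, ?_⟩
  · intro g hg h hh
    have := h1 g hg h hh
    unfold permDist at this
    rw [div_lt_iff₀ hc] at this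
    exact this.le
  · intro g hg hg1
    have := h2 g hg hg1
    unfold permDist at this
    rw [lt_div_iff₀ hc] at this
    have e := Set.ncard_add_ncard_compl {a | φ g a ≠ (1 : Equiv.Perm A) a}
    have hs : ({a | φ g a ≠ (1 : Equiv.Perm A) a})ᶜ = {a | φ g a = a} := by
      ext a; simp
    rw [hs] at e
    have t : (Set.ncard {a | φ g a ≠ (1 : Equiv.Perm A) a} : ℝ) +
      Set.ncard {a | φ g a = a} = Nat.card A := by exact_mod_cast e
    linarith
  · intro g hg _
    simp
    positivity
  · intro g hg h
    simp at h

open Classical in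
/-- passage to the filter form -/
theorem RelSof.filter {U : Type*} [Group U] {V : Subgroup U} (hU : RelSof U V) :
    ∃ (A : Finset U × ℕ → Type) (B : Finset U × ℕ → Type) (_ : ∀ j, Finite (A j))
      (_ : ∀ j, Nonempty (A j)) (_ : ∀ j, Finite (B j)) (φ : ∀ j, U → Equiv.Perm (A j))
      (β : ∀ j, A j → B j),
      (∀ g h, ∀ᶠ x in MF atTop A, φ x.1 (g * h) x.2 = φ x.1 g (φ x.1 h x.2)) ∧
      (∀ g, g ≠ 1 → ∀ᶠ x in MF atTop A, φ x.1 g x.2 ≠ x.2) ∧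
      (∀ g ∈ V, ∀ᶠ x in MF atTop A, β x.1 (φ x.1 g x.2) = β x.1 x.2) ∧
      (∀ g ∉ V, ∀ᶠ x in MF atTop A, β x.1 (φ x.1 g x.2) ≠ β x.1 x.2) := by
  choose A B hA hA' hB φ β h1 h2 h3 h4 using 
    fun j : Finset U × ℕ => hU j.1 (1 / ((j.2 : ℝ) + 1)) (by positivity)
  have key : ∀ δ : ℝ, 0 < δ → ∀ g h : U, ∀ᶠ j : Finset U × ℕ in atTop, 
      g ∈ j.1 ∧ h ∈ j.1 ∧ 1 / ((j.2 : ℝ) + 1) ≤ δ := by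
    intro δ hδ g h
    obtain ⟨n, hn⟩ := exists_nat_one_div_lt hδ
    filter_upwards [eventually_ge_atTop (({g, h} : Finset U), n)] with j hj
    obtain ⟨ha, hb⟩ := Prod.mk_le_mk.1 (show (({g, h} : Finset U), n) ≤ (j.1, j.2) from hj)
    refine ⟨ha (by simp), ha (by simp), ?_⟩
    refine le_trans ?_ hn.le
    gcongr
  refine ⟨A, B, hA, hA', hB, φ, β, ?_, ?_, ?_, ?_⟩
  · intro g h
    rw [eventually_MF]
    intro δ hδ
    filter_upwards [key δ hδ g h] with j hj
    refine (h1 j g hj.1 h hj.2.1).trans ?_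
    gcongr
    exact hj.2.2
  · intro g h
    rw [eventually_MF]
    intro δ hδ
    filter_upwards [key δ hδ g g] with j hj
    simp only [ne_eq, not_not]
    refine (h2 j g hj.1 h).trans ?_
    gcongr
    exact hj.2.2
  · intro g h
    rw [eventually_MF]
    intro δ hδ
    filter_upwards [key δ hδ g g] with j hj
    refine (h3 j g hj.1 h).trans ?_
    gcongr
    exact hj.2.2
  · intro g h
    rw [eventually_MF]
    intro δ hδ
    filter_upwards [key δ hδ g g] with j hj
    simp only [ne_eq, not_not]
    refine (h4 j g hj.1 h).trans ?_
    gcongr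
    exact hj.2.2
open Classical in
theorem fibcount {A Ω : Type*} [Finite A] [Finite Ω] (D : Set (A × Ω)) (N : Set A) (ε : ℝ)
    (hε : 0 < ε)
    (hN : (N.ncard : ℝ) ≤ ε / 2 * Nat.card A)
    (hD : ∀ a ∉ N, (Set.ncard {s | (a, s) ∈ D} : ℝ) ≤ ε / 2 * Nat.card Ω) :
    (D.ncard : ℝ) ≤ ε * Nat.card (A × Ω) := by
  have := Fintype.ofFinite A
  have := Fintype.ofFinite Ω
  have h1 : D.ncard = ∑ a : A, Set.ncard {s | (a, s) ∈ D} := by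
    simp only [Set.ncard_eq_toFinset_card', Finset.card_eq_sum_ones,
      Finset.sum_filter, Set.toFinset_ofPred]
    rw [← Fintype.sum_prod_type' (f := fun a s => if (a, s) ∈ D then 1 else 0),
      ← Finset.sum_filter]
    congr 1
    ext x; simp
  have h2 : ∀ a : A, (Set.ncard {s | (a, s) ∈ D} : ℝ) ≤ 
      (if a ∈ N then 1 else 0) * Nat.card Ω + ε / 2 * Nat.card Ω := by
    intro a
    split_ifs with ha
    · have : (Set.ncard {s | (a, s) ∈ D} : ℝ) ≤ Nat.card Ω := by
        exact_mod_cast Set.ncard_le_card _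
      have : 0 ≤ ε / 2 * Nat.card Ω := by positivity
      linarith
    · simpa using hD a ha
  have h3 : (∑ a : A, if a ∈ N then (1 : ℝ) else 0) = N.ncard := by
    rw [Finset.sum_boole, Set.ncard_eq_toFinset_card']
    congr 2
    ext; simp
  rw [h1, Nat.card_prod]
  push_cast
  refine (Finset.sum_le_sum fun a _ => h2 a).trans ?_
  rw [Finset.sum_add_distrib, ← Finset.sum_mul, h3]
  simp only [Finset.sum_const, Finset.card_univ, nsmul_eq_mul, ← Nat.card_eq_fintype_card]
  have : (N.ncard : ℝ) * Nat.card Ω ≤ ε / 2 * Nat.card A * Nat.card Ω := by gcongr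
  nlinarith

theorem RelSof.prod {L K : Type*} [Group L] [Group K] {H : Subgroup L} (hL : RelSof L H)
    (hK : IsSofic K) : RelSof (L × K) (H.prod ⊤) := by
  classical
  intro F ε hε
  obtain ⟨A, B, hA, hA', hB, φ, β, h1, h2, h3, h4⟩ := hL (F.image Prod.fst) (ε/2) (by positivity)
  obtain ⟨A2, B2, hA2, hA2', hB2, ψ, -, k1, k2, -, -⟩ :=
    (RelSof.top hK) (F.image Prod.snd) (ε/2) (by positivity)
  have m1 : ∀ g ∈ F, g.1 ∈ F.image Prod.fst := fun g hg => Finset.mem_image_of_mem _ hg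
  have m2 : ∀ g ∈ F, g.2 ∈ F.image Prod.snd := fun g hg => Finset.mem_image_of_mem _ hg
  refine ⟨A × A2, B, inferInstance, inferInstance, hB, fun g => (φ g.1).prodCongr (ψ g.2),
    fun x => β x.1, ?_, ?_, ?_, ?_⟩
  · intro g hg h hh
    refine fibcount _ _ ε hε (h1 _ (m1 g hg) _ (m1 h hh)) ?_
    intro a ha
    refine le_trans ?_ (k1 _ (m2 g hg) _ (m2 h hh))
    norm_cast
    refine Set.ncard_le_ncard ?_ (Set.toFinite _)
    intro s hs hs2
    simp only [Set.mem_ofPred_eq, not_not] at ha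
    apply hs
    simp [ha, hs2]
  · intro g hg hg1
    by_cases hl : g.1 = 1
    · have hk : g.2 ≠ 1 := fun h => hg1 (Prod.ext hl h)
      refine fibcount _ ∅ ε hε (by simp; positivity) ?_
      intro a _
      refine le_trans ?_ (k2 _ (m2 g hg) hk)
      norm_cast
      refine Set.ncard_le_ncard ?_ (Set.toFinite _)
      intro s hs
      exact congrArg Prod.snd hs
    · refine fibcount _ _ ε hε (h2 _ (m1 g hg) hl) ?_
      intro a ha
      have : {s | (a, s) ∈ {x : A × A2 | ((φ g.1).prodCongr (ψ g.2)) x = x}} = ∅ := by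
        ext s
        simp only [Set.mem_ofPred_eq, Set.mem_empty_iff_false, iff_false]
        intro h
        exact ha (congrArg Prod.fst h)
      rw [this, Set.ncard_empty]
      push_cast; positivity
  · intro g hg hgV
    refine fibcount _ _ ε hε (h3 _ (m1 g hg) hgV.1) ?_
    intro a ha
    have : {s | (a, s) ∈ {x : A × A2 | β (((φ g.1).prodCongr (ψ g.2)) x).1 ≠ β x.1}} = ∅ := by
      ext s
      simp only [Set.mem_ofPred_eq, Set.mem_empty_iff_false, iff_false]
      exact ha
    rw [this, Set.ncard_empty]
    push_cast; positivity
  · intro g hg hgV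
    have hgV' : g.1 ∉ H := fun h => hgV ⟨h, trivial⟩
    refine fibcount _ _ ε hε (h4 _ (m1 g hg) hgV') ?_
    intro a ha
    have : {s | (a, s) ∈ {x : A × A2 | β (((φ g.1).prodCongr (ψ g.2)) x).1 = β x.1}} = ∅ := by
      ext s
      simp only [Set.mem_ofPred_eq, Set.mem_empty_iff_false, iff_false]
      exact ha
    rw [this, Set.ncard_empty]
    push_cast; positivity

theorem up_mk_eq {ι : Type*} (ω : Ultrafilter ι) {G : ι → Type*} [∀ i, Group (G i)]
    (a b : ∀ i, G i) : QuotientGroup.mk' (upKer ω G) a = QuotientGroup.mk' (upKer ω G) b ↔ 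
      ∀ᶠ i in (ω : Filter ι), a i = b i := by
  have : QuotientGroup.mk' (upKer ω G) a = QuotientGroup.mk' (upKer ω G) b ↔ 
     ∀ᶠ i in (ω : Filter ι), (a⁻¹ * b) i = 1 := QuotientGroup.eq
  rw [this]
  refine eventually_congr (Eventually.of_forall fun i => ?_)
  rw [Pi.mul_apply, Pi.inv_apply, inv_mul_eq_one]

theorem RelSof.ultra {ι : Type*} (ω : Ultrafilter ι) {G : ι → Type*} [∀ i, Group (G i)]
    (V : ∀ i, Subgroup (G i)) (h : ∀ i, RelSof (G i) (V i)) :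
    RelSof (Ultraproduct ω G) (upSubgroup ω V) := by
  classical
  intro F ε hε
  let mk : (∀ i, G i) →* Ultraproduct ω G := QuotientGroup.mk' (upKer ω G)
  have hmk : ∀ a b, mk a = mk b ↔ ∀ᶠ i in (ω : Filter ι), a i = b i := up_mk_eq ω
  have hsurj : ∀ u, ∃ a, mk a = u := QuotientGroup.mk'_surjective _
  choose r hr using hsurj
  have c1 : ∀ g ∈ F, ∀ h ∈ F, ∀ᶠ i in (ω : Filter ι), r (g * h) i = r g i * r h i := by
    intro g _ h _
    have := (hmk (r (g * h)) (r g * r h)).1 (by rw [map_mul, hr, hr, hr])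
    exact this
  have c2 : ∀ g ∈ F, ∀ᶠ i in (ω : Filter ι), g ≠ 1 → r g i ≠ 1 := by
    intro g _
    by_cases hg : g = 1
    · exact Eventually.of_forall fun i h => absurd hg h
    have : ¬ ∀ᶠ i in (ω : Filter ι), r g i = 1 := by
      intro h
      apply hg
      rw [← hr g, ← map_one mk]
      exact (hmk _ _).2 h
    rw [← Ultrafilter.eventually_not] at this
    filter_upwards [this] with i hi _ using hi
  have c3 : ∀ g ∈ F, ∀ᶠ i in (ω : Filter ι), g ∈ upSubgroup ω V → r g i ∈ V i := by
    intro g _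
    by_cases hg : g ∈ upSubgroup ω V
    · obtain ⟨v, hv, hvg⟩ := id hg
      have := (hmk v (r g)).1 (by rw [hr]; exact hvg)
      filter_upwards [this] with i hi _
      rw [← hi]
      exact hv i trivial
    · exact Eventually.of_forall fun i h => absurd h hg
  have c4 : ∀ g ∈ F, ∀ᶠ i in (ω : Filter ι), g ∉ upSubgroup ω V → r g i ∉ V i := by
    intro g _
    by_cases hg : g ∈ upSubgroup ω V
    · exact Eventually.of_forall fun i h => absurd hg h
    have : ¬ ∀ᶠ i in (ω : Filter ι), r g i ∈ V i := by
      intro h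
      apply hg
      refine ⟨fun i => if r g i ∈ V i then r g i else 1, ?_, ?_⟩
      · intro i _
        simp only
        split_ifs with h
        · exact h
        · exact (V i).one_mem
      · refine Eq.trans ?_ (hr g)
        refine (hmk _ _).2 ?_
        filter_upwards [h] with i hi
        rw [if_pos hi]
    rw [← Ultrafilter.eventually_not] at this
    filter_upwards [this] with i hi _ using hi
  have c1' : ∀ᶠ i in (ω : Filter ι), ∀ g ∈ F, ∀ h ∈ F, r (g * h) i = r g i * r h i := by
    rw [Filter.eventually_all_finset]
    intro g hg
    rw [Filter.eventually_all_finset]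
    exact c1 g hg
  obtain ⟨i, d1, d2, d3, d4⟩ := (c1'.and (((Filter.eventually_all_finset F).2 c2).and
    (((Filter.eventually_all_finset F).2 c3).and
    ((Filter.eventually_all_finset F).2 c4)))).exists
  obtain ⟨A, B, hA, hA', hB, φ, β, h1, h2, h3, h4⟩ := h i (F.image fun g => r g i) ε hε
  have m : ∀ g ∈ F, r g i ∈ F.image fun g => r g i := fun g hg => Finset.mem_image_of_mem _ hg
  refine ⟨A, B, hA, hA', hB, fun g => φ (r g i), β, ?_, ?_, ?_, ?_⟩
  · intro g hg h hh
    have := h1 _ (m g hg) _ (m h hh)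
    rw [← d1 g hg h hh] at this
    exact this
  · intro g hg hg1
    exact h2 _ (m g hg) (d2 g hg hg1)
  · intro g hg hg1
    exact h3 _ (m g hg) (d3 g hg hg1)
  · intro g hg hg1
    exact h4 _ (m g hg) (d4 g hg hg1)

open Classical in
theorem folner' {L : Type*} [Group L] (H : Subgroup L) (hH : IsAmenable H) (F : Finset L)
    (ε : ℝ) (hε : 0 < ε) : ∃ T : Finset L, T.Nonempty ∧ (∀ t ∈ T, t ∈ H) ∧ ∀ h ∈ F, h ∈ H →
      (((T ∪ T.image (· * h)).card : ℕ) : ℝ) ≤ (1 + ε) * T.card := by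
  obtain ⟨T, hT, hST⟩ := folner hH (insert 1 ((F.subtype (· ∈ H)).image (·⁻¹))) ε hε
  have hinj : Function.Injective (fun t : H => (t : L)⁻¹) := by
    intro a b h
    exact Subtype.ext (inv_injective h)
  refine ⟨T.image (fun t : H => (t : L)⁻¹), hT.image _, ?_, ?_⟩
  · intro t ht
    obtain ⟨s, _, rfl⟩ := Finset.mem_image.1 ht
    exact inv_mem s.2
  · intro h hF hh
    rw [Finset.card_image_of_injective T hinj]
    refine le_trans ?_ hST.le
    norm_cast
    rw [← Finset.card_image_of_injective _ hinj]
    refine Finset.card_le_card ?_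
    intro x hx
    rw [Finset.mem_union] at hx
    rw [Finset.mem_image]
    rcases hx with hx | hx
    · obtain ⟨s, hs, rfl⟩ := Finset.mem_image.1 hx
      exact ⟨s, by rw [← one_mul s]; exact Finset.mul_mem_mul (by simp) hs, rfl⟩
    · obtain ⟨y, hy, rfl⟩ := Finset.mem_image.1 hx
      obtain ⟨s, hs, rfl⟩ := Finset.mem_image.1 hy
      refine ⟨(⟨h, hh⟩ : H)⁻¹ * s, Finset.mul_mem_mul ?_ hs, by simp⟩
      refine Finset.mem_insert_of_mem (Finset.mem_image_of_mem _ ?_)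
      simpa using hF

theorem RelSof.amen {L : Type*} [Group L] (hL : IsSofic L) (H : Subgroup L) (hH : IsAmenable H) :
    RelSof L H := by
  classical
  intro F ε hε
  obtain ⟨T, hT, hTH, hF⟩ := folner' H hH F (ε / 4) (by positivity)
  obtain ⟨A, B, hA, hA', hB, φ, -, h1, h2, -, -⟩ := (RelSof.top hL).filter
  set E : Finset L := T ∪ T * F with hE
  have g1 : ∀ᶠ x in MF atTop A, ∀ t ∈ T ∪ F, ∀ g ∈ F,
      φ x.1 (t * g) x.2 = φ x.1 t (φ x.1 g x.2) := by
    rw [Filter.eventually_all_finset]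
    intro t _
    rw [Filter.eventually_all_finset]
    intro g _
    exact h1 t g
  have g2 : ∀ᶠ x in MF atTop A, ∀ s ∈ E, ∀ t ∈ E, φ x.1 s x.2 = φ x.1 t x.2 → s = t := by
    rw [Filter.eventually_all_finset]
    intro s _
    rw [Filter.eventually_all_finset]
    intro t _
    by_cases hst : s = t
    · exact Eventually.of_forall fun x _ => hst
    filter_upwards [h1 s (s⁻¹ * t), h2 (s⁻¹ * t) (by rwa [ne_eq, inv_mul_eq_one])] with x hx1 hx2 hx3
    exfalso
    rw [mul_inv_cancel_left, ← hx3] at hx1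
    exact hx2 ((φ x.1 s).injective hx1.symm)
  have g3 : ∀ᶠ x in MF atTop A, ∀ g ∈ F, g ≠ 1 → φ x.1 g x.2 ≠ x.2 := by
    rw [Filter.eventually_all_finset]
    intro g _
    by_cases hg : g = 1
    · exact Eventually.of_forall fun x h => absurd hg h
    · filter_upwards [h2 g hg] with x hx _ using hx
  obtain ⟨j, hj⟩ := (eventually_MF.1 (g1.and (g2.and g3)) (ε/2) (by positivity)).exists
  simp only at hj
  set N := {a : A j | ¬ _} with hNdef
  clear_value N
  have hgood : ∀ a ∉ N, (∀ t ∈ T ∪ F, ∀ g ∈ F, φ j (t * g) a = φ j t (φ j g a)) ∧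
      (∀ s ∈ E, ∀ t ∈ E, φ j s a = φ j t a → s = t) ∧ (∀ g ∈ F, g ≠ 1 → φ j g a ≠ a) := by
    intro a ha
    rw [hNdef, Set.mem_ofPred_eq, not_not] at ha
    exact ha
  clear hNdef g1 g2 g3
  have := Fintype.ofFinite (A j)
  obtain ⟨n, ⟨e⟩⟩ := Finite.exists_equiv_fin (A j)
  let X : A j → Finset (A j) := fun a => T.image (fun t => φ j t a)
  have hX : ∀ a, (X a).Nonempty := fun a => hT.image _
  have hempty : ∀ D : Set (A j × Equiv.Perm (A j)), (∀ a ∉ N, ∀ s, (a, s) ∉ D) → 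
      (D.ncard : ℝ) ≤ ε * Nat.card (A j × Equiv.Perm (A j)) := by
    intro D hD
    refine fibcount D N ε hε hj ?_
    intro a ha
    have : {s | (a, s) ∈ D} = ∅ := by
      ext s; simpa using hD a ha s
    rw [this, Set.ncard_empty]
    push_cast; positivity
  refine ⟨A j × Equiv.Perm (A j), A j, inferInstance, inferInstance, inferInstance, 
    fun g => (φ j g).prodCongr 1, fun x => am e x.2 (X x.1) (hX _), ?_, ?_, ?_, ?_⟩
  · intro g hg h hh
    apply hempty
    intro a ha s hs
    apply hs
    simp [(hgood a ha).1 g (Finset.mem_union_right _ hg) h hh]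
  · intro g hg hg1
    apply hempty
    intro a ha s hs
    exact (hgood a ha).2.2 g hg hg1 (congrArg Prod.fst hs)
  · intro h hh hhH
    refine fibcount _ N ε hε hj ?_
    intro a ha
    obtain ⟨i1, i2, -⟩ := hgood a ha
    have hXY : X (φ j h a) = (T.image (· * h)).image (fun t => φ j t a) := by
      rw [Finset.image_image]
      refine Finset.image_congr ?_
      intro t ht
      exact (i1 t (Finset.mem_union_left _ ht) h hh).symm
    have hEs : T ∪ T.image (· * h) ⊆ E := by
      refine Finset.union_subset_union_right ?_
      intro x hx
      obtain ⟨t, ht, rfl⟩ := Finset.mem_image.1 hx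
      exact Finset.mul_mem_mul ht hh
    have hinj : Set.InjOn (fun t => φ j t a) (T ∪ T.image (· * h) : Finset L) := by
      intro s hs t ht hst
      exact i2 s (hEs hs) t (hEs ht) hst
    have u1 : (X a ∪ X (φ j h a)).card = (T ∪ T.image (· * h)).card := by
      rw [hXY, ← Finset.image_union, Finset.card_image_of_injOn hinj]
    have u2 : (X a).card = T.card := Finset.card_image_of_injOn
      (hinj.mono (by exact_mod_cast Finset.subset_union_left))
    have u3 : (X (φ j h a)).card = T.card := by
      rw [hXY, Finset.card_image_of_injOn
        (hinj.mono (by exact_mod_cast Finset.subset_union_right)),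
        Finset.card_image_of_injective _ (mul_left_injective h)]
    have u4 := Finset.card_union_add_card_inter (X a) (X (φ j h a))
    have u5 := Finset.card_sdiff_add_card_eq_card
      (Finset.inter_subset_union (s := X a) (t := X (φ j h a)))
    have u6 := am_ne_card e (X a) (hX a) (X (φ j h a)) (hX _)
    have u7 := hF h hh hhH
    have u8 : 0 < T.card := hT.card_pos
    have u9 : T.card ≤ (X a ∪ X (φ j h a)).card := u2 ▸ Finset.card_le_card Finset.subset_union_left
    rw [← u1] at u7
    have key : (Set.ncard {s | am e s (X (φ j h a)) (hX _) ≠ am e s (X a) (hX _)} : ℝ) ≤ 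
        ε / 2 * Nat.card (Equiv.Perm (A j)) := by
      have hs : Set.ncard {s | am e s (X (φ j h a)) (hX _) ≠ am e s (X a) (hX _)} = 
        (Finset.univ.filter fun σ => am e σ (X a) (hX a) ≠ am e σ (X (φ j h a)) (hX _)).card := by
        rw [← Set.ncard_coe_finset]
        congr 1
        ext s
        simp [eq_comm]
      rw [hs, Nat.card_eq_fintype_card]
      generalize (Finset.univ.filter fun σ => am e σ (X a) (hX a) ≠ am e σ (X (φ j h a)) (hX _)).card = c at *
      generalize (X a ∪ X (φ j h a)).card = u at *
      generalize ((X a ∪ X (φ j h a)) \ (X a ∩ X (φ j h a))).card = d at *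
      generalize (X a ∩ X (φ j h a)).card = i at *
      generalize Fintype.card (Equiv.Perm (A j)) = o at *
      generalize T.card = t at *
      have v1 : (c : ℝ) * u ≤ d * o := by exact_mod_cast u6
      have v2 : (d : ℝ) + i = u := by exact_mod_cast u5
      have v3 : (u : ℝ) + i = t + t := by rw [u2, u3] at u4; exact_mod_cast u4
      have v4 : (t : ℝ) ≤ u := by exact_mod_cast u9
      have v5 : (0 : ℝ) < t := by exact_mod_cast u8
      have v6 : (d : ℝ) ≤ ε / 2 * u := by nlinarith
      have v7 : (c : ℝ) * u ≤ (ε / 2 * o) * u := by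
        refine v1.trans ?_
        have : (0 : ℝ) ≤ o := by positivity
        nlinarith
      exact le_of_mul_le_mul_right v7 (by linarith)
    exact key
  · intro g hg hgH
    apply hempty
    intro a ha s hs
    obtain ⟨i1, i2, -⟩ := hgood a ha
    have hs' : am e s (X (φ j g a)) (hX _) = am e s (X a) (hX _) := hs
    have m1 := am_mem e s (X (φ j g a)) (hX _)
    have m2 := am_mem e s (X a) (hX _)
    rw [hs'] at m1
    obtain ⟨t, ht, hta⟩ := Finset.mem_image.1 m1
    obtain ⟨t', ht', hta'⟩ := Finset.mem_image.1 m2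
    rw [← i1 t (Finset.mem_union_left _ ht) g hg] at hta
    have := i2 (t * g) (Finset.mem_union_right _ (Finset.mul_mem_mul ht hg)) t'
      (Finset.mem_union_left _ ht') (hta.trans hta'.symm)
    apply hgH
    rw [← mul_mem_cancel_left (hTH t ht), this]
    exact (hTH t' ht')
theorem trivial_spacer : True := trivial

/-- reduced words of bounded length in a free product of groups of order two -/
abbrev BV (S : Type) (N : ℕ) : Type := {l : List S // l.IsChain (· ≠ ·) ∧ l.length ≤ N}

instance (S : Type) [Finite S] (N : ℕ) : Finite (BV S N) := by
  have h : {l : List S | l.IsChain (· ≠ ·) ∧ l.length ≤ N}.Finite :=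
    (List.finite_length_le S N).subset fun l hl => hl.2
  exact h.to_subtype

open Classical in
noncomputable def bstep {S : Type} {N : ℕ} (s : S) (l : BV S N) : BV S N :=
  if h : l.1.head? = some s then ⟨l.1.tail, l.2.1.tail, by have := l.2.2; simp; omega⟩
  else if h2 : l.1.length < N then ⟨s :: l.1, by
    rw [List.isChain_cons]
    refine ⟨?_, l.2.1⟩
    rintro y hy rfl
    exact h hy, h2⟩
  else l

theorem bstep_inv {S : Type} {N : ℕ} (s : S) : Function.Involutive (bstep (N := N) s) := by
  rintro ⟨l, hl, hN⟩
  by_cases h : l.head? = some s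
  · obtain ⟨t, rfl⟩ : ∃ t, l = s :: t := by
      cases l with
      | nil => simp at h
      | cons a t => simp at h; exact ⟨t, by rw [h]⟩
    have h1 : t.head? ≠ some s := by
      intro h
      rw [List.isChain_cons] at hl
      exact hl.1 s h rfl
    have h2 : t.length < N := by simp at hN; omega
    simp [bstep, h1, h2]
  · by_cases h2 : l.length < N
    · simp [bstep, h, h2]
    · simp [bstep, h, h2]

noncomputable def brho {S : Type} {N : ℕ} (s : S) : Equiv.Perm (BV S N) := (bstep_inv s).toPerm

theorem brho_mul_self {S : Type} {N : ℕ} (s : S) : brho (N := N) s * brho s = 1 := by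
  ext x : 1
  exact bstep_inv s x

theorem brho_word {S : Type} {N : ℕ} (w : List S) (hw : w.IsChain (· ≠ ·)) (hN : w.length ≤ N) :
    (w.map (brho (N := N))).prod ⟨[], List.isChain_nil, by simp⟩ = ⟨w, hw, hN⟩ := by
  induction w with
  | nil => simp
  | cons a t ih =>
    have h2 : t.length < N := by simp at hN; omega
    have h3 := hw
    rw [List.isChain_cons] at h3
    have h1 : t.head? ≠ some a := fun h => h3.1 a h rfl
    rw [List.map_cons, List.prod_cons, Equiv.Perm.mul_apply, ih h3.2 h2.le]
    show bstep a _ = _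
    simp [bstep, h1, h2]

theorem brho_ne {S : Type} {N : ℕ} (w : List S) (hw : w.IsChain (· ≠ ·)) (hN : w.length ≤ N)
    (h : w ≠ []) : (w.map (brho (N := N))).prod ≠ 1 := by
  intro h1
  have := brho_word w hw hN
  rw [h1] at this
  exact h (congrArg Subtype.val this).symm

section
variable {J U : Type*} {A B : J → Type} (N : J → ℕ) (φ : ∀ j, U → Equiv.Perm (A j))
  (β : ∀ j, A j → B j)

abbrev Yt (N : J → ℕ) (B : J → Type) (j : J) : Type :=
  Equiv.Perm (BV (Fin (N j + 1) × B j) (N j))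

noncomputable def rh (k : ℕ) (j : J) (b : B j) : Yt N B j := brho (Fin.ofNat (N j + 1) k, b)

noncomputable def tau (k : ℕ) (j : J) : Equiv.Perm (A j × Yt N B j) :=
  Equiv.prodShear 1 (fun a => Equiv.mulLeft (rh N k j (β j a)))

theorem tau_apply (k : ℕ) (j : J) (x : A j × Yt N B j) :
    tau N β k j x = (x.1, rh N k j (β j x.1) * x.2) := rfl

theorem tau_inv_apply (k : ℕ) (j : J) (x : A j × Yt N B j) :
    (tau N β k j)⁻¹ x = (x.1, rh N k j (β j x.1) * x.2) := by
  rw [Equiv.Perm.inv_eq_iff_eq, tau_apply]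
  simp only
  rw [← mul_assoc, rh, brho_mul_self, one_mul]

def ph (u : U) (j : J) : Equiv.Perm (A j × Yt N B j) := (φ j u).prodCongr 1

theorem ph_apply (u : U) (j : J) (x : A j × Yt N B j) : ph N φ u j x = (φ j u x.1, x.2) := rfl

noncomputable def word (l : List (ℕ × U)) : ∀ j, Equiv.Perm (A j × Yt N B j) :=
  (l.map fun x => (tau N β x.1)⁻¹ * ph N φ x.2 * tau N β x.1).prod

theorem word_cons (c : ℕ × U) (l : List (ℕ × U)) (j : J) (x : A j × Yt N B j) :
    word N φ β (c :: l) j x = (φ j c.2 (word N φ β l j x).1, 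
      rh N c.1 j (β j (φ j c.2 (word N φ β l j x).1)) * 
        (rh N c.1 j (β j (word N φ β l j x).1) * (word N φ β l j x).2)) := by
  rw [word, List.map_cons, List.prod_cons]
  change (tau N β c.1 j)⁻¹ (ph N φ c.2 j (tau N β c.1 j (word N φ β l j x))) = _
  rw [tau_inv_apply, ph_apply, tau_apply]

theorem ofNat_ne {n a b : ℕ} (h : a ≠ b) (ha : a ≤ n) (hb : b ≤ n) :
    Fin.ofNat (n + 1) a ≠ Fin.ofNat (n + 1) b := by
  intro h2
  have := congrArg Fin.val h2
  simp only [Fin.val_ofNat] at this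
  rw [Nat.mod_eq_of_lt (by omega), Nat.mod_eq_of_lt (by omega)] at this
  exact h this

theorem word_spec {𝓕 : Filter J} [∀ j, Finite (A j)] [∀ j, Finite (B j)]
    (hN : ∀ n, ∀ᶠ j in 𝓕, n ≤ N j) (l : List (ℕ × U)) (hl : l.IsChain (fun x y => x.1 ≠ y.1))
    (h4 : ∀ c ∈ l, ∀ᶠ x in MF 𝓕 A, β x.1 (φ x.1 c.2 x.2) ≠ β x.1 x.2) :
    ∀ᶠ x in MF 𝓕 (fun j => A j × Yt N B j), ∃ s : List (Fin (N x.1 + 1) × B x.1),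
      s.length = 2 * l.length ∧ s.IsChain (· ≠ ·) ∧
      (word N φ β l x.1 x.2).2 = (s.map brho).prod * x.2.2 ∧
      (∀ c ∈ l.head?, s.head? = some (Fin.ofNat _ c.1, β _ (word N φ β l x.1 x.2).1)) := by
  induction l with
  | nil =>
    refine Eventually.of_forall fun x => ⟨[], by simp, by simp, ?_, by simp⟩
    simp [word]
  | cons c l ih =>
    rw [List.isChain_cons] at hl
    have ih' := ih hl.2 fun c hc => h4 c (List.mem_cons_of_mem _ hc)
    have h5 := (tendsto_sg (𝓕 := 𝓕) (word N φ β l)).eventually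
      ((tendsto_proj (Yt N B)).eventually (h4 c List.mem_cons_self))
    have h6 : ∀ᶠ x in MF 𝓕 (fun j => A j × Yt N B j), ∀ d ∈ l.head?, c.1 ≤ N x.1 ∧ d.1 ≤ N x.1 := by
      cases l with
      | nil => simp
      | cons d l => 
        filter_upwards [eventually_MF_of (hN c.1), eventually_MF_of (hN d.1)] with x h1 h2
        simp [h1, h2]
    filter_upwards [ih', h5, h6] with x ⟨s, s1, s2, s3, s4⟩ hx h6
    simp only [sg] at hx
    refine ⟨(Fin.ofNat _ c.1, β _ (φ x.1 c.2 (word N φ β l x.1 x.2).1)) :: 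
      (Fin.ofNat _ c.1, β _ (word N φ β l x.1 x.2).1) :: s, ?_, ?_, ?_, ?_⟩
    · simp [s1]; omega
    · rw [List.isChain_cons, List.isChain_cons]
      refine ⟨?_, ?_, s2⟩
      · intro y hy
        simp only [List.head?_cons, Option.mem_def, Option.some.injEq] at hy
        rw [← hy]
        intro h
        exact hx (congrArg Prod.snd h)
      · intro y hy
        cases l with
        | nil =>
          have : s = [] := by simpa using s1
          simp [this] at hy
        | cons d l =>
          have h7 := s4 d (by simp)
          rw [Option.mem_def] at hy
          rw [h7, Option.some.injEq] at hy
          rw [← hy]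
          intro h
          obtain ⟨h8, h9⟩ := h6 d (by simp)
          exact ofNat_ne (hl.1 d (by simp)) h8 h9 (congrArg Prod.fst h)
    · rw [word_cons, s3]
      simp only [List.map_cons, List.prod_cons, mul_assoc]
      rfl
    · intro d hd
      simp only [List.head?_cons, Option.mem_def, Option.some.injEq] at hd
      subst hd
      rw [word_cons]
      simp
end

theorem mainThm {H : Type*} [Group H] {G : ℕ → Type*} [∀ k, Group (G k)] (ι : ∀ k, H →* G k)
    (hι : ∀ k, Function.Injective (ι k)) {U : Type*} [Group U] (V : Subgroup U)
    (hU : RelSof U V) (π : ∀ k, G k →* U) (hinj : ∀ k, Function.Injective (π k))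
    (hV : ∀ k g, π k g ∈ V ↔ g ∈ (ι k).range)
    (hc : ∀ (h : H) (k k' : ℕ), π k (ι k h) = π k' (ι k' h)) : IsSofic (Monoid.PushoutI ι) := by
  classical
  obtain ⟨A, B, hA, hA', hB, φ, β, h1, h2, h3, h4⟩ := hU.filter
  let N : Finset U × ℕ → ℕ := Prod.snd
  have hN : ∀ n, ∀ᶠ j : Finset U × ℕ in atTop, n ≤ N j := by
    intro n
    filter_upwards [eventually_ge_atTop ((∅ : Finset U), n)] with j hj
    exact hj.2
  clear_value N
  let A' : Finset U × ℕ → Type := fun j => A j × Yt N B j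
  let mk : (∀ j, Equiv.Perm (A' j)) →* (∀ j, Equiv.Perm (A' j)) ⧸ upN atTop A' :=
    QuotientGroup.mk' _
  have hmk : ∀ σ τ, mk σ = mk τ ↔ ∀ᶠ x in MF atTop A', σ x.1 x.2 = τ x.1 x.2 := fun σ τ => mk_eq
  let θ : U →* (∀ j, Equiv.Perm (A' j)) ⧸ upN atTop A' :=
    MonoidHom.mk' (fun u => mk (ph N φ u)) (by
      intro u v
      rw [← map_mul, hmk]
      filter_upwards [(tendsto_proj (Yt N B)).eventually (h1 u v)] with x hx
      rw [Pi.mul_apply, Equiv.Perm.mul_apply, ph_apply, ph_apply, ph_apply]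
      exact Prod.ext hx rfl)
  have hθ : ∀ u, θ u = mk (ph N φ u) := fun u => rfl
  let f : ∀ k, G k →* (∀ j, Equiv.Perm (A' j)) ⧸ upN atTop A' := fun k =>
    (MulAut.conj (mk (tau N β k))⁻¹).toMonoidHom.comp (θ.comp (π k))
  have hf : ∀ k g, f k g = mk ((tau N β k)⁻¹ * ph N φ (π k g) * tau N β k) := by
    intro k g
    simp [f, hθ]
  let Θ := Monoid.PushoutI.lift (φ := ι) f (θ.comp ((π 0).comp (ι 0))) (by
    intro k
    ext h
    change f k (ι k h) = θ (π 0 (ι 0 h))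
    rw [hf, hθ, hc h 0 k, hmk]
    filter_upwards [(tendsto_proj (Yt N B)).eventually 
      (h3 (π k (ι k h)) ((hV k _).2 ⟨h, rfl⟩))] with x hx
    change (tau N β k x.1)⁻¹ (ph N φ _ x.1 (tau N β k x.1 x.2)) = _
    rw [tau_inv_apply, ph_apply, tau_apply, ph_apply]
    refine Prod.ext rfl ?_
    simp only at hx ⊢
    rw [hx, ← mul_assoc, rh, brho_mul_self, one_mul])
  refine isSofic_of_hom Θ ?_
  intro p hp
  obtain ⟨d⟩ := Monoid.PushoutI.NormalWord.transversal_nonempty ι hι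
  obtain ⟨w, rfl⟩ : ∃ w : Monoid.PushoutI.NormalWord d, w.prod = p :=
    ⟨Monoid.PushoutI.NormalWord.equiv p, Monoid.PushoutI.NormalWord.equiv.symm_apply_apply p⟩
  let l : List (ℕ × U) := w.toList.map fun x => (x.1, π x.1 x.2)
  have hΘ : Θ w.prod = mk (ph N φ (π 0 (ι 0 w.head)) * word N φ β l) := by
    rw [Monoid.PushoutI.NormalWord.prod, map_mul, Monoid.PushoutI.lift_base, map_mul]
    congr 1
    rw [Monoid.CoprodI.Word.prod, map_list_prod, map_list_prod, word, map_list_prod]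
    simp only [l, List.map_map]
    congr 1
  refine ⟨_, hΘ, ?_⟩
  by_cases hw : w.toList = []
  · have hl : l = [] := by simp [l, hw]
    have hh : π 0 (ι 0 w.head) ≠ 1 := by
      intro h
      have h0 : w.head = 1 := hι 0 (hinj 0 (by rw [h, map_one, map_one]))
      apply hp
      rw [Monoid.PushoutI.NormalWord.prod, h0, Monoid.CoprodI.Word.prod, hw]
      simp
    filter_upwards [(tendsto_proj (Yt N B)).eventually (h2 _ hh)] with x hx
    intro h
    apply hx
    rw [hl] at h
    exact congrArg Prod.fst h
  · have hl : l ≠ [] := by simpa [l] using hw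
    have hchain : l.IsChain (fun x y => x.1 ≠ y.1) := by
      simp only [l, List.isChain_map]
      exact w.chain_ne
    have hmem : ∀ c ∈ l, c.2 ∉ V := by
      intro c hcl
      obtain ⟨⟨k, g⟩, hkg, rfl⟩ := List.mem_map.1 hcl
      simp only [hV]
      intro hr
      have hg1 := w.ne_one _ hkg
      apply hg1
      have hs := w.normalized k g hkg
      have e := (d.compl k).1 (a₁ := (⟨g, hr⟩, ⟨1, d.one_mem k⟩)) (a₂ := (1, ⟨g, hs⟩)) (by simp)
      exact (congrArg (fun x => (x.2 : G k)) e).symm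
    filter_upwards [word_spec N φ β hN l hchain (fun c hcl => h4 _ (hmem c hcl)),
      eventually_MF_of (hN (2 * l.length))] with x ⟨s, s1, s2, s3, _⟩ hx
    intro h
    have h' := congrArg Prod.snd h
    change (word N φ β l x.1 x.2).2 = x.2.2 at h'
    rw [s3] at h'
    refine brho_ne s s2 (by omega) ?_ (mul_eq_right.1 h')
    rintro rfl
    apply hl
    simpa using s1
end SoficAux

/-- If the family of inclusions `(H < G_k)` of countable groups is consistently
relatively sofic over a sofic group `K`, then the amalgamated free product
`∗_H^{k ∈ ℕ} G_k` is sofic. -/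
theorem isSofic_pushoutI_of_consistentlyRelativelySofic {H : Type*} [Group H]
    {G : ℕ → Type*} [∀ k, Group (G k)] [∀ k, Countable (G k)]
    (ι : ∀ k, H →* G k) (hι : ∀ k, Function.Injective (ι k))
    (K : Type*) [Group K] (hK : IsSofic K)
    (h : ConsistentlyRelativelySofic.{u} ι K) :
    IsSofic (Monoid.PushoutI ι) := by

  obtain ⟨⟨L, Hi, ω, _, hsof, ham, π, hinj, hinter, hcons⟩⟩ := h
  refine SoficAux.mainThm ι hι (upSubgroup ω (fun i => (Hi i).prod (⊤ : Subgroup K)))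
    (SoficAux.RelSof.ultra ω _ fun i =>
      (SoficAux.RelSof.amen (hsof i) (Hi i) (ham i)).prod hK) π hinj ?_ hcons
  intro k g
  constructor
  · intro hg
    have : π k g ∈ Subgroup.map (π k) (Subgroup.map (ι k) ⊤) := by
      rw [← hinter k]
      exact ⟨⟨g, trivial, rfl⟩, hg⟩
    obtain ⟨_, ⟨x, _, rfl⟩, hx⟩ := this
    exact ⟨x, hinj k hx⟩
  · rintro ⟨x, rfl⟩
    have : π k (ι k x) ∈ Subgroup.map (π k) (Subgroup.map (ι k) ⊤) :=
      ⟨_, ⟨x, trivial, rfl⟩, rfl⟩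
    rw [← hinter k] at this
    exact this.2
end
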